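/- arXiv:2307.16029 — 5 statements merged into one kernel-verified Lean document; each statement's English description precedes it below -/
import Mathlib

section
/- Let n ≥ 2 and 0 < s ≤ 1/2. Suppose u ∈ 𝓛^{2s,s}(ℝⁿ×ℝ) is a distributional solution of (∂_t−Δ)^s u = 0 on ℝⁿ×ℝ. Then u is equal almost everywhere to a constant. -/
open MeasureTheory

/-- `ℝⁿ` as Euclidean space. -/
abbrev En (n : ℕ) := EuclideanSpace ℝ (Fin n)

/-- The normalization constant `C_{n,s} = (4π)^{-n/2} / |Γ(-s)|`. -/
noncomputable def Cns (n : ℕ) (s : ℝ) : ℝ :=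
  (4 * Real.pi) ^ (-(n : ℝ) / 2) / |Real.Gamma (-s)|

/-- The right fractional heat operator `(∂_t - Δ)^s_{right}` applied to a function
`φ : ℝⁿ×ℝ → ℂ`, defined by the (symmetrized) singular integral. -/
noncomputable def rightHeat (n : ℕ) (s : ℝ) (φ : En n × ℝ → ℂ)
    (x : En n) (t : ℝ) : ℂ :=
  ((Cns n s / 2 : ℝ) : ℂ) *
    ∫ τ in Set.Ioi (0 : ℝ), ∫ y : En n,
      (2 * φ (x, t) - φ (x + y, t + τ) - φ (x - y, t + τ)) *
        (((τ ^ (-((n : ℝ) / 2 + 1 + s)) * Real.exp (-‖y‖ ^ 2 / (4 * τ)) : ℝ)) : ℂ)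

open scoped FourierTransform ContDiff

/-- The Euclidean pairing on `ℝⁿ × ℝ`. -/
noncomputable def spaceTimePairing {n : ℕ} (z ζ : En n × ℝ) : ℝ := inner ℝ z.1 ζ.1 + z.2 * ζ.2

/-- The character of frequency `ζ` evaluated at `z`. -/
noncomputable def spaceTimeChar {n : ℕ} (z ζ : En n × ℝ) : ℂ :=
  Complex.exp ((2 * Real.pi * spaceTimePairing z ζ : ℝ) * Complex.I)

/-- The inverse Fourier transform on `ℝⁿ × ℝ`. -/
noncomputable def spaceTimeFourierInv {n : ℕ} (g : En n × ℝ → ℂ) (z : En n × ℝ) : ℂ :=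
  ∫ ζ, spaceTimeChar z ζ * g ζ

theorem fourierInv_toLp_eq_spaceTimeFourierInv {n : ℕ} (g : En n × ℝ → ℂ) (z : En n × ℝ) :
    𝓕⁻ (fun ζ : WithLp 2 (En n × ℝ) => g (WithLp.ofLp ζ)) (WithLp.toLp 2 z)
      = spaceTimeFourierInv g z := by
  have e : MeasurableEmbedding (WithLp.ofLp : WithLp 2 (En n × ℝ) → En n × ℝ) :=
    (MeasurableEquiv.toLp 2 (En n × ℝ)).symm.measurableEmbedding
  rw [spaceTimeFourierInv, ← (WithLp.volume_preserving_ofLp (En n) ℝ).integral_comp e,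
    Real.fourierInv_eq']
  refine integral_congr_ae (Filter.Eventually.of_forall fun ζ => ?_)
  simp only [smul_eq_mul, spaceTimeChar, spaceTimePairing, WithLp.prod_inner_apply, real_inner_comm]
  simp [mul_comm]

theorem exists_schwartzMap_eq_spaceTimeFourierInv {n : ℕ} {g : En n × ℝ → ℂ}
    (hg : ContDiff ℝ ∞ g) (hc : HasCompactSupport g) :
    ∃ φ : SchwartzMap (En n × ℝ) ℂ, ∀ z, φ z = spaceTimeFourierInv g z := by
  let e := WithLp.prodContinuousLinearEquiv 2 ℝ (En n) ℝ
  have hg' : ContDiff ℝ ∞ (g ∘ e) := hg.comp e.contDiff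
  have hc' : HasCompactSupport (g ∘ e) := hc.comp_homeomorph e.toHomeomorph
  refine ⟨SchwartzMap.compCLMOfContinuousLinearEquiv ℂ e.symm (𝓕⁻ (hc'.toSchwartzMap hg')), ?_⟩
  intro z
  rw [← fourierInv_toLp_eq_spaceTimeFourierInv, SchwartzMap.compCLMOfContinuousLinearEquiv_apply,
    SchwartzMap.fourierInv_coe]
  rfl

theorem integral_spaceTimeFourierInv {n : ℕ} {g : En n × ℝ → ℂ}
    (hg : ContDiff ℝ ∞ g) (hc : HasCompactSupport g) :
    ∫ z, spaceTimeFourierInv g z = g 0 := by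
  let e := WithLp.prodContinuousLinearEquiv 2 ℝ (En n) ℝ
  have hg' : ContDiff ℝ ∞ (g ∘ e) := hg.comp e.contDiff
  have hc' : HasCompactSupport (g ∘ e) := hc.comp_homeomorph e.toHomeomorph
  have h1 : 𝓕 (𝓕⁻ (hc'.toSchwartzMap hg')) 0 = g 0 := by
    rw [FourierTransform.fourier_fourierInv_eq]
    rfl
  rw [← h1, SchwartzMap.fourier_coe, Real.fourier_eq']
  have e : MeasurableEmbedding (WithLp.ofLp : WithLp 2 (En n × ℝ) → En n × ℝ) :=
    (MeasurableEquiv.toLp 2 (En n × ℝ)).symm.measurableEmbedding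
  rw [← (WithLp.volume_preserving_ofLp (En n) ℝ).integral_comp e]
  refine integral_congr_ae (Filter.Eventually.of_forall fun ζ => ?_)
  simp only [inner_zero_right, mul_zero, Complex.ofReal_zero, zero_mul, Complex.exp_zero, one_smul]
  rw [← fourierInv_toLp_eq_spaceTimeFourierInv, SchwartzMap.fourierInv_coe]
  rfl

/-- The integral `∫₀^∞ (1 - e^{-lτ}) τ^{-1-s} dτ`, a multiple of `l ^ s` on the right half-plane. -/
noncomputable def fracPowIntegral (s : ℝ) (l : ℂ) : ℂ :=
  ∫ τ in Set.Ioi (0 : ℝ), (1 - Complex.exp (-(l * τ))) * ((τ ^ (-1 - s) : ℝ) : ℂ)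

theorem norm_one_sub_cexp_neg_mul_le {l : ℂ} (hl : 0 ≤ l.re) {τ : ℝ} (hτ : 0 ≤ τ) :
    ‖1 - Complex.exp (-(l * τ))‖ ≤ 2 * min 1 (‖l‖ * τ) := by
  have h2 : ‖1 - Complex.exp (-(l * τ))‖ ≤ 2 := by
    refine (norm_sub_le _ _).trans ?_
    have : ‖Complex.exp (-(l * τ))‖ ≤ 1 := by
      rw [Complex.norm_exp, Real.exp_le_one_iff]
      simp only [Complex.neg_re, Complex.mul_re, Complex.ofReal_re, Complex.ofReal_im, mul_zero,
        sub_zero]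
      nlinarith [mul_nonneg hl hτ]
    rw [norm_one]; linarith
  have hn : ‖-(l * (τ : ℂ))‖ = ‖l‖ * τ := by
    rw [norm_neg, norm_mul, Complex.norm_real, Real.norm_of_nonneg hτ]
  rcases le_total 1 (‖l‖ * τ) with h | h
  · rw [min_eq_left h]; linarith
  · rw [min_eq_right h, norm_sub_rev, ← hn]
    exact Complex.norm_exp_sub_one_le (by rw [hn]; exact h)

theorem integrableOn_min_mul_rpow {s : ℝ} (hs0 : 0 < s) (hs1 : s < 1) (b : ℝ) (hb : 0 ≤ b) :
    IntegrableOn (fun τ : ℝ => 2 * min 1 (b * τ) * τ ^ (-1 - s)) (Set.Ioi 0) := by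
  rw [← Set.Ioc_union_Ioi_eq_Ioi (zero_le_one' ℝ)]
  have hm : Measurable (fun τ : ℝ => 2 * min 1 (b * τ) * τ ^ (-1 - s)) := by fun_prop
  refine IntegrableOn.union ?_ ?_
  · have h1 : IntegrableOn (fun τ : ℝ => 2 * b * τ ^ (-s)) (Set.Ioc 0 1) := by
      rw [← intervalIntegrable_iff_integrableOn_Ioc_of_le zero_le_one]
      exact (intervalIntegral.intervalIntegrable_rpow' (by linarith)).const_mul _
    refine h1.mono' hm.aestronglyMeasurable ((ae_restrict_iff' measurableSet_Ioc).2 (.of_forall ?_))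
    intro τ hτ
    have hτ0 : 0 < τ := hτ.1
    rw [Real.norm_of_nonneg (by positivity)]
    have : τ ^ (-s) = τ * τ ^ (-1 - s) := by
      rw [show -s = 1 + (-1 - s) by ring, Real.rpow_add hτ0, Real.rpow_one]
    rw [this]
    have h3 : min 1 (b * τ) ≤ b * τ := min_le_right _ _
    calc 2 * min 1 (b * τ) * τ ^ (-1 - s) ≤ 2 * (b * τ) * τ ^ (-1 - s) := by gcongr
      _ = _ := by ring
  · have h1 : IntegrableOn (fun τ : ℝ => 2 * τ ^ (-1 - s)) (Set.Ioi 1) :=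
      (integrableOn_Ioi_rpow_of_lt (by linarith) zero_lt_one).const_mul _
    refine h1.mono' hm.aestronglyMeasurable ((ae_restrict_iff' measurableSet_Ioi).2 (.of_forall ?_))
    intro τ hτ
    have hτ0 : 0 < τ := zero_lt_one.trans hτ
    rw [Real.norm_of_nonneg (by positivity)]
    have h3 : min 1 (b * τ) ≤ 1 := min_le_left _ _
    calc 2 * min 1 (b * τ) * τ ^ (-1 - s) ≤ 2 * 1 * τ ^ (-1 - s) := by gcongr
      _ = _ := by ring

theorem aestronglyMeasurable_fracPowIntegrand (s : ℝ) (l : ℂ) (μ : Measure ℝ) :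
    AEStronglyMeasurable
      (fun τ : ℝ => (1 - Complex.exp (-(l * τ))) * ((τ ^ (-1 - s) : ℝ) : ℂ)) μ := by
  have : Measurable (fun τ : ℝ => (1 - Complex.exp (-(l * τ))) * ((τ ^ (-1 - s) : ℝ) : ℂ)) := by
    fun_prop
  exact this.aestronglyMeasurable

theorem norm_fracPowIntegrand_le {s : ℝ} {l : ℂ} (hl : 0 ≤ l.re) {b : ℝ} (hb : ‖l‖ ≤ b) {τ : ℝ}
    (hτ : 0 < τ) :
    ‖(1 - Complex.exp (-(l * τ))) * ((τ ^ (-1 - s) : ℝ) : ℂ)‖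
      ≤ 2 * min 1 (b * τ) * τ ^ (-1 - s) := by
  rw [norm_mul, Complex.norm_real, Real.norm_of_nonneg (by positivity)]
  gcongr
  refine (norm_one_sub_cexp_neg_mul_le hl hτ.le).trans ?_
  gcongr

theorem integrableOn_fracPowIntegrand {s : ℝ} (hs0 : 0 < s) (hs1 : s < 1) {l : ℂ}
    (hl : 0 ≤ l.re) :
    IntegrableOn (fun τ : ℝ => (1 - Complex.exp (-(l * τ))) * ((τ ^ (-1 - s) : ℝ) : ℂ))
      (Set.Ioi 0) :=
  (integrableOn_min_mul_rpow hs0 hs1 ‖l‖ (norm_nonneg _)).mono'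
    (aestronglyMeasurable_fracPowIntegrand _ _ _)
    ((ae_restrict_iff' measurableSet_Ioi).2 (.of_forall fun _ hτ =>
      norm_fracPowIntegrand_le hl le_rfl hτ))

theorem differentiableAt_fracPowIntegral {s : ℝ} (hs0 : 0 < s) (hs1 : s < 1) {l : ℂ}
    (hl : 0 < l.re) : DifferentiableAt ℂ (fracPowIntegral s) l := by
  have h_int : IntegrableOn (fun τ : ℝ => τ ^ (-s) * Real.exp (-(l.re / 2) * τ)) (Set.Ioi 0) := by
    have := integrableOn_rpow_mul_exp_neg_mul_rpow (s := -s) (p := 1) (b := l.re / 2) (by linarith)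
      one_pos (by positivity)
    simpa using this
  have := hasDerivAt_integral_of_dominated_loc_of_deriv_le
    (μ := volume.restrict (Set.Ioi (0 : ℝ))) (s := Metric.ball l (l.re / 2))
    (F := fun (l : ℂ) (τ : ℝ) => (1 - Complex.exp (-(l * τ))) * ((τ ^ (-1 - s) : ℝ) : ℂ))
    (F' := fun (l : ℂ) (τ : ℝ) => (τ * Complex.exp (-(l * τ))) * ((τ ^ (-1 - s) : ℝ) : ℂ))
    (x₀ := l) (bound := fun τ : ℝ => τ ^ (-s) * Real.exp (-(l.re / 2) * τ))
    (Metric.ball_mem_nhds _ (by positivity))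
    (.of_forall fun l => aestronglyMeasurable_fracPowIntegrand _ _ _)
    (integrableOn_fracPowIntegrand hs0 hs1 hl.le) ?_ ?_ h_int ?_
  · exact this.2.differentiableAt
  · have : Measurable
        (fun τ : ℝ => (τ * Complex.exp (-(l * τ))) * ((τ ^ (-1 - s) : ℝ) : ℂ)) := by
      fun_prop
    exact this.aestronglyMeasurable
  · refine (ae_restrict_iff' measurableSet_Ioi).2 (.of_forall ?_)
    intro τ (hτ : 0 < τ) w hw
    have h1 : l.re / 2 ≤ w.re := by
      have h := (Complex.abs_re_le_norm (w - l)).trans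
        ((dist_eq_norm w l).symm.trans_le (Metric.mem_ball.1 hw).le)
      have := (abs_le.1 h).1
      simp only [Complex.sub_re] at this
      linarith
    rw [norm_mul, norm_mul, Complex.norm_real, Complex.norm_real, Real.norm_of_nonneg hτ.le,
      Real.norm_of_nonneg (by positivity), Complex.norm_exp]
    have h2 : τ ^ (-s) = τ * τ ^ (-1 - s) := by
      rw [show -s = 1 + (-1 - s) by ring, Real.rpow_add hτ, Real.rpow_one]
    have h3 : Real.exp (-(w * τ)).re ≤ Real.exp (-(l.re / 2) * τ) := by
      simp only [Complex.neg_re, Complex.mul_re, Complex.ofReal_re, Complex.ofReal_im, mul_zero,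
        sub_zero]
      gcongr
      nlinarith
    rw [h2]
    calc τ * Real.exp (-(w * τ)).re * τ ^ (-1 - s)
        ≤ τ * Real.exp (-(l.re / 2) * τ) * τ ^ (-1 - s) := by gcongr
      _ = _ := by ring
  · refine .of_forall ?_
    intro τ w _
    have h1 : HasDerivAt (fun w : ℂ => -(w * τ)) (-(1 * (τ : ℂ))) w :=
      ((hasDerivAt_id w).mul_const _).neg
    convert! (h1.cexp.const_sub 1).mul_const _ using 1
    ring

theorem fracPowIntegral_ofReal {s : ℝ} {r : ℝ} (hr : 0 < r) :
    fracPowIntegral s r = fracPowIntegral s 1 * (r : ℂ) ^ (s : ℂ) := by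
  have h := integral_comp_mul_left_Ioi
    (fun τ : ℝ => (1 - Complex.exp (-(1 * τ))) * ((τ ^ (-1 - s) : ℝ) : ℂ)) 0 hr
  have h2 : ∫ τ in Set.Ioi (0 : ℝ), (1 - Complex.exp (-(1 * ((r * τ : ℝ) : ℂ)))) *
      (((r * τ) ^ (-1 - s) : ℝ) : ℂ) = ((r ^ (-1 - s) : ℝ) : ℂ) * fracPowIntegral s r := by
    rw [fracPowIntegral, ← integral_const_mul]
    refine setIntegral_congr_fun measurableSet_Ioi fun τ hτ => ?_
    rw [Real.mul_rpow hr.le (le_of_lt hτ)]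
    push_cast
    ring_nf
  rw [h2, mul_zero] at h
  change _ = r⁻¹ • fracPowIntegral s 1 at h
  rw [← Complex.ofReal_cpow hr.le]
  have h3 : ((r ^ (-1 - s) : ℝ) : ℂ) ≠ 0 := by
    exact_mod_cast (Real.rpow_pos_of_pos hr _).ne'
  have h4 : r ^ (-1 - s) * r ^ s = r⁻¹ := by
    rw [← Real.rpow_add hr, ← Real.rpow_neg_one]; ring_nf
  apply mul_left_cancel₀ h3
  rw [h, ← h4, Complex.real_smul]
  push_cast
  ring

theorem fracPowIntegral_eq_of_re_pos {s : ℝ} (hs0 : 0 < s) (hs1 : s < 1) {l : ℂ} (hl : 0 < l.re) :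
    fracPowIntegral s l = fracPowIntegral s 1 * l ^ (s : ℂ) := by
  have hopen : IsOpen {l : ℂ | 0 < l.re} := isOpen_lt continuous_const Complex.continuous_re
  have hA : AnalyticOnNhd ℂ (fracPowIntegral s) {l : ℂ | 0 < l.re} :=
    DifferentiableOn.analyticOnNhd
      (fun w hw => (differentiableAt_fracPowIntegral hs0 hs1 hw).differentiableWithinAt) hopen
  have hB : AnalyticOnNhd ℂ (fun l : ℂ => fracPowIntegral s 1 * l ^ (s : ℂ))
      {l : ℂ | 0 < l.re} := by
    refine DifferentiableOn.analyticOnNhd (fun w hw => ?_) hopen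
    refine DifferentiableAt.differentiableWithinAt ?_
    exact (differentiableAt_id.cpow_const (Or.inl hw)).const_mul _
  refine hA.eqOn_of_preconnected_of_frequently_eq hB (convex_halfSpace_re_gt 0).isPreconnected
    (z₀ := 1) (by simp) ?_ hl
  have hseq : Filter.Tendsto (fun k : ℕ => ((1 + 1 / ((k : ℝ) + 1) : ℝ) : ℂ)) Filter.atTop
      (nhdsWithin 1 {1}ᶜ) := by
    refine tendsto_nhdsWithin_iff.2 ⟨?_, .of_forall fun k => ?_⟩
    · have := (tendsto_one_div_add_atTop_nhds_zero_nat (𝕜 := ℝ)).const_add 1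
      rw [add_zero] at this
      exact (Complex.continuous_ofReal.tendsto 1).comp this
    · have : (0 : ℝ) < 1 / ((k : ℝ) + 1) := by positivity
      simp only [Set.mem_compl_iff, Set.mem_singleton_iff]
      intro h
      have h' : (1 + 1 / ((k : ℝ) + 1) : ℝ) = 1 := by exact_mod_cast h
      linarith
  refine hseq.frequently (Filter.Frequently.of_forall fun k => ?_)
  exact fracPowIntegral_ofReal (by positivity)

theorem fracPowIntegral_eq {s : ℝ} (hs0 : 0 < s) (hs1 : s < 1) {l : ℂ} (hl : 0 ≤ l.re)
    (hl0 : l ≠ 0) :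
    fracPowIntegral s l = fracPowIntegral s 1 * l ^ (s : ℂ) := by
  have hlim : Filter.Tendsto (fun k : ℕ => l + ((1 / ((k : ℝ) + 1) : ℝ) : ℂ)) Filter.atTop
      (nhds l) := by
    have := (Complex.continuous_ofReal.tendsto 0).comp
      (tendsto_one_div_add_atTop_nhds_zero_nat (𝕜 := ℝ))
    simpa using this.const_add l
  have hslit : l ∈ Complex.slitPlane := by
    rw [Complex.mem_slitPlane_iff]
    by_contra! h
    exact hl0 (Complex.ext (le_antisymm h.1 hl) h.2)
  have h1 : Filter.Tendsto
      (fun k : ℕ => fracPowIntegral s 1 * (l + ((1 / ((k : ℝ) + 1) : ℝ) : ℂ)) ^ (s : ℂ))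
      Filter.atTop (nhds (fracPowIntegral s 1 * l ^ (s : ℂ))) :=
    ((continuousAt_id.cpow continuousAt_const hslit).tendsto.comp hlim).const_mul _
  have h2 : Filter.Tendsto (fun k : ℕ => fracPowIntegral s (l + ((1 / ((k : ℝ) + 1) : ℝ) : ℂ)))
      Filter.atTop (nhds (fracPowIntegral s l)) := by
    refine tendsto_integral_of_dominated_convergence
      (fun τ : ℝ => 2 * min 1 ((‖l‖ + 1) * τ) * τ ^ (-1 - s))
      (fun k => aestronglyMeasurable_fracPowIntegrand _ _ _)
      (integrableOn_min_mul_rpow hs0 hs1 _ (by positivity)) ?_ ?_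
    · intro k
      have hk : (0 : ℝ) < 1 / ((k : ℝ) + 1) := by positivity
      refine (ae_restrict_iff' measurableSet_Ioi).2 (.of_forall fun τ hτ => ?_)
      refine norm_fracPowIntegrand_le ?_ ?_ hτ
      · rw [Complex.add_re, Complex.ofReal_re]; linarith
      · refine (norm_add_le _ _).trans ?_
        rw [Complex.norm_real, Real.norm_of_nonneg hk.le]
        gcongr
        rw [div_le_one (by positivity)]
        linarith [(Nat.cast_nonneg k : (0 : ℝ) ≤ k)]
    · refine .of_forall fun τ => ?_
      have hc : Continuous
          (fun l : ℂ => (1 - Complex.exp (-(l * τ))) * ((τ ^ (-1 - s) : ℝ) : ℂ)) := by fun_prop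
      exact (hc.tendsto l).comp hlim
  refine tendsto_nhds_unique h2 (h1.congr fun k => ?_)
  refine (fracPowIntegral_eq_of_re_pos hs0 hs1 ?_).symm
  rw [Complex.add_re, Complex.ofReal_re]
  positivity

theorem fracPowIntegral_one_ne_zero {s : ℝ} (hs0 : 0 < s) (hs1 : s < 1) :
    fracPowIntegral s 1 ≠ 0 := by
  have h : fracPowIntegral s 1
      = ((∫ τ in Set.Ioi (0 : ℝ), (1 - Real.exp (-τ)) * τ ^ (-1 - s) : ℝ) : ℂ) := by
    rw [fracPowIntegral, ← integral_complex_ofReal]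
    refine integral_congr_ae (.of_forall fun τ => ?_)
    simp
  have hi := integrableOn_fracPowIntegrand hs0 hs1 (l := 1) (by simp)
  have hi' : IntegrableOn (fun τ : ℝ => (1 - Real.exp (-τ)) * τ ^ (-1 - s)) (Set.Ioi 0) := by
    have := hi.re
    refine this.congr (.of_forall fun τ => ?_)
    simp only [one_mul, RCLike.re_to_complex]
    rw [← Complex.ofReal_neg, ← Complex.ofReal_exp, ← Complex.ofReal_one, ← Complex.ofReal_sub,
      ← Complex.ofReal_mul, Complex.ofReal_re]
  have hpos : ∀ τ ∈ Set.Ioi (0 : ℝ), 0 < (1 - Real.exp (-τ)) * τ ^ (-1 - s) := by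
    intro τ (hτ : 0 < τ)
    have : Real.exp (-τ) < 1 := by simpa using hτ
    have : 0 < 1 - Real.exp (-τ) := by linarith
    positivity
  rw [h, Complex.ofReal_ne_zero]
  refine ne_of_gt ?_
  rw [setIntegral_pos_iff_support_of_nonneg_ae
    ((ae_restrict_iff' measurableSet_Ioi).2 (.of_forall fun τ hτ => (hpos τ hτ).le)) hi']
  have : Set.Ioi (0 : ℝ) ⊆
      (Function.support fun τ : ℝ => (1 - Real.exp (-τ)) * τ ^ (-1 - s)) ∩ Set.Ioi 0 :=
    fun τ hτ => ⟨(hpos τ hτ).ne', hτ⟩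
  exact lt_of_lt_of_le (by simp) (measure_mono this)

theorem spaceTimeChar_add_left {n : ℕ} (z w ζ : En n × ℝ) :
    spaceTimeChar (z + w) ζ = spaceTimeChar z ζ * spaceTimeChar w ζ := by
  simp only [spaceTimeChar, spaceTimePairing, Prod.fst_add, Prod.snd_add, inner_add_left]
  rw [← Complex.exp_add]
  push_cast
  ring_nf

theorem norm_spaceTimeChar {n : ℕ} (z ζ : En n × ℝ) : ‖spaceTimeChar z ζ‖ = 1 :=
  Complex.norm_exp_ofReal_mul_I _

theorem contDiff_spaceTimeChar {n : ℕ} (z : En n × ℝ) {k : WithTop ℕ∞} :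
    ContDiff ℝ k (spaceTimeChar z) := by
  unfold spaceTimeChar spaceTimePairing
  have h : ContDiff ℝ k fun ζ : En n × ℝ => 2 * Real.pi * (inner ℝ z.1 ζ.1 + z.2 * ζ.2) :=
    contDiff_const.mul ((contDiff_const.inner ℝ contDiff_fst).add (contDiff_const.mul contDiff_snd))
  exact ((Complex.ofRealCLM.contDiff.comp h).mul contDiff_const).cexp

@[fun_prop]
theorem Continuous.spaceTimeChar {n : ℕ} {X : Type*} [TopologicalSpace X] {f g : X → En n × ℝ}
    (hf : Continuous f) (hg : Continuous g) :
    Continuous (fun x => spaceTimeChar (f x) (g x)) := by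
  unfold _root_.spaceTimeChar spaceTimePairing
  fun_prop

/-- The Fourier symbol of the backward heat operator `-∂_t - Δ`. -/
noncomputable def heatSymbol {n : ℕ} (ζ : En n × ℝ) : ℂ :=
  (4 * Real.pi ^ 2 * ‖ζ.1‖ ^ 2 : ℝ) - (2 * Real.pi * ζ.2 : ℝ) * Complex.I

theorem heatSymbol_re {n : ℕ} (ζ : En n × ℝ) :
    (heatSymbol ζ).re = 4 * Real.pi ^ 2 * ‖ζ.1‖ ^ 2 := by
  simp only [heatSymbol, Complex.sub_re, Complex.re_ofReal_mul, Complex.I_re, mul_zero, sub_zero,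
    Complex.ofReal_re]

theorem heatSymbol_im {n : ℕ} (ζ : En n × ℝ) : (heatSymbol ζ).im = -(2 * Real.pi * ζ.2) := by
  simp only [heatSymbol, Complex.sub_im, Complex.im_ofReal_mul, Complex.I_im, mul_one,
    Complex.ofReal_im, zero_sub]

theorem heatSymbol_re_nonneg {n : ℕ} (ζ : En n × ℝ) : 0 ≤ (heatSymbol ζ).re := by
  rw [heatSymbol_re]; positivity

theorem heatSymbol_ne_zero {n : ℕ} {ζ : En n × ℝ} (hζ : ζ ≠ 0) : heatSymbol ζ ≠ 0 := by
  intro h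
  have h1 := heatSymbol_re ζ
  have h2 := heatSymbol_im ζ
  rw [h] at h1 h2
  simp only [Complex.zero_re, Complex.zero_im] at h1 h2
  have hpi := Real.pi_pos
  refine hζ (Prod.ext ?_ ?_)
  · simpa [hpi.ne'] using h1.symm
  · simpa [hpi.ne'] using h2.symm

theorem contDiff_heatSymbol {n : ℕ} {k : WithTop ℕ∞} :
    ContDiff ℝ k (heatSymbol : En n × ℝ → ℂ) := by
  unfold heatSymbol
  have h1 : ContDiff ℝ k fun ζ : En n × ℝ => 4 * Real.pi ^ 2 * ‖ζ.1‖ ^ 2 :=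
    contDiff_const.mul (contDiff_fst.norm_sq ℝ)
  have h2 : ContDiff ℝ k fun ζ : En n × ℝ => 2 * Real.pi * ζ.2 := by fun_prop
  exact (Complex.ofRealCLM.contDiff.comp h1).sub
    ((Complex.ofRealCLM.contDiff.comp h2).mul contDiff_const)

theorem integrable_gaussian_real {n : ℕ} {τ : ℝ} (hτ : 0 < τ) :
    Integrable (fun y : En n => Real.exp (-‖y‖ ^ 2 / (4 * τ))) := by
  have h := GaussianFourier.integrable_cexp_neg_mul_sq_norm_add (V := En n)
    (b := ((1 / (4 * τ) : ℝ) : ℂ)) (by rw [Complex.ofReal_re]; positivity) 0 0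
  have h2 := h.norm
  refine h2.congr (.of_forall fun y => ?_)
  simp only [zero_mul, add_zero, Complex.norm_exp]
  congr 1
  rw [← Complex.ofReal_pow, ← Complex.ofReal_neg, ← Complex.ofReal_mul, Complex.ofReal_re]
  ring

theorem integral_spaceTimeChar_mul_gaussian {n : ℕ} {τ : ℝ} (hτ : 0 < τ) (ζ : En n × ℝ) (ε : ℝ)
    (hε : ε ^ 2 = 1) :
    ∫ y : En n, spaceTimeChar (ε • y, τ) ζ * ((Real.exp (-‖y‖ ^ 2 / (4 * τ)) : ℝ) : ℂ)
      = Complex.exp (-(heatSymbol ζ * τ)) * (((4 * Real.pi * τ) ^ ((n : ℝ) / 2) : ℝ) : ℂ) := by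
  have h := GaussianFourier.integral_cexp_neg_mul_sq_norm_add (V := En n)
    (b := ((1 / (4 * τ) : ℝ) : ℂ)) (by rw [Complex.ofReal_re]; positivity)
    ((2 * Real.pi * ε : ℝ) * Complex.I) ζ.1
  have hτ' : (τ : ℂ) ≠ 0 := by exact_mod_cast hτ.ne'
  have h1 : ∀ y : En n,
      spaceTimeChar (ε • y, τ) ζ * ((Real.exp (-‖y‖ ^ 2 / (4 * τ)) : ℝ) : ℂ)
      = Complex.exp ((2 * Real.pi * τ * ζ.2 : ℝ) * Complex.I) *
        Complex.exp (-((1 / (4 * τ) : ℝ) : ℂ) * ‖y‖ ^ 2 +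
          ((2 * Real.pi * ε : ℝ) * Complex.I) * (inner ℝ ζ.1 y : ℝ)) := by
    intro y
    simp only [spaceTimeChar, spaceTimePairing, real_inner_smul_left]
    rw [Complex.ofReal_exp, ← Complex.exp_add, ← Complex.exp_add, real_inner_comm]
    congr 1
    push_cast
    ring
  simp_rw [h1]
  rw [integral_const_mul, h, finrank_euclideanSpace_fin]
  have h2 : ((Real.pi : ℂ) / ((1 / (4 * τ) : ℝ) : ℂ)) ^ ((n : ℂ) / 2)
      = (((4 * Real.pi * τ) ^ ((n : ℝ) / 2) : ℝ) : ℂ) := by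
    rw [Complex.ofReal_cpow (by positivity)]
    congr 1
    · push_cast
      field_simp
    · push_cast; rfl
  rw [h2, mul_comm (((4 * Real.pi * τ) ^ ((n : ℝ) / 2) : ℝ) : ℂ), ← mul_assoc, ← Complex.exp_add]
  congr 2
  have hε' : (ε : ℂ) ^ 2 = 1 := by exact_mod_cast hε
  simp only [heatSymbol]
  push_cast
  have h3 : (((2 * Real.pi * ε : ℂ)) * Complex.I) ^ 2 = -(4 * Real.pi ^ 2) := by
    rw [mul_pow, Complex.I_sq, mul_pow, mul_pow, hε']; ring
  rw [h3]
  field_simp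
  ring

theorem integral_symmetricDifference_mul_gaussian {n : ℕ} {τ : ℝ} (hτ : 0 < τ) (ζ : En n × ℝ) :
    ∫ y : En n, (2 - spaceTimeChar (y, τ) ζ - spaceTimeChar (-y, τ) ζ) *
        ((Real.exp (-‖y‖ ^ 2 / (4 * τ)) : ℝ) : ℂ)
      = 2 * (1 - Complex.exp (-(heatSymbol ζ * τ))) *
        (((4 * Real.pi * τ) ^ ((n : ℝ) / 2) : ℝ) : ℂ) := by
  have hG : Integrable (fun y : En n => ((Real.exp (-‖y‖ ^ 2 / (4 * τ)) : ℝ) : ℂ)) :=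
    (integrable_gaussian_real hτ).ofReal
  have hI : ∀ ε : ℝ, Integrable (fun y : En n =>
      spaceTimeChar (ε • y, τ) ζ * ((Real.exp (-‖y‖ ^ 2 / (4 * τ)) : ℝ) : ℂ)) := by
    intro ε
    refine hG.bdd_mul (c := 1) ?_ (.of_forall fun y => (norm_spaceTimeChar _ _).le)
    exact Continuous.aestronglyMeasurable (by fun_prop)
  have h0 : ∫ y : En n, ((Real.exp (-‖y‖ ^ 2 / (4 * τ)) : ℝ) : ℂ)
      = (((4 * Real.pi * τ) ^ ((n : ℝ) / 2) : ℝ) : ℂ) := by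
    have := integral_spaceTimeChar_mul_gaussian hτ (0 : En n × ℝ) 1 (by norm_num)
    simpa [spaceTimeChar, spaceTimePairing, heatSymbol] using this
  have h1 := integral_spaceTimeChar_mul_gaussian hτ ζ 1 (by norm_num)
  have h2 := integral_spaceTimeChar_mul_gaussian hτ ζ (-1) (by norm_num)
  have i1 := hI 1
  have i2 := hI (-1)
  simp only [one_smul, neg_smul] at h1 h2 i1 i2
  have i3 : Integrable (fun y : En n => 2 * ((Real.exp (-‖y‖ ^ 2 / (4 * τ)) : ℝ) : ℂ) -
      spaceTimeChar (y, τ) ζ * ((Real.exp (-‖y‖ ^ 2 / (4 * τ)) : ℝ) : ℂ)) :=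
    (hG.const_mul 2).sub i1
  simp_rw [sub_mul]
  rw [integral_sub i3 i2, integral_sub (hG.const_mul 2) i1,
    integral_const_mul, h0, h1, h2]
  ring

theorem integrable_spaceTimeChar_mul {n : ℕ} {g : En n × ℝ → ℂ} (hg : Integrable g)
    (z : En n × ℝ) : Integrable (fun ζ => spaceTimeChar z ζ * g ζ) :=
  hg.bdd_mul (c := 1) (by fun_prop : Continuous (spaceTimeChar z)).aestronglyMeasurable
    (.of_forall fun _ => (norm_spaceTimeChar _ _).le)

theorem integral_symmetricDifference_spaceTimeFourierInv {n : ℕ} {g : En n × ℝ → ℂ}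
    (hg : Integrable g) (z : En n × ℝ) {τ : ℝ} (hτ : 0 < τ) :
    ∫ y : En n, (2 * spaceTimeFourierInv g z - spaceTimeFourierInv g (z.1 + y, z.2 + τ)
        - spaceTimeFourierInv g (z.1 - y, z.2 + τ)) * ((Real.exp (-‖y‖ ^ 2 / (4 * τ)) : ℝ) : ℂ)
      = ∫ ζ, spaceTimeChar z ζ * g ζ * (2 * (1 - Complex.exp (-(heatSymbol ζ * τ))) *
        (((4 * Real.pi * τ) ^ ((n : ℝ) / 2) : ℝ) : ℂ)) := by
  have hI := integrable_spaceTimeChar_mul hg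
  have h1 : ∀ y : En n, 2 * spaceTimeFourierInv g z - spaceTimeFourierInv g (z.1 + y, z.2 + τ)
        - spaceTimeFourierInv g (z.1 - y, z.2 + τ)
      = ∫ ζ, spaceTimeChar z ζ * g ζ *
        (2 - spaceTimeChar (y, τ) ζ - spaceTimeChar (-y, τ) ζ) := by
    intro y
    have i3 : Integrable (fun ζ => 2 * (spaceTimeChar z ζ * g ζ) -
        spaceTimeChar (z.1 + y, z.2 + τ) ζ * g ζ) := ((hI z).const_mul 2).sub (hI _)
    rw [spaceTimeFourierInv, spaceTimeFourierInv, spaceTimeFourierInv, ← integral_const_mul,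
      ← integral_sub ((hI z).const_mul 2) (hI _),
      ← integral_sub i3 (hI _)]
    refine integral_congr_ae (.of_forall fun ζ => ?_)
    have e1 : ((z.1 + y, z.2 + τ) : En n × ℝ) = z + (y, τ) := rfl
    have e2 : ((z.1 - y, z.2 + τ) : En n × ℝ) = z + (-y, τ) := by
      rw [sub_eq_add_neg]; rfl
    simp only [e1, e2, spaceTimeChar_add_left]
    ring
  simp_rw [h1, ← integral_mul_const]
  rw [integral_integral_swap]
  · refine integral_congr_ae (.of_forall fun ζ => ?_)
    simp only
    rw [← integral_symmetricDifference_mul_gaussian hτ, ← integral_const_mul]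
    refine integral_congr_ae (.of_forall fun y => ?_)
    simp only
    ring
  · have hprod : Integrable (fun p : En n × (En n × ℝ) =>
        ((Real.exp (-‖p.1‖ ^ 2 / (4 * τ)) : ℝ) : ℂ) * (spaceTimeChar z p.2 * g p.2))
        (volume.prod volume) :=
      (integrable_gaussian_real hτ).ofReal.mul_prod (hI z)
    have hm : AEStronglyMeasurable (fun p : En n × (En n × ℝ) =>
        2 - spaceTimeChar (p.1, τ) p.2 - spaceTimeChar (-p.1, τ) p.2)
        ((volume : Measure (En n)).prod volume) := by
      exact Continuous.aestronglyMeasurable (by fun_prop)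
    have hb : ∀ p : En n × (En n × ℝ),
        ‖2 - spaceTimeChar (p.1, τ) p.2 - spaceTimeChar (-p.1, τ) p.2‖ ≤ 4 := by
      intro p
      have h1 := norm_sub_le (2 - spaceTimeChar (p.1, τ) p.2) (spaceTimeChar (-p.1, τ) p.2)
      have h2 := norm_sub_le 2 (spaceTimeChar (p.1, τ) p.2)
      rw [norm_spaceTimeChar] at h1 h2
      rw [RCLike.norm_ofNat] at h2
      linarith
    refine (hprod.bdd_mul hm (.of_forall hb)).congr (.of_forall fun p => ?_)
    simp only [Function.uncurry]
    ring

theorem rightHeat_spaceTimeFourierInv {n : ℕ} {s : ℝ} (hs0 : 0 < s) (hs1 : s < 1)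
    {g : En n × ℝ → ℂ} (hg : Continuous g) (hc : HasCompactSupport g) (x : En n) (t : ℝ) :
    rightHeat n s (spaceTimeFourierInv g) x t
      = ((Cns n s * (4 * Real.pi) ^ ((n : ℝ) / 2) : ℝ) : ℂ) *
        spaceTimeFourierInv (fun ζ => fracPowIntegral s (heatSymbol ζ) * g ζ) (x, t) := by
  have hgi : Integrable g := hg.integrable_of_hasCompactSupport hc
  have h1 : ∀ τ ∈ Set.Ioi (0 : ℝ), (∫ y : En n,
      (2 * spaceTimeFourierInv g (x, t) - spaceTimeFourierInv g (x + y, t + τ)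
        - spaceTimeFourierInv g (x - y, t + τ)) *
        (((τ ^ (-((n : ℝ) / 2 + 1 + s)) * Real.exp (-‖y‖ ^ 2 / (4 * τ)) : ℝ)) : ℂ))
      = ∫ ζ, ((2 * (4 * Real.pi) ^ ((n : ℝ) / 2) : ℝ) : ℂ) * (spaceTimeChar (x, t) ζ * g ζ *
        ((1 - Complex.exp (-(heatSymbol ζ * τ))) * ((τ ^ (-1 - s) : ℝ) : ℂ))) := by
    intro τ (hτ : 0 < τ)
    have h2 := integral_symmetricDifference_spaceTimeFourierInv hgi (x, t) hτ
    have h3 : τ ^ (-((n : ℝ) / 2 + 1 + s)) * (4 * Real.pi * τ) ^ ((n : ℝ) / 2)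
        = (4 * Real.pi) ^ ((n : ℝ) / 2) * τ ^ (-1 - s) := by
      rw [Real.mul_rpow (by positivity) hτ.le, mul_left_comm, ← Real.rpow_add hτ]
      ring_nf
    have h4 : (∫ y : En n,
      (2 * spaceTimeFourierInv g (x, t) - spaceTimeFourierInv g (x + y, t + τ)
        - spaceTimeFourierInv g (x - y, t + τ)) *
        (((τ ^ (-((n : ℝ) / 2 + 1 + s)) * Real.exp (-‖y‖ ^ 2 / (4 * τ)) : ℝ)) : ℂ))
      = ((τ ^ (-((n : ℝ) / 2 + 1 + s)) : ℝ) : ℂ) * ∫ y : En n,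
      (2 * spaceTimeFourierInv g (x, t) - spaceTimeFourierInv g (x + y, t + τ)
        - spaceTimeFourierInv g (x - y, t + τ)) *
        (((Real.exp (-‖y‖ ^ 2 / (4 * τ)) : ℝ)) : ℂ) := by
      rw [← integral_const_mul]
      refine integral_congr_ae (.of_forall fun y => ?_)
      simp only
      push_cast
      ring
    rw [h4, h2, ← integral_const_mul]
    refine integral_congr_ae (.of_forall fun ζ => ?_)
    have h5 : ((τ ^ (-((n : ℝ) / 2 + 1 + s)) : ℝ) : ℂ) *
        (((4 * Real.pi * τ) ^ ((n : ℝ) / 2) : ℝ) : ℂ)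
        = (((4 * Real.pi) ^ ((n : ℝ) / 2) : ℝ) : ℂ) * ((τ ^ (-1 - s) : ℝ) : ℂ) := by
      rw [← Complex.ofReal_mul, h3, Complex.ofReal_mul]
    simp only
    rw [Complex.ofReal_mul 2, Complex.ofReal_ofNat]
    linear_combination (2 * spaceTimeChar (x, t) ζ * g ζ *
      (1 - Complex.exp (-(heatSymbol ζ * τ)))) * h5
  obtain ⟨b, hb⟩ : ∃ b : ℝ, ∀ ζ, g ζ ≠ 0 → ‖heatSymbol ζ‖ ≤ b := by
    obtain ⟨b, hb⟩ := hc.isCompact.exists_bound_of_continuousOn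
      (contDiff_heatSymbol (n := n) (k := 0)).continuous.continuousOn
    exact ⟨b, fun ζ hζ => hb ζ (subset_tsupport _ hζ)⟩
  have hb0 : ∀ ζ, g ζ ≠ 0 → ‖heatSymbol ζ‖ ≤ |b| := fun ζ hζ => (hb ζ hζ).trans (le_abs_self b)
  have h_int : Integrable (Function.uncurry fun (τ : ℝ) (ζ : En n × ℝ) =>
      (spaceTimeChar (x, t) ζ * g ζ *
        ((1 - Complex.exp (-(heatSymbol ζ * τ))) * ((τ ^ (-1 - s) : ℝ) : ℂ))))
      ((volume.restrict (Set.Ioi 0)).prod volume) := by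
    have hB := (integrableOn_min_mul_rpow hs0 hs1 |b| (abs_nonneg b)).mul_prod hgi.norm
    refine hB.mono' ?_ ?_
    · have hm1 := (contDiff_spaceTimeChar (k := 0) ((x, t) : En n × ℝ)).continuous.measurable
      have hm2 := (contDiff_heatSymbol (n := n) (k := 0)).continuous.measurable
      have hm3 := hg.measurable
      have : Measurable (Function.uncurry fun (τ : ℝ) (ζ : En n × ℝ) =>
        (spaceTimeChar (x, t) ζ * g ζ *
          ((1 - Complex.exp (-(heatSymbol ζ * τ))) * ((τ ^ (-1 - s) : ℝ) : ℂ)))) := by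
        unfold Function.uncurry
        fun_prop
      exact this.aestronglyMeasurable
    · have hpos : ∀ᵐ p : ℝ × (En n × ℝ) ∂((volume.restrict (Set.Ioi 0)).prod volume), 0 < p.1 := by
        have : ∀ᵐ τ : ℝ ∂(volume.restrict (Set.Ioi 0)), 0 < τ :=
          (ae_restrict_iff' measurableSet_Ioi).2 (.of_forall fun _ h => h)
        exact Measure.quasiMeasurePreserving_fst.ae this
      filter_upwards [hpos] with p hp
      simp only [Function.uncurry]
      rw [norm_mul, norm_mul, norm_spaceTimeChar, one_mul, mul_comm]
      by_cases h : g p.2 = 0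
      · simp [h]
      · gcongr
        exact norm_fracPowIntegrand_le (heatSymbol_re_nonneg _) (hb0 _ h) hp
  rw [rightHeat, setIntegral_congr_fun measurableSet_Ioi h1]
  simp_rw [integral_const_mul]
  rw [integral_integral_swap h_int]
  have h6 : ∀ ζ, (∫ τ in Set.Ioi (0 : ℝ), spaceTimeChar (x, t) ζ * g ζ *
        ((1 - Complex.exp (-(heatSymbol ζ * τ))) * ((τ ^ (-1 - s) : ℝ) : ℂ)))
      = spaceTimeChar (x, t) ζ * (fracPowIntegral s (heatSymbol ζ) * g ζ) := by
    intro ζ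
    rw [integral_const_mul, fracPowIntegral]
    ring
  simp_rw [h6]
  rw [← mul_assoc, spaceTimeFourierInv]
  congr 1
  push_cast
  ring

theorem exists_rightHeat_eq_spaceTimeFourierInv {n : ℕ} {s : ℝ} (hs0 : 0 < s) (hs1 : s < 1)
    {g : En n × ℝ → ℂ} (hg : ContDiff ℝ ∞ g) (hc : HasCompactSupport g) (h0 : 0 ∉ tsupport g) :
    ∃ φ : SchwartzMap (En n × ℝ) ℂ, ∀ x t,
      rightHeat n s (fun q => φ q) x t = spaceTimeFourierInv g (x, t) := by
  set c : ℂ := ((Cns n s * (4 * Real.pi) ^ ((n : ℝ) / 2) : ℝ) : ℂ) * fracPowIntegral s 1 with hcdef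
  have hc0 : c ≠ 0 := by
    refine mul_ne_zero ?_ (fracPowIntegral_one_ne_zero hs0 hs1)
    have hΓ : Real.Gamma (-s) ≠ 0 := by
      refine Real.Gamma_ne_zero fun m hm => ?_
      rcases Nat.eq_zero_or_pos m with rfl | hm0
      · simp at hm; linarith
      · have : (1 : ℝ) ≤ m := by exact_mod_cast hm0
        linarith
    have : 0 < Cns n s * (4 * Real.pi) ^ ((n : ℝ) / 2) := by
      unfold Cns; positivity
    exact_mod_cast this.ne'
  set m : En n × ℝ → ℂ := fun ζ => c⁻¹ * Complex.exp (-(s * Complex.log (heatSymbol ζ))) with hm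
  have hsmooth : ContDiff ℝ ∞ (fun ζ => m ζ * g ζ) := by
    rw [← contMDiff_iff_contDiff]
    refine contMDiff_of_tsupport fun ζ hζ => ?_
    rw [contMDiffAt_iff_contDiffAt]
    have hζ0 : ζ ≠ 0 := by
      rintro rfl
      exact h0 (closure_mono (Function.support_mul_subset_right _ _) hζ)
    have hslit : heatSymbol ζ ∈ Complex.slitPlane := by
      rw [Complex.mem_slitPlane_iff]
      by_contra! h
      have h1 := heatSymbol_re_nonneg ζ
      exact heatSymbol_ne_zero hζ0 (Complex.ext (le_antisymm h.1 h1) h.2)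
    have hlog : ContDiffAt ℝ ∞ Complex.log (heatSymbol ζ) :=
      (Complex.contDiffAt_log hslit).restrict_scalars ℝ
    have h1 : ContDiffAt ℝ ∞ (fun ζ : En n × ℝ => Complex.log (heatSymbol ζ)) ζ :=
      hlog.comp ζ contDiff_heatSymbol.contDiffAt
    exact (contDiffAt_const.mul (contDiffAt_const.mul h1).neg.cexp).mul hg.contDiffAt
  have hcomp : HasCompactSupport (fun ζ => m ζ * g ζ) := hc.mul_left
  obtain ⟨φ, hφ⟩ := exists_schwartzMap_eq_spaceTimeFourierInv hsmooth hcomp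
  refine ⟨φ, fun x t => ?_⟩
  have hφ' : (fun q => φ q) = spaceTimeFourierInv (fun ζ => m ζ * g ζ) := funext hφ
  rw [hφ', rightHeat_spaceTimeFourierInv hs0 hs1 hsmooth.continuous hcomp]
  simp only [spaceTimeFourierInv]
  rw [← integral_const_mul]
  refine integral_congr_ae (.of_forall fun ζ => ?_)
  by_cases hζ : g ζ = 0
  · simp [hζ]
  have hζ0 : ζ ≠ 0 := by
    rintro rfl
    exact h0 (subset_tsupport _ hζ)
  have hne := heatSymbol_ne_zero hζ0
  have h2 : heatSymbol ζ ^ (s : ℂ) * Complex.exp (-(s * Complex.log (heatSymbol ζ))) = 1 := by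
    rw [Complex.cpow_def_of_ne_zero hne, ← Complex.exp_add, mul_comm (Complex.log _)]
    simp
  simp only [hm]
  rw [fracPowIntegral_eq hs0 hs1 (heatSymbol_re_nonneg ζ) hne]
  have h3 : c * c⁻¹ = 1 := mul_inv_cancel₀ hc0
  rw [hcdef] at h3 ⊢
  linear_combination (spaceTimeChar (x, t) ζ * g ζ) * h2 + (spaceTimeChar (x, t) ζ * g ζ *
    (heatSymbol ζ ^ (s : ℂ) * Complex.exp (-(s * Complex.log (heatSymbol ζ))))) * h3

/-- The parabolic dilation `(x, t) ↦ (a x, a² t)`. -/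
noncomputable def parabolicDilation {n : ℕ} (a : ℝ) : (En n × ℝ) →L[ℝ] (En n × ℝ) :=
  (a • ContinuousLinearMap.id ℝ (En n)).prodMap (a ^ 2 • ContinuousLinearMap.id ℝ ℝ)

theorem parabolicDilation_apply {n : ℕ} (a : ℝ) (z : En n × ℝ) :
    parabolicDilation a z = (a • z.1, a ^ 2 * z.2) := rfl

theorem parabolicDilation_parabolicDilation {n : ℕ} (a b : ℝ) (z : En n × ℝ) :
    parabolicDilation a (parabolicDilation b z) = parabolicDilation (a * b) z := by
  simp only [parabolicDilation_apply, smul_smul, mul_pow, mul_assoc]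

theorem parabolicDilation_one {n : ℕ} (z : En n × ℝ) : parabolicDilation 1 z = z := by
  simp [parabolicDilation_apply]

theorem parabolicDilation_inv_apply_self {n : ℕ} {a : ℝ} (ha : a ≠ 0) (z : En n × ℝ) :
    parabolicDilation a⁻¹ (parabolicDilation a z) = z := by
  rw [parabolicDilation_parabolicDilation, inv_mul_cancel₀ ha, parabolicDilation_one]

theorem parabolicDilation_apply_inv_self {n : ℕ} {a : ℝ} (ha : a ≠ 0) (z : En n × ℝ) :
    parabolicDilation a (parabolicDilation a⁻¹ z) = z := by
  rw [parabolicDilation_parabolicDilation, mul_inv_cancel₀ ha, parabolicDilation_one]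

/-- The parabolic dilation with nonzero ratio as a continuous linear equivalence. -/
noncomputable def parabolicDilationEquiv {n : ℕ} {a : ℝ} (ha : a ≠ 0) :
    (En n × ℝ) ≃L[ℝ] (En n × ℝ) :=
  ContinuousLinearEquiv.equivOfInverse (parabolicDilation a) (parabolicDilation a⁻¹)
    (parabolicDilation_inv_apply_self ha) (parabolicDilation_apply_inv_self ha)

theorem integral_comp_parabolicDilation {n : ℕ} {a : ℝ} (ha : 0 < a) (F : En n × ℝ → ℂ) :
    ∫ z, F (parabolicDilation a z) = ((a ^ (n + 2))⁻¹ : ℝ) * ∫ z, F z := by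
  have hdet : LinearMap.det ((parabolicDilation a : (En n × ℝ) →L[ℝ] (En n × ℝ)) :
      (En n × ℝ) →ₗ[ℝ] (En n × ℝ)) = a ^ (n + 2) := by
    have : ((parabolicDilation a : (En n × ℝ) →L[ℝ] (En n × ℝ)) :
      (En n × ℝ) →ₗ[ℝ] (En n × ℝ)) = (a • LinearMap.id (R := ℝ) (M := En n)).prodMap
        (a ^ 2 • LinearMap.id (R := ℝ) (M := ℝ)) := rfl
    rw [this, LinearMap.det_prodMap, LinearMap.det_smul, LinearMap.det_smul]
    simp
    ring
  have : (volume : Measure (En n × ℝ)).IsAddHaarMeasure :=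
    inferInstanceAs ((volume : Measure (En n)).prod (volume : Measure ℝ)).IsAddHaarMeasure
  have hmap := Measure.map_linearMap_addHaar_eq_smul_addHaar
    (μ := (volume : Measure (En n × ℝ)))
    (f := ((parabolicDilation a : (En n × ℝ) →L[ℝ] (En n × ℝ)) :
      (En n × ℝ) →ₗ[ℝ] (En n × ℝ))) (by rw [hdet]; positivity)
  have he : MeasurableEmbedding (parabolicDilation a : En n × ℝ → En n × ℝ) :=
    (parabolicDilationEquiv ha.ne').toHomeomorph.measurableEmbedding
  have h1 := he.integral_map (μ := volume) F
  rw [← h1]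
  have : Measure.map (parabolicDilation a) (volume : Measure (En n × ℝ))
    = ENNReal.ofReal |(a ^ (n + 2))⁻¹| • volume := by
    rw [← hdet]; exact hmap
  rw [this, integral_smul_measure, ENNReal.toReal_ofReal (abs_nonneg _),
    abs_of_pos (by positivity), Complex.real_smul]

theorem spaceTimeChar_parabolicDilation {n : ℕ} (a : ℝ) (z ζ : En n × ℝ) :
    spaceTimeChar (parabolicDilation a z) ζ = spaceTimeChar z (parabolicDilation a ζ) := by
  simp only [spaceTimeChar, spaceTimePairing, parabolicDilation_apply, real_inner_smul_left,
    real_inner_smul_right]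
  ring_nf

theorem spaceTimeFourierInv_comp_parabolicDilation {n : ℕ} {a : ℝ} (ha : 0 < a)
    (g : En n × ℝ → ℂ) (z : En n × ℝ) :
    spaceTimeFourierInv (fun ζ => g (parabolicDilation a⁻¹ ζ)) z
      = (a ^ (n + 2) : ℝ) * spaceTimeFourierInv g (parabolicDilation a z) := by
  have h := integral_comp_parabolicDilation (inv_pos.2 ha)
    (fun ζ : En n × ℝ => spaceTimeChar (parabolicDilation a z) ζ * g ζ)
  simp only [spaceTimeChar_parabolicDilation, parabolicDilation_apply_inv_self ha.ne'] at h
  simp only [spaceTimeFourierInv]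
  rw [h]
  simp only [spaceTimeChar_parabolicDilation, inv_pow, inv_inv]

/-- The rescaled kernel `z ↦ a^{n+2} κ(δ_a z)`. -/
noncomputable def parabolicRescale {n : ℕ} (κ : En n × ℝ → ℂ) (a : ℝ) (z : En n × ℝ) : ℂ :=
  (a ^ (n + 2) : ℝ) * κ (parabolicDilation a z)

/-- The polynomial weight defining `𝓛^{2s,s}(ℝⁿ × ℝ)`. -/
noncomputable def growthWeight {n : ℕ} (s : ℝ) (z : En n × ℝ) : ℝ :=
  1 + ‖z.1‖ ^ ((n : ℝ) + 2 + 2 * s) + |z.2| ^ ((n : ℝ) / 2 + 1 + s)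

theorem growthWeight_pos {n : ℕ} (s : ℝ) (z : En n × ℝ) : 0 < growthWeight s z := by
  unfold growthWeight; positivity

theorem growthWeight_le {n : ℕ} {s : ℝ} (hs0 : 0 < s) (hs1 : s ≤ 1) (z : En n × ℝ) :
    growthWeight s z ≤ 3 * (1 + ‖z‖) ^ (n + 4) := by
  have h0 := norm_nonneg z
  have hn : (0 : ℝ) ≤ n := n.cast_nonneg
  have key : ∀ v p : ℝ, 0 ≤ v → v ≤ ‖z‖ → 0 ≤ p → p ≤ n + 4 → v ^ p ≤ (1 + ‖z‖) ^ (n + 4) := by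
    intro v p hv hvz hp hpn
    calc v ^ p ≤ (1 + ‖z‖) ^ p := Real.rpow_le_rpow hv (by linarith) hp
      _ ≤ (1 + ‖z‖) ^ ((n + 4 : ℕ) : ℝ) :=
        Real.rpow_le_rpow_of_exponent_le (by linarith) (by push_cast; exact hpn)
      _ = _ := Real.rpow_natCast _ _
  have h1 := key ‖z.1‖ (n + 2 + 2 * s) (norm_nonneg _) (norm_fst_le z) (by positivity)
    (by linarith)
  have h2 := key |z.2| (n / 2 + 1 + s) (abs_nonneg _) (norm_snd_le z) (by positivity)
    (by linarith)
  have h3 : (1 : ℝ) ≤ (1 + ‖z‖) ^ (n + 4) := one_le_pow₀ (by linarith)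
  unfold growthWeight
  linarith

theorem rpow_mul_growthWeight_le {n : ℕ} {s : ℝ} (hs0 : 0 < s) (hs1 : s ≤ 1) {ε : ℝ} (hε : 0 < ε)
    (hε1 : ε ≤ 1) (z : En n × ℝ) :
    ε ^ ((n : ℝ) + 2 + 2 * s) * growthWeight s z ≤ 3 * (1 + ‖parabolicDilation ε z‖) ^ (n + 4) := by
  refine le_trans ?_ (growthWeight_le hs0 hs1 (parabolicDilation ε z))
  simp only [growthWeight, parabolicDilation_apply, norm_smul, Real.norm_eq_abs, abs_mul, abs_pow,
    abs_of_pos hε]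
  rw [Real.mul_rpow hε.le (norm_nonneg _), Real.mul_rpow (by positivity) (abs_nonneg _)]
  have h1 : (ε ^ 2) ^ ((n : ℝ) / 2 + 1 + s) = ε ^ ((n : ℝ) + 2 + 2 * s) := by
    rw [← Real.rpow_natCast, ← Real.rpow_mul hε.le]
    congr 1
    push_cast
    ring
  have h2 : ε ^ ((n : ℝ) + 2 + 2 * s) ≤ 1 := Real.rpow_le_one hε.le hε1 (by positivity)
  rw [h1]
  linarith

theorem one_add_norm_le_mul {E : Type*} [SeminormedAddCommGroup E] (a b : E) :
    1 + ‖a‖ ≤ (1 + ‖a - b‖) * (1 + ‖b‖) := by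
  have h := norm_add_le (a - b) b
  rw [sub_add_cancel] at h
  nlinarith [norm_nonneg (a - b), norm_nonneg b]

theorem norm_parabolicDilation_le {n : ℕ} {a : ℝ} (ha : 0 ≤ a) (ha1 : a ≤ 1) (z : En n × ℝ) :
    ‖parabolicDilation a z‖ ≤ a * ‖z‖ := by
  rw [parabolicDilation_apply, Prod.norm_def]
  refine max_le ?_ ?_
  · simp only [norm_smul, Real.norm_eq_abs, abs_of_nonneg ha]
    gcongr
    exact norm_fst_le z
  · simp only [norm_mul, norm_pow, Real.norm_eq_abs, abs_of_nonneg ha]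
    have h : |z.2| ≤ ‖z‖ := norm_snd_le z
    have h2 : a ^ 2 ≤ a := by nlinarith
    gcongr

theorem SchwartzMap.exists_one_add_pow_mul_norm_iteratedFDeriv_le {E : Type*}
    [NormedAddCommGroup E] [NormedSpace ℝ E] (κ : SchwartzMap E ℂ) (N m : ℕ) :
    ∃ C, 0 ≤ C ∧ ∀ z, (1 + ‖z‖) ^ N * ‖iteratedFDeriv ℝ m κ z‖ ≤ C := by
  have h := SchwartzMap.one_add_le_sup_seminorm_apply (𝕜 := ℝ) (m := (N, m)) (k := N) (n := m)
    le_rfl le_rfl κ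
  exact ⟨_, le_trans (by positivity) (h 0), h⟩

theorem SchwartzMap.exists_one_add_pow_mul_norm_le {E : Type*} [NormedAddCommGroup E]
    [NormedSpace ℝ E] (κ : SchwartzMap E ℂ) (N : ℕ) :
    ∃ C, 0 ≤ C ∧ ∀ z, (1 + ‖z‖) ^ N * ‖κ z‖ ≤ C := by
  simpa only [norm_iteratedFDeriv_zero] using κ.exists_one_add_pow_mul_norm_iteratedFDeriv_le N 0

theorem SchwartzMap.exists_one_add_pow_mul_norm_comp_sub_le {E : Type*} [NormedAddCommGroup E]
    [NormedSpace ℝ E] (κ : SchwartzMap E ℂ) (N : ℕ) :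
    ∃ C, 0 ≤ C ∧ ∀ z w, (1 + ‖z‖) ^ N * ‖κ (z - w)‖ ≤ C * (1 + ‖w‖) ^ N := by
  obtain ⟨C, hC0, hC⟩ := κ.exists_one_add_pow_mul_norm_le N
  refine ⟨C, hC0, fun z w => ?_⟩
  calc (1 + ‖z‖) ^ N * ‖κ (z - w)‖
      ≤ ((1 + ‖z - w‖) * (1 + ‖w‖)) ^ N * ‖κ (z - w)‖ := by
        gcongr; exact one_add_norm_le_mul z w
    _ = (1 + ‖z - w‖) ^ N * ‖κ (z - w)‖ * (1 + ‖w‖) ^ N := by rw [mul_pow]; ring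
    _ ≤ C * (1 + ‖w‖) ^ N := by gcongr; exact hC _

theorem SchwartzMap.exists_one_add_pow_mul_norm_sub_le {E : Type*} [NormedAddCommGroup E]
    [NormedSpace ℝ E] (κ : SchwartzMap E ℂ) (N : ℕ) :
    ∃ C, 0 ≤ C ∧ ∀ z w, (1 + ‖z‖) ^ N * ‖κ (z - w) - κ z‖ ≤ C * (1 + ‖w‖) ^ N * ‖w‖ := by
  obtain ⟨C, hC0, hC⟩ : ∃ C, 0 ≤ C ∧ ∀ z, (1 + ‖z‖) ^ N * ‖fderiv ℝ κ z‖ ≤ C := by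
    simpa only [norm_iteratedFDeriv_one] using κ.exists_one_add_pow_mul_norm_iteratedFDeriv_le N 1
  refine ⟨C, hC0, fun z w => ?_⟩
  have hz : 0 < (1 + ‖z‖) ^ N := by positivity
  have hbound : ∀ y ∈ Metric.closedBall z ‖w‖,
      ‖fderiv ℝ κ y‖ ≤ C * (1 + ‖w‖) ^ N / (1 + ‖z‖) ^ N := by
    intro y hy
    rw [le_div_iff₀ hz]
    rw [mem_closedBall_iff_norm'] at hy
    calc ‖fderiv ℝ κ y‖ * (1 + ‖z‖) ^ N
        ≤ ‖fderiv ℝ κ y‖ * ((1 + ‖w‖) * (1 + ‖y‖)) ^ N := by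
          gcongr
          exact (one_add_norm_le_mul z y).trans (by gcongr)
      _ = (1 + ‖y‖) ^ N * ‖fderiv ℝ κ y‖ * (1 + ‖w‖) ^ N := by rw [mul_pow]; ring
      _ ≤ C * (1 + ‖w‖) ^ N := by gcongr; exact hC y
  have := (convex_closedBall z ‖w‖).norm_image_sub_le_of_norm_fderiv_le (𝕜 := ℝ)
    (fun y _ => κ.differentiableAt) hbound (Metric.mem_closedBall_self (norm_nonneg w))
    (show z - w ∈ _ by simp)
  rw [sub_sub_cancel_left, norm_neg, div_mul_eq_mul_div, le_div_iff₀ hz] at this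
  linarith

theorem integrable_mul_of_growthWeight {n : ℕ} {s : ℝ} {u : En n × ℝ → ℝ}
    (hu : Integrable (fun z => u z / growthWeight s z)) {f : En n × ℝ → ℂ}
    (hf : AEStronglyMeasurable f) {C : ℝ} (hC : ∀ z, growthWeight s z * ‖f z‖ ≤ C) :
    Integrable (fun z => (u z : ℂ) * f z) := by
  have hW : Measurable (fun z : En n × ℝ => growthWeight s z) := by
    unfold growthWeight; fun_prop
  have h : Integrable (fun z => ((growthWeight s z : ℝ) : ℂ) * f z *
      ((u z / growthWeight s z : ℝ) : ℂ)) := by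
    refine hu.ofReal.bdd_mul (c := C) (hW.complex_ofReal.aestronglyMeasurable.mul hf)
      (.of_forall fun z => ?_)
    rw [norm_mul, Complex.norm_real, Real.norm_of_nonneg (growthWeight_pos s z).le]
    exact hC z
  refine h.congr (.of_forall fun z => ?_)
  have : ((growthWeight s z : ℝ) : ℂ) ≠ 0 := by exact_mod_cast (growthWeight_pos s z).ne'
  simp only [Complex.ofReal_div]
  field_simp

theorem tendsto_integral_mul_of_growthWeight {n : ℕ} {s : ℝ} {u : En n × ℝ → ℝ}
    (hm : AEStronglyMeasurable u)
    (hu : Integrable (fun z => u z / growthWeight s z)) {F : ℕ → En n × ℝ → ℂ} {f : En n × ℝ → ℂ}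
    (hF : ∀ k, AEStronglyMeasurable (F k)) {C : ℝ} (hC : ∀ k z, growthWeight s z * ‖F k z‖ ≤ C)
    (hlim : ∀ z, Filter.Tendsto (fun k => F k z) Filter.atTop (nhds (f z))) :
    Filter.Tendsto (fun k => ∫ z, (u z : ℂ) * F k z) Filter.atTop
      (nhds (∫ z, (u z : ℂ) * f z)) := by
  refine tendsto_integral_of_dominated_convergence (fun z => C * ‖u z / growthWeight s z‖)
    (fun k => (Complex.continuous_ofReal.comp_aestronglyMeasurable hm).mul (hF k))
    (hu.norm.const_mul C)
    (fun k => .of_forall fun z => ?_)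
    (.of_forall fun z => (hlim z).const_mul _)
  have hW := growthWeight_pos s z
  rw [norm_mul, Complex.norm_real, norm_div, Real.norm_of_nonneg hW.le, mul_div_assoc',
    le_div_iff₀ hW]
  calc ‖u z‖ * ‖F k z‖ * growthWeight s z = growthWeight s z * ‖F k z‖ * ‖u z‖ := by ring
    _ ≤ C * ‖u z‖ := by gcongr; exact hC k z

theorem integrable_div_growthWeight {n : ℕ} {s : ℝ} {u : En n × ℝ → ℝ}
    (hm : AEStronglyMeasurable u)
    (hu : (∫⁻ t : ℝ, ∫⁻ x : En n, ENNReal.ofReal (|u (x, t)| /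
      (1 + ‖x‖ ^ ((n : ℝ) + 2 + 2 * s) + |t| ^ ((n : ℝ) / 2 + 1 + s)))) < ⊤) :
    Integrable (fun z => u z / growthWeight s z) := by
  have hW : Measurable (fun z : En n × ℝ => growthWeight s z) := by
    unfold growthWeight; fun_prop
  refine ⟨(hm.aemeasurable.div hW.aemeasurable).aestronglyMeasurable, ?_⟩
  rw [hasFiniteIntegral_iff_norm]
  have hmeas : AEMeasurable (fun z => ENNReal.ofReal ‖u z / growthWeight s z‖)
      ((volume : Measure (En n)).prod (volume : Measure ℝ)) :=
    (hm.aemeasurable.div hW.aemeasurable).norm.ennreal_ofReal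
  rw [Measure.volume_eq_prod, lintegral_prod_symm _ hmeas]
  convert hu using 6 with t x
  rw [norm_div, Real.norm_of_nonneg (growthWeight_pos s _).le]
  rfl

theorem exists_schwartzMap_eq_parabolicRescale {n : ℕ} (κ : SchwartzMap (En n × ℝ) ℂ) {a : ℝ}
    (ha : a ≠ 0) : ∃ ψ : SchwartzMap (En n × ℝ) ℂ, ∀ z, ψ z = parabolicRescale κ a z :=
  ⟨((a ^ (n + 2) : ℝ) : ℂ) • SchwartzMap.compCLMOfContinuousLinearEquiv ℂ
    (parabolicDilationEquiv ha) κ, fun _ => rfl⟩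

theorem integrable_mul_schwartzMap_comp_sub {n : ℕ} {s : ℝ} (hs0 : 0 < s) (hs1 : s ≤ 1)
    {u : En n × ℝ → ℝ} (hu : Integrable (fun z => u z / growthWeight s z))
    (ψ : SchwartzMap (En n × ℝ) ℂ) (w : En n × ℝ) :
    Integrable (fun z => (u z : ℂ) * ψ (z - w)) := by
  obtain ⟨C, hC0, hC⟩ := ψ.exists_one_add_pow_mul_norm_comp_sub_le (n + 4)
  refine integrable_mul_of_growthWeight hu (f := fun z => ψ (z - w))
    (C := 3 * (C * (1 + ‖w‖) ^ (n + 4))) ?_ fun z => ?_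
  · exact (ψ.continuous.comp (continuous_id.sub continuous_const)).aestronglyMeasurable
  · calc growthWeight s z * ‖ψ (z - w)‖ ≤ 3 * (1 + ‖z‖) ^ (n + 4) * ‖ψ (z - w)‖ := by
          gcongr; exact growthWeight_le hs0 hs1 z
      _ = 3 * ((1 + ‖z‖) ^ (n + 4) * ‖ψ (z - w)‖) := by ring
      _ ≤ _ := mul_le_mul_of_nonneg_left (hC z w) (by norm_num)

theorem integral_mul_spaceTimeFourierInv_eq_zero {n : ℕ} {s : ℝ} (hs0 : 0 < s) (hs1 : s < 1)
    {u : En n × ℝ → ℝ} (hu : Integrable (fun z => u z / growthWeight s z))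
    (hsol : ∀ φ : SchwartzMap (En n × ℝ) ℂ, (∫ t : ℝ, ∫ x : En n,
      (u (x, t) : ℂ) * (starRingEnd ℂ) (rightHeat n s (fun q => φ q) x t)) = 0)
    {g : En n × ℝ → ℂ} (hg : ContDiff ℝ ∞ g) (hc : HasCompactSupport g) (h0 : 0 ∉ tsupport g) :
    ∫ z, (u z : ℂ) * spaceTimeFourierInv g z = 0 := by
  obtain ⟨φ, hφ⟩ := exists_rightHeat_eq_spaceTimeFourierInv hs0 hs1 hg hc h0
  obtain ⟨ψ, hψ⟩ := exists_schwartzMap_eq_spaceTimeFourierInv hg hc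
  have h_int : Integrable (fun z => (u z : ℂ) * spaceTimeFourierInv g z) := by
    have := integrable_mul_schwartzMap_comp_sub hs0 hs1.le hu ψ 0
    simpa only [sub_zero, hψ] using this
  rw [Measure.volume_eq_prod, integral_prod_symm _ h_int]
  have h1 := congrArg (starRingEnd ℂ) (hsol φ)
  simp_rw [hφ, ← integral_conj, map_mul, Complex.conj_ofReal, Complex.conj_conj, map_zero] at h1
  exact h1

theorem integral_mul_translate_sub_eq {n : ℕ} {s : ℝ} (hs0 : 0 < s) (hs1 : s < 1)
    {u : En n × ℝ → ℝ} (hu : Integrable (fun z => u z / growthWeight s z))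
    (hsol : ∀ φ : SchwartzMap (En n × ℝ) ℂ, (∫ t : ℝ, ∫ x : En n,
      (u (x, t) : ℂ) * (starRingEnd ℂ) (rightHeat n s (fun q => φ q) x t)) = 0)
    {χ₁ χ₂ : En n × ℝ → ℂ} (h₁ : ContDiff ℝ ∞ χ₁) (hc₁ : HasCompactSupport χ₁)
    (h₂ : ContDiff ℝ ∞ χ₂) (hc₂ : HasCompactSupport χ₂) (h : χ₁ =ᶠ[nhds 0] χ₂) (w : En n × ℝ) :
    ∫ z, (u z : ℂ) * (spaceTimeFourierInv χ₁ (z - w) - spaceTimeFourierInv χ₁ z)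
      = ∫ z, (u z : ℂ) * (spaceTimeFourierInv χ₂ (z - w) - spaceTimeFourierInv χ₂ z) := by
  have h_int : ∀ χ : En n × ℝ → ℂ, ContDiff ℝ ∞ χ → HasCompactSupport χ →
      Integrable (fun z => (u z : ℂ) *
        (spaceTimeFourierInv χ (z - w) - spaceTimeFourierInv χ z)) := by
    intro χ hχ hcχ
    obtain ⟨ψ, hψ⟩ := exists_schwartzMap_eq_spaceTimeFourierInv hχ hcχ
    have h3 := (integrable_mul_schwartzMap_comp_sub hs0 hs1.le hu ψ w).sub
      (integrable_mul_schwartzMap_comp_sub hs0 hs1.le hu ψ 0)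
    refine h3.congr (.of_forall fun z => ?_)
    simp only [Pi.sub_apply, sub_zero, hψ, mul_sub]
  rw [← sub_eq_zero, ← integral_sub (h_int χ₁ h₁ hc₁) (h_int χ₂ h₂ hc₂)]
  set g : En n × ℝ → ℂ := fun ζ => (spaceTimeChar (-w) ζ - 1) * (χ₁ ζ - χ₂ ζ) with hgdef
  have hg : ContDiff ℝ ∞ g :=
    ((contDiff_spaceTimeChar _).sub contDiff_const).mul (h₁.sub h₂)
  have hc : HasCompactSupport g := (hc₁.sub hc₂).mul_left
  have h0 : 0 ∉ tsupport g := by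
    rw [notMem_tsupport_iff_eventuallyEq]
    filter_upwards [h] with ζ hζ
    simp [hgdef, hζ]
  rw [← integral_mul_spaceTimeFourierInv_eq_zero hs0 hs1 hu hsol hg hc h0]
  refine integral_congr_ae (.of_forall fun z => ?_)
  have i₁ : Integrable χ₁ := h₁.continuous.integrable_of_hasCompactSupport hc₁
  have i₂ : Integrable χ₂ := h₂.continuous.integrable_of_hasCompactSupport hc₂
  have e : spaceTimeFourierInv g z = (spaceTimeFourierInv χ₁ (z - w) - spaceTimeFourierInv χ₁ z)
      - (spaceTimeFourierInv χ₂ (z - w) - spaceTimeFourierInv χ₂ z) := by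
    have j₁ := integrable_spaceTimeChar_mul i₁ (z - w)
    have j₂ := integrable_spaceTimeChar_mul i₂ (z - w)
    have k₁ := integrable_spaceTimeChar_mul i₁ z
    have k₂ := integrable_spaceTimeChar_mul i₂ z
    simp only [spaceTimeFourierInv]
    rw [← integral_sub' j₁ k₁, ← integral_sub' j₂ k₂, ← integral_sub' (j₁.sub k₁) (j₂.sub k₂)]
    refine integral_congr_ae (.of_forall fun ζ => ?_)
    simp only [hgdef, Pi.sub_apply, sub_eq_add_neg z w, spaceTimeChar_add_left]
    ring
  simp only [e]
  ring

theorem tendsto_integral_mul_parabolicRescale_translate_sub {n : ℕ} {s : ℝ} (hs0 : 0 < s)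
    (hs1 : s ≤ 1 / 2) {u : En n × ℝ → ℝ} (hm : AEStronglyMeasurable u)
    (hu : Integrable (fun z => u z / growthWeight s z)) (κ : SchwartzMap (En n × ℝ) ℂ)
    (w : En n × ℝ) :
    Filter.Tendsto (fun k : ℕ => ∫ z, (u z : ℂ) * (parabolicRescale κ (1 / ((k : ℝ) + 1)) (z - w)
      - parabolicRescale κ (1 / ((k : ℝ) + 1)) z)) Filter.atTop (nhds 0) := by
  obtain ⟨C, hC0, hC⟩ := κ.exists_one_add_pow_mul_norm_sub_le (n + 4)
  set B : ℝ := C * (1 + ‖w‖) ^ (n + 4) * ‖w‖ with hB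
  have hB0 : 0 ≤ B := by positivity
  have key : ∀ ε : ℝ, 0 < ε → ε ≤ 1 → ∀ z, (1 + ‖parabolicDilation ε z‖) ^ (n + 4) *
      ‖parabolicRescale κ ε (z - w) - parabolicRescale κ ε z‖ ≤ ε ^ (n + 3) * B := by
    intro ε hε hε1 z
    have hw : ‖parabolicDilation ε w‖ ≤ ε * ‖w‖ := norm_parabolicDilation_le hε.le hε1 w
    have hw1 : ‖parabolicDilation ε w‖ ≤ ‖w‖ :=
      hw.trans (mul_le_of_le_one_left (norm_nonneg w) hε1)
    have h1 := hC (parabolicDilation ε z) (parabolicDilation ε w)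
    simp only [parabolicRescale, ← mul_sub, norm_mul, map_sub, Complex.norm_real]
    rw [Real.norm_of_nonneg (by positivity : 0 ≤ ε ^ (n + 2))]
    calc _ = ε ^ (n + 2) * ((1 + ‖parabolicDilation ε z‖) ^ (n + 4) *
          ‖κ (parabolicDilation ε z - parabolicDilation ε w) - κ (parabolicDilation ε z)‖) := by
          ring
      _ ≤ ε ^ (n + 2) * (C * (1 + ‖parabolicDilation ε w‖) ^ (n + 4) *
          ‖parabolicDilation ε w‖) := by gcongr
      _ ≤ ε ^ (n + 2) * (C * (1 + ‖w‖) ^ (n + 4) * (ε * ‖w‖)) := by gcongr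
      _ = ε ^ (n + 3) * B := by rw [hB]; ring
  have hε : ∀ k : ℕ, 0 < 1 / ((k : ℝ) + 1) ∧ 1 / ((k : ℝ) + 1) ≤ 1 := fun k =>
    ⟨by positivity, (div_le_one (by positivity)).2 (by linarith [(k.cast_nonneg : (0 : ℝ) ≤ k)])⟩
  have hcont : ∀ ε : ℝ, Continuous (parabolicRescale κ ε) := fun ε =>
    continuous_const.mul (κ.continuous.comp (parabolicDilation ε).continuous)
  have := tendsto_integral_mul_of_growthWeight hm hu (f := fun _ => 0) (C := 3 * B)
    (F := fun k z => parabolicRescale κ (1 / ((k : ℝ) + 1)) (z - w)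
      - parabolicRescale κ (1 / ((k : ℝ) + 1)) z) ?_ ?_ ?_
  · simpa using this
  · intro k
    exact (((hcont _).comp (continuous_id.sub continuous_const)).sub
      (hcont _)).aestronglyMeasurable
  · intro k z
    obtain ⟨h0, h1⟩ := hε k
    generalize 1 / ((k : ℝ) + 1) = ε at h0 h1
    set p := (n : ℝ) + 2 + 2 * s
    have h2 := rpow_mul_growthWeight_le hs0 (by linarith) h0 h1 z
    have h3 := key ε h0 h1 z
    have hp : 0 < ε ^ p := Real.rpow_pos_of_pos h0 _
    have h4 : ε ^ (n + 3) ≤ ε ^ p := by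
      rw [← Real.rpow_natCast]
      exact Real.rpow_le_rpow_of_exponent_ge h0 h1 (by simp only [p]; push_cast; linarith)
    set D := ‖parabolicRescale κ ε (z - w) - parabolicRescale κ ε z‖
    have h5 : ε ^ p * (growthWeight s z * D) ≤ ε ^ p * (3 * B) := by
      calc ε ^ p * (growthWeight s z * D) = ε ^ p * growthWeight s z * D := by ring
        _ ≤ 3 * (1 + ‖parabolicDilation ε z‖) ^ (n + 4) * D := by gcongr
        _ = 3 * ((1 + ‖parabolicDilation ε z‖) ^ (n + 4) * D) := by ring
        _ ≤ 3 * (ε ^ (n + 3) * B) := by gcongr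
        _ ≤ 3 * (ε ^ p * B) := by gcongr
        _ = _ := by ring
    exact le_of_mul_le_mul_left h5 hp
  · intro z
    refine squeeze_zero_norm (a := fun k : ℕ => 1 / ((k : ℝ) + 1) * B) (fun k => ?_) ?_
    · obtain ⟨h0, h1⟩ := hε k
      generalize 1 / ((k : ℝ) + 1) = ε at h0 h1
      have h3 := key ε h0 h1 z
      have h4 : (1 : ℝ) ≤ (1 + ‖parabolicDilation ε z‖) ^ (n + 4) :=
        one_le_pow₀ (by linarith [norm_nonneg (parabolicDilation ε z)])
      have h5 : ε ^ (n + 3) ≤ ε := pow_le_of_le_one h0.le h1 (by omega)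
      calc _ ≤ _ := le_mul_of_one_le_left (norm_nonneg _) h4
        _ ≤ _ := h3
        _ ≤ ε * B := by gcongr
    · simpa using (tendsto_one_div_add_atTop_nhds_zero_nat (𝕜 := ℝ)).mul_const B

theorem integral_mul_parabolicRescale_translate {n : ℕ} {s : ℝ} (hs0 : 0 < s) (hs1 : s ≤ 1 / 2)
    {u : En n × ℝ → ℝ} (hm : AEStronglyMeasurable u)
    (hu : Integrable (fun z => u z / growthWeight s z))
    (hsol : ∀ φ : SchwartzMap (En n × ℝ) ℂ, (∫ t : ℝ, ∫ x : En n,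
      (u (x, t) : ℂ) * (starRingEnd ℂ) (rightHeat n s (fun q => φ q) x t)) = 0)
    {χ : En n × ℝ → ℂ} (hχ : ContDiff ℝ ∞ χ) (hc : HasCompactSupport χ)
    (h1 : χ =ᶠ[nhds 0] fun _ => 1) {κ : SchwartzMap (En n × ℝ) ℂ}
    (hκ : ∀ z, κ z = spaceTimeFourierInv χ z) {r : ℝ} (hr : 0 < r) (w : En n × ℝ) :
    ∫ z, (u z : ℂ) * parabolicRescale κ r (z - w) = ∫ z, (u z : ℂ) * parabolicRescale κ r z := by
  have hs1' : s < 1 := by linarith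
  have hFI : ∀ a : ℝ, 0 < a → ∀ z, spaceTimeFourierInv (fun ζ => χ (parabolicDilation a⁻¹ ζ)) z
      = parabolicRescale κ a z := by
    intro a ha z
    rw [spaceTimeFourierInv_comp_parabolicDilation ha, parabolicRescale, hκ]
  have hsm : ∀ a : ℝ, ContDiff ℝ ∞ (fun ζ => χ (parabolicDilation a⁻¹ ζ)) := fun a =>
    hχ.comp (parabolicDilation a⁻¹).contDiff
  have hcs : ∀ a : ℝ, 0 < a → HasCompactSupport (fun ζ => χ (parabolicDilation a⁻¹ ζ)) :=
    fun a ha => hc.comp_homeomorph (parabolicDilationEquiv (inv_pos.2 ha).ne').toHomeomorph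
  have hev : ∀ a : ℝ, (fun ζ => χ (parabolicDilation a⁻¹ ζ)) =ᶠ[nhds 0] fun _ => 1 := by
    intro a
    have : Filter.Tendsto (parabolicDilation a⁻¹ : En n × ℝ → En n × ℝ) (nhds 0) (nhds 0) :=
      (parabolicDilation a⁻¹).continuous.tendsto' _ _ (map_zero _)
    exact this.eventually h1
  have heq : ∀ ε : ℝ, 0 < ε →
      ∫ z, (u z : ℂ) * (parabolicRescale κ ε (z - w) - parabolicRescale κ ε z)
        = ∫ z, (u z : ℂ) * (parabolicRescale κ r (z - w) - parabolicRescale κ r z) := by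
    intro ε hε
    have := integral_mul_translate_sub_eq hs0 hs1' hu hsol (hsm ε) (hcs ε hε) (hsm r) (hcs r hr)
      ((hev ε).trans (hev r).symm) w
    simpa only [hFI ε hε, hFI r hr] using this
  have hlim := tendsto_integral_mul_parabolicRescale_translate_sub hs0 hs1 hm hu κ w
  have h0 : ∫ z, (u z : ℂ) * (parabolicRescale κ r (z - w) - parabolicRescale κ r z) = 0 := by
    refine tendsto_nhds_unique ?_ hlim
    refine tendsto_const_nhds.congr fun k => (heq _ (by positivity)).symm
  obtain ⟨ψ, hψ⟩ := exists_schwartzMap_eq_parabolicRescale κ hr.ne'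
  have i1 := integrable_mul_schwartzMap_comp_sub hs0 hs1'.le hu ψ w
  have i2 := integrable_mul_schwartzMap_comp_sub hs0 hs1'.le hu ψ 0
  simp only [sub_zero, hψ] at i1 i2
  rw [← sub_eq_zero, ← integral_sub i1 i2, ← h0]
  simp only [mul_sub]

theorem SchwartzMap.integrable_one_add_pow_mul_norm {E : Type*} [NormedAddCommGroup E]
    [NormedSpace ℝ E] [MeasurableSpace E] [BorelSpace E] [SecondCountableTopology E]
    {μ : Measure E} [μ.HasTemperateGrowth] (f : SchwartzMap E ℂ) (N : ℕ) :
    Integrable (fun x => (1 + ‖x‖) ^ N * ‖f x‖) μ := by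
  have h := ((f.integrable_pow_mul μ 0).add (f.integrable_pow_mul μ N)).const_mul (2 ^ (N - 1))
  refine h.mono' (Continuous.aestronglyMeasurable ?_) (.of_forall fun x => ?_)
  · have := f.continuous
    fun_prop
  · rw [Real.norm_of_nonneg (by positivity)]
    have := add_pow_le zero_le_one (norm_nonneg x) N
    simp only [Pi.add_apply, pow_zero, one_pow] at this ⊢
    calc (1 + ‖x‖) ^ N * ‖f x‖ ≤ 2 ^ (N - 1) * (1 + ‖x‖ ^ N) * ‖f x‖ := by gcongr
      _ = _ := by ring

theorem integral_mul_parabolicRescale_comp_sub {n : ℕ} {r : ℝ} (hr : 0 < r)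
    (H κ : En n × ℝ → ℂ) (z : En n × ℝ) :
    ∫ w, H w * parabolicRescale κ r (z - w) = ∫ y, H (z - parabolicDilation r⁻¹ y) * κ y := by
  have h1 := integral_comp_parabolicDilation hr
    (fun y => H (z - parabolicDilation r⁻¹ y) * κ y)
  simp only [parabolicDilation_inv_apply_self hr.ne'] at h1
  have hr' : ((r ^ (n + 2) : ℝ) : ℂ) ≠ 0 := by exact_mod_cast (pow_pos hr _).ne'
  have h2 : ∫ y, H (z - parabolicDilation r⁻¹ y) * κ y
      = ((r ^ (n + 2) : ℝ) : ℂ) * ∫ y, H (z - y) * κ (parabolicDilation r y) := by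
    rw [h1, Complex.ofReal_inv, mul_inv_cancel_left₀ hr']
  have : (volume : Measure (En n × ℝ)).IsAddHaarMeasure :=
    inferInstanceAs ((volume : Measure (En n)).prod (volume : Measure ℝ)).IsAddHaarMeasure
  rw [h2, ← integral_const_mul,
    ← integral_sub_left_eq_self (fun w => H w * parabolicRescale κ r (z - w)) volume z]
  refine integral_congr_ae (.of_forall fun y => ?_)
  simp only [parabolicRescale, sub_sub_cancel]
  ring

theorem integral_mul_integral_parabolicRescale {n : ℕ} {s : ℝ} (hs0 : 0 < s) (hs1 : s ≤ 1)
    {u : En n × ℝ → ℝ} (hm : AEStronglyMeasurable u)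
    (hu : Integrable (fun z => u z / growthWeight s z)) (κ H : SchwartzMap (En n × ℝ) ℂ)
    {r : ℝ} (hr : 0 < r)
    (hinv : ∀ w, ∫ z, (u z : ℂ) * parabolicRescale κ r (z - w)
      = ∫ z, (u z : ℂ) * parabolicRescale κ r z) :
    (∫ z, (u z : ℂ) * parabolicRescale κ r z) * ∫ w, H w
      = ∫ z, (u z : ℂ) * ∫ y, H (z - parabolicDilation r⁻¹ y) * κ y := by
  obtain ⟨ψ, hψ⟩ := exists_schwartzMap_eq_parabolicRescale κ hr.ne'
  obtain ⟨C, hC0, hC⟩ := ψ.exists_one_add_pow_mul_norm_comp_sub_le (n + 4)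
  simp only [← integral_mul_parabolicRescale_comp_sub hr, ← hψ] at hinv ⊢
  rw [← integral_const_mul]
  have : (volume : Measure (En n × ℝ)).HasTemperateGrowth := by
    have : (volume : Measure (En n × ℝ)).IsAddHaarMeasure :=
      inferInstanceAs ((volume : Measure (En n)).prod (volume : Measure ℝ)).IsAddHaarMeasure
    infer_instance
  have h_int : Integrable (Function.uncurry fun (w z : En n × ℝ) => (u z : ℂ) * (H w * ψ (z - w)))
      (volume.prod volume) := by
    have hB := ((H.integrable_one_add_pow_mul_norm (μ := volume) (n + 4)).const_mul
      (3 * C)).mul_prod hu.norm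
    refine hB.mono' ?_ (.of_forall fun p => ?_)
    · have h1 : AEStronglyMeasurable (fun p : (En n × ℝ) × (En n × ℝ) => (u p.2 : ℂ))
          (volume.prod volume) :=
        Complex.continuous_ofReal.comp_aestronglyMeasurable hm.comp_snd
      have hH := H.continuous
      have hψc := ψ.continuous
      exact h1.mul (Continuous.aestronglyMeasurable (by fun_prop))
    · simp only [Function.uncurry]
      have hW := growthWeight_pos s p.2
      have h2 : growthWeight s p.2 * ‖ψ (p.2 - p.1)‖ ≤ 3 * C * (1 + ‖p.1‖) ^ (n + 4) := by
        calc growthWeight s p.2 * ‖ψ (p.2 - p.1)‖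
            ≤ 3 * (1 + ‖p.2‖) ^ (n + 4) * ‖ψ (p.2 - p.1)‖ := by
              gcongr; exact growthWeight_le hs0 hs1 _
          _ = 3 * ((1 + ‖p.2‖) ^ (n + 4) * ‖ψ (p.2 - p.1)‖) := by ring
          _ ≤ 3 * (C * (1 + ‖p.1‖) ^ (n + 4)) :=
            mul_le_mul_of_nonneg_left (hC _ _) (by norm_num)
          _ = _ := by ring
      rw [norm_mul, norm_mul, Complex.norm_real, norm_div, Real.norm_of_nonneg hW.le,
        mul_div_assoc', le_div_iff₀ hW]
      calc _ = growthWeight s p.2 * ‖ψ (p.2 - p.1)‖ * (‖H p.1‖ * ‖u p.2‖) := by ring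
        _ ≤ 3 * C * (1 + ‖p.1‖) ^ (n + 4) * (‖H p.1‖ * ‖u p.2‖) := by gcongr
        _ = _ := by ring
  have hswap := integral_integral_swap h_int
  simp_rw [integral_const_mul] at hswap
  rw [← hswap]
  refine integral_congr_ae (.of_forall fun w => ?_)
  simp only
  rw [← hinv w, mul_comm, ← integral_const_mul]
  refine integral_congr_ae (.of_forall fun z => ?_)
  simp only
  ring

theorem tendsto_integral_mul_parabolicRescale {n : ℕ} {s : ℝ} (hs0 : 0 < s) (hs1 : s ≤ 1)
    {u : En n × ℝ → ℝ} (hm : AEStronglyMeasurable u)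
    (hu : Integrable (fun z => u z / growthWeight s z)) {κ : SchwartzMap (En n × ℝ) ℂ}
    (hκ : ∫ z, κ z = 1)
    (hinv : ∀ r : ℝ, 0 < r → ∀ w, ∫ z, (u z : ℂ) * parabolicRescale κ r (z - w)
      = ∫ z, (u z : ℂ) * parabolicRescale κ r z) (H : SchwartzMap (En n × ℝ) ℂ) :
    Filter.Tendsto (fun k : ℕ => (∫ z, (u z : ℂ) * parabolicRescale κ ((k : ℝ) + 1) z) * ∫ w, H w)
      Filter.atTop (nhds (∫ z, (u z : ℂ) * H z)) := by
  have hpos : ∀ k : ℕ, 0 < (k : ℝ) + 1 := fun k => by positivity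
  simp_rw [fun k : ℕ => integral_mul_integral_parabolicRescale hs0 hs1 hm hu κ H (hpos k)
    (hinv _ (hpos k))]
  have : (volume : Measure (En n × ℝ)).HasTemperateGrowth := by
    have : (volume : Measure (En n × ℝ)).IsAddHaarMeasure :=
      inferInstanceAs ((volume : Measure (En n)).prod (volume : Measure ℝ)).IsAddHaarMeasure
    infer_instance
  obtain ⟨C, hC0, hC⟩ := H.exists_one_add_pow_mul_norm_comp_sub_le (n + 4)
  have hκi := κ.integrable_one_add_pow_mul_norm (μ := volume) (n + 4)
  have hHc := H.continuous
  have hκc := κ.continuous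
  have hdil : ∀ (k : ℕ) (y : En n × ℝ), ‖parabolicDilation ((k : ℝ) + 1)⁻¹ y‖ ≤ ‖y‖ := by
    intro k y
    have h1 : ((k : ℝ) + 1)⁻¹ ≤ 1 :=
      inv_le_one_of_one_le₀ (by linarith [(k.cast_nonneg : (0 : ℝ) ≤ k)])
    exact (norm_parabolicDilation_le (by positivity) h1 y).trans
      (mul_le_of_le_one_left (norm_nonneg y) h1)
  have hb : ∀ (k : ℕ) (z y : En n × ℝ), (1 + ‖z‖) ^ (n + 4) *
      ‖H (z - parabolicDilation ((k : ℝ) + 1)⁻¹ y) * κ y‖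
        ≤ C * ((1 + ‖y‖) ^ (n + 4) * ‖κ y‖) := by
    intro k z y
    rw [norm_mul, ← mul_assoc, ← mul_assoc]
    refine mul_le_mul_of_nonneg_right ((hC _ _).trans ?_) (norm_nonneg _)
    gcongr
    exact hdil k y
  have hcont : ∀ k : ℕ, Continuous (fun p : (En n × ℝ) × (En n × ℝ) =>
      H (p.1 - parabolicDilation ((k : ℝ) + 1)⁻¹ p.2) * κ p.2) := fun k => by
    have := (parabolicDilation (n := n) ((k : ℝ) + 1)⁻¹).continuous
    fun_prop
  refine tendsto_integral_mul_of_growthWeight hm hu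
    (C := 3 * ∫ y, C * ((1 + ‖y‖) ^ (n + 4) * ‖κ y‖)) ?_ ?_ ?_
  · intro k
    exact ((hcont k).stronglyMeasurable.integral_prod_right
      (ν := (volume : Measure (En n × ℝ)))).aestronglyMeasurable
  · intro k z
    calc growthWeight s z * ‖∫ y, H (z - parabolicDilation ((k : ℝ) + 1)⁻¹ y) * κ y‖
        ≤ 3 * (1 + ‖z‖) ^ (n + 4) *
          ∫ y, ‖H (z - parabolicDilation ((k : ℝ) + 1)⁻¹ y) * κ y‖ := by
          gcongr
          · exact growthWeight_le hs0 hs1 z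
          · exact norm_integral_le_integral_norm _
      _ = 3 * ∫ y, (1 + ‖z‖) ^ (n + 4) *
          ‖H (z - parabolicDilation ((k : ℝ) + 1)⁻¹ y) * κ y‖ := by
          rw [mul_assoc, integral_const_mul]
      _ ≤ _ := by
          refine mul_le_mul_of_nonneg_left ?_ (by norm_num)
          exact integral_mono_of_nonneg (.of_forall fun y => by positivity) (hκi.const_mul C)
            (.of_forall fun y => hb k z y)
  · intro z
    have hlim : H z = ∫ y, H z * κ y := by rw [integral_const_mul, hκ, mul_one]
    rw [hlim]
    refine tendsto_integral_of_dominated_convergence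
      (fun y => C * ((1 + ‖y‖) ^ (n + 4) * ‖κ y‖)) (fun k => ?_) (hκi.const_mul C)
      (fun k => .of_forall fun y => ?_) (.of_forall fun y => ?_)
    · exact ((hcont k).comp (Continuous.prodMk_right z)).aestronglyMeasurable
    · exact (le_mul_of_one_le_left (norm_nonneg _)
        (one_le_pow₀ (by linarith [norm_nonneg z]))).trans (hb k z y)
    · have h0 : Filter.Tendsto (fun k : ℕ => ((k : ℝ) + 1)⁻¹) Filter.atTop (nhds 0) := by
        simpa using tendsto_one_div_add_atTop_nhds_zero_nat (𝕜 := ℝ)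
      have hc : Continuous fun a : ℝ => H (z - parabolicDilation a y) * κ y := by
        simp only [parabolicDilation_apply]
        fun_prop
      have := (hc.tendsto 0).comp h0
      simpa [parabolicDilation_apply, Function.comp_def, Prod.mk_zero_zero] using this

theorem exists_ae_eq_const_of_tendsto {n : ℕ}
    {u : En n × ℝ → ℝ} (hloc : LocallyIntegrable u)
    {a : ℕ → ℂ}
    (h : ∀ H : SchwartzMap (En n × ℝ) ℂ, Filter.Tendsto (fun k : ℕ => a k * ∫ w, H w)
      Filter.atTop (nhds (∫ z, (u z : ℂ) * H z))) :
    ∃ c : ℝ, ∀ᵐ p : En n × ℝ, u p = c := by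
  have hvol : (volume : Measure (En n × ℝ)).IsAddHaarMeasure :=
    inferInstanceAs ((volume : Measure (En n)).prod (volume : Measure ℝ)).IsAddHaarMeasure
  have hex : ∀ η : En n × ℝ → ℝ, ContDiff ℝ ∞ η → HasCompactSupport η →
      ∃ H : SchwartzMap (En n × ℝ) ℂ, ∀ z, H z = η z := by
    intro η hη hc
    have hc' : HasCompactSupport (fun z => (η z : ℂ)) :=
      hc.comp_left (g := Complex.ofReal) Complex.ofReal_zero
    exact ⟨hc'.toSchwartzMap (Complex.ofRealCLM.contDiff.comp hη), fun z => rfl⟩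
  let b : ContDiffBump (0 : En n × ℝ) := ⟨1, 2, one_pos, one_lt_two⟩
  obtain ⟨H₀, hH₀⟩ := hex (b.normed volume) b.contDiff_normed b.hasCompactSupport_normed
  have hint₀ : ∫ z, H₀ z = 1 := by
    simp_rw [hH₀, integral_complex_ofReal, b.integral_normed, Complex.ofReal_one]
  set c : ℂ := ∫ z, (u z : ℂ) * H₀ z with hc
  have ha : Filter.Tendsto a Filter.atTop (nhds c) := by
    simpa only [hint₀, mul_one] using h H₀
  have hzero : ∀ᵐ z : En n × ℝ, u z - c.re = 0 := by
    refine ae_eq_zero_of_integral_contDiff_smul_eq_zero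
      (hloc.sub (locallyIntegrable_const _)) fun η hη hcη => ?_
    obtain ⟨H, hH⟩ := hex η hη hcη
    have h1 := tendsto_nhds_unique (h H) (ha.mul_const _)
    have i1 : Integrable (fun z => η z • u z) :=
      hloc.integrable_smul_left_of_hasCompactSupport hη.continuous hcη
    have i2 : Integrable η := hη.continuous.integrable_of_hasCompactSupport hcη
    have h2 : ((∫ z, η z • u z : ℝ) : ℂ) = c * ((∫ z, η z : ℝ) : ℂ) := by
      rw [← integral_complex_ofReal, ← integral_complex_ofReal]
      simp only [hH] at h1
      rw [← h1]
      refine integral_congr_ae (.of_forall fun z => ?_)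
      simp [mul_comm]
    have h3 := congrArg Complex.re h2
    rw [Complex.ofReal_re, Complex.re_mul_ofReal] at h3
    simp_rw [smul_sub]
    rw [integral_sub i1 (by simpa using i2.mul_const c.re), h3]
    simp only [smul_eq_mul, integral_mul_const]
    ring
  exact ⟨c.re, hzero.mono fun z hz => sub_eq_zero.1 hz⟩

/-- Liouville theorem for the homogeneous master equation, case `0 < s ≤ 1/2`:
a distributional solution `u ∈ 𝓛^{2s,s}(ℝⁿ×ℝ)` of `(∂_t - Δ)^s u = 0` is a.e. constant. -/
theorem liouville_master_equation_small_s (n : ℕ) (hn : 2 ≤ n)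
    (s : ℝ) (hs0 : 0 < s) (hs1 : s ≤ 1 / 2)
    (u : En n × ℝ → ℝ)
    (hu_loc : LocallyIntegrable u volume)
    (hu_mem : (∫⁻ t : ℝ, ∫⁻ x : En n,
        ENNReal.ofReal (|u (x, t)| /
          (1 + ‖x‖ ^ ((n : ℝ) + 2 + 2 * s) + |t| ^ ((n : ℝ) / 2 + 1 + s)))) < ⊤)
    (hsol : ∀ φ : SchwartzMap (En n × ℝ) ℂ,
        (∫ t : ℝ, ∫ x : En n,
          (u (x, t) : ℂ) * (starRingEnd ℂ) (rightHeat n s (fun q => φ q) x t)) = 0) :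
    ∃ c : ℝ, ∀ᵐ p : En n × ℝ ∂volume, u p = c := by
  have hm := hu_loc.aestronglyMeasurable
  have hu := integrable_div_growthWeight hm hu_mem
  let b : ContDiffBump (0 : En n × ℝ) := ⟨1, 2, one_pos, one_lt_two⟩
  set χ : En n × ℝ → ℂ := fun ζ => (b ζ : ℂ) with hχdef
  have hχ : ContDiff ℝ ∞ χ := Complex.ofRealCLM.contDiff.comp b.contDiff
  have hc : HasCompactSupport χ :=
    b.hasCompactSupport.comp_left (g := Complex.ofReal) Complex.ofReal_zero
  have h1 : χ =ᶠ[nhds 0] fun _ => 1 := b.eventuallyEq_one.mono fun ζ hζ => by simp [hχdef, hζ]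
  obtain ⟨κ, hκ⟩ := exists_schwartzMap_eq_spaceTimeFourierInv hχ hc
  have hκ1 : ∫ z, κ z = 1 := by
    simp_rw [hκ, integral_spaceTimeFourierInv hχ hc]
    exact h1.self_of_nhds
  exact exists_ae_eq_const_of_tendsto hu_loc
    (tendsto_integral_mul_parabolicRescale hs0 (by linarith) hm hu hκ1 fun r hr w =>
      integral_mul_parabolicRescale_translate hs0 hs1 hm hu hsol hχ hc h1 hκ hr w)
end

section
/- Let n ≥ 1, 0 < s < 1, and let φ be a Schwartz function on ℝⁿ×ℝ. Then there exists a constant C > 0 (depending on n, s, and φ) such that |(∂_t−Δ)^s_{right} φ(x,t)| ≤ C / (1 + |x|^{n+2+2s} + |t|^{n/2+1+s}) for all (x,t) ∈ ℝⁿ×ℝ. -/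
open MeasureTheory

/-- The parabolic weight `1 + |x|² + |t|` on `ℝⁿ×ℝ`. -/
noncomputable def parabolicWeight {n : ℕ} (p : En n × ℝ) : ℝ :=
  1 + ‖p.1‖ ^ 2 + |p.2|

/-- The integrable bump `(1 + |x|²)^{-(n+1)/2}` on `ℝⁿ`. -/
noncomputable def radialDecay {n : ℕ} (x : En n) : ℝ :=
  (1 + ‖x‖ ^ 2) ^ (-((n : ℝ) + 1) / 2)

lemma one_le_parabolicWeight {n : ℕ} (p : En n × ℝ) : 1 ≤ parabolicWeight p := by
  unfold parabolicWeight; nlinarith [sq_nonneg ‖p.1‖, abs_nonneg p.2]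

lemma parabolicWeight_pos {n : ℕ} (p : En n × ℝ) : 0 < parabolicWeight p :=
  one_pos.trans_le (one_le_parabolicWeight p)

lemma radialDecay_nonneg {n : ℕ} (x : En n) : 0 ≤ radialDecay x := by
  unfold radialDecay; positivity

lemma integrable_radialDecay (n : ℕ) : Integrable (radialDecay : En n → ℝ) :=
  integrable_rpow_neg_one_add_norm_sq (by simp)

/-- A Peetre-type inequality for the parabolic weight. -/
lemma parabolicWeight_le_mul {n : ℕ} (p q : En n × ℝ) :
    parabolicWeight p ≤
      2 * parabolicWeight q * (1 + ‖q.1 - p.1‖ ^ 2 + |q.2 - p.2|) := by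
  unfold parabolicWeight
  have h1 : ‖p.1‖ ≤ ‖q.1‖ + ‖q.1 - p.1‖ := by
    simpa using norm_sub_le q.1 (q.1 - p.1)
  have h2 : |p.2| ≤ |q.2| + |q.2 - p.2| := by
    simpa using abs_sub q.2 (q.2 - p.2)
  have h3 : ‖p.1‖ ^ 2 ≤ 2 * ‖q.1‖ ^ 2 + 2 * ‖q.1 - p.1‖ ^ 2 := by
    nlinarith [norm_nonneg p.1, sq_nonneg (‖q.1‖ - ‖q.1 - p.1‖)]
  nlinarith [mul_nonneg (add_nonneg (sq_nonneg ‖q.1‖) (abs_nonneg q.2))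
    (add_nonneg (sq_nonneg ‖q.1 - p.1‖) (abs_nonneg (q.2 - p.2))), abs_nonneg q.2,
    abs_nonneg (q.2 - p.2)]

lemma parabolicWeight_le_of_norm_sub_le {n : ℕ} {p q : En n × ℝ} {d : ℝ}
    (h : ‖q - p‖ ≤ d) : parabolicWeight p ≤ 4 * parabolicWeight q * (1 + d ^ 2) := by
  have h1 : ‖q.1 - p.1‖ ≤ d := (norm_fst_le (q - p)).trans h
  have h2 : |q.2 - p.2| ≤ d := (norm_snd_le (q - p)).trans h
  have h3 : ‖q.1 - p.1‖ ^ 2 ≤ d ^ 2 := by gcongr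
  calc parabolicWeight p
      ≤ 2 * parabolicWeight q * (1 + ‖q.1 - p.1‖ ^ 2 + |q.2 - p.2|) :=
        parabolicWeight_le_mul p q
    _ ≤ 2 * parabolicWeight q * (2 * (1 + d ^ 2)) := by
        have := parabolicWeight_pos q
        gcongr
        nlinarith [sq_nonneg (d - 1)]
    _ = _ := by ring

lemma exists_exp_neg_le_rpow (M : ℝ) :
    ∃ C > (0 : ℝ), ∀ u : ℝ, 0 ≤ u → Real.exp (-u / 4) ≤ C * (1 + u) ^ (-M) := by
  set k := ⌈M⌉₊
  refine ⟨4 ^ k * k.factorial * Real.exp (1 / 4), by positivity, fun u hu => ?_⟩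
  have h1 := Real.pow_div_factorial_le_exp ((1 + u) / 4) (by positivity) k
  have h2 : (1 + u) ^ M ≤ (1 + u) ^ k := by
    rw [← Real.rpow_natCast]
    exact Real.rpow_le_rpow_of_exponent_le (by linarith) (Nat.le_ceil M)
  have h3 : (1 + u) ^ k ≤ 4 ^ k * k.factorial * Real.exp ((1 + u) / 4) := by
    rw [div_pow, div_div, div_le_iff₀ (by positivity)] at h1
    linarith
  have h4 : Real.exp ((1 + u) / 4) = Real.exp (1 / 4) * Real.exp (u / 4) := by
    rw [← Real.exp_add]; ring_nf
  rw [Real.rpow_neg (by linarith), ← div_eq_mul_inv, le_div_iff₀ (by positivity),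
    neg_div, Real.exp_neg, inv_mul_le_iff₀ (by positivity)]
  rw [h4] at h3
  linarith

lemma SchwartzMap.exists_norm_le_parabolicWeight_rpow {n : ℕ} {F : Type*}
    [NormedAddCommGroup F] [NormedSpace ℝ F] (f : SchwartzMap (En n × ℝ) F) {M : ℝ}
    (hM : 0 ≤ M) : ∃ C > (0 : ℝ), ∀ p, ‖f p‖ ≤ C * parabolicWeight p ^ (-M) := by
  set k := ⌈2 * M⌉₊
  set A : ℝ := 2 ^ k * ((Finset.Iic (k, 0)).sup fun m => SchwartzMap.seminorm ℝ m.1 m.2) f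
  have hA : 0 ≤ A := by positivity
  refine ⟨2 ^ M * (A + 1), by positivity, fun p => ?_⟩
  have h1 : (1 + ‖p‖) ^ k * ‖f p‖ ≤ A := by
    simpa using SchwartzMap.one_add_le_sup_seminorm_apply (𝕜 := ℝ) (m := (k, 0)) (k := k)
      (n := 0) le_rfl le_rfl f p
  have h2 : parabolicWeight p ≤ 2 * (1 + ‖p‖) ^ (2 : ℝ) := by
    have a := norm_fst_le p
    have b : |p.2| ≤ ‖p‖ := norm_snd_le p
    have c : ‖p.1‖ ^ 2 ≤ ‖p‖ ^ 2 := by gcongr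
    unfold parabolicWeight
    rw [Real.rpow_two]
    nlinarith [norm_nonneg p]
  have h3 : parabolicWeight p ^ M ≤ 2 ^ M * (1 + ‖p‖) ^ k := by
    calc parabolicWeight p ^ M ≤ (2 * (1 + ‖p‖) ^ (2 : ℝ)) ^ M :=
          Real.rpow_le_rpow (parabolicWeight_pos p).le h2 hM
      _ = 2 ^ M * (1 + ‖p‖) ^ (2 * M) := by
          rw [Real.mul_rpow (by positivity) (by positivity), ← Real.rpow_mul (by positivity)]
      _ ≤ 2 ^ M * (1 + ‖p‖) ^ k := by
          gcongr
          rw [← Real.rpow_natCast]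
          exact Real.rpow_le_rpow_of_exponent_le (by linarith [norm_nonneg p]) (Nat.le_ceil _)
  have hw := Real.rpow_pos_of_pos (parabolicWeight_pos p) M
  rw [Real.rpow_neg (parabolicWeight_pos p).le, ← div_eq_mul_inv, le_div_iff₀ hw]
  calc ‖f p‖ * parabolicWeight p ^ M ≤ ‖f p‖ * (2 ^ M * (1 + ‖p‖) ^ k) := by gcongr
    _ = 2 ^ M * ((1 + ‖p‖) ^ k * ‖f p‖) := by ring
    _ ≤ 2 ^ M * (A + 1) := by gcongr; linarith

lemma SchwartzMap.exists_norm_le_of_norm_sub_le {n : ℕ} {F : Type*}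
    [NormedAddCommGroup F] [NormedSpace ℝ F] (f : SchwartzMap (En n × ℝ) F) {M : ℝ}
    (hM : 0 ≤ M) : ∃ C > (0 : ℝ), ∀ (p q : En n × ℝ) (d : ℝ), ‖q - p‖ ≤ d →
      ‖f q‖ ≤ C * parabolicWeight p ^ (-M) * (1 + d ^ 2) ^ M := by
  obtain ⟨C, hC, h⟩ := f.exists_norm_le_parabolicWeight_rpow hM
  refine ⟨C * 4 ^ M, by positivity, fun p q d hd => (h q).trans ?_⟩
  have hp := parabolicWeight_pos p
  have hq := parabolicWeight_pos q
  have h1 := Real.rpow_le_rpow hp.le (parabolicWeight_le_of_norm_sub_le hd) hM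
  rw [Real.mul_rpow (by positivity) (by positivity),
    Real.mul_rpow (by positivity) (by positivity)] at h1
  have hpM := Real.rpow_pos_of_pos hp M
  have hqM := Real.rpow_pos_of_pos hq M
  rw [Real.rpow_neg hp.le, Real.rpow_neg hq.le, ← div_eq_mul_inv, ← div_eq_mul_inv,
    div_mul_eq_mul_div, div_le_div_iff₀ hqM hpM]
  nlinarith

/-- Symmetric second differences are controlled by the second derivative. -/
lemma norm_symmetric_difference_le {E F : Type*} [NormedAddCommGroup E] [NormedSpace ℝ E]
    [NormedAddCommGroup F] [NormedSpace ℝ F] {f : E → F} (hf : Differentiable ℝ f)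
    (hf' : Differentiable ℝ (fderiv ℝ f)) {p v : E} {B : ℝ}
    (hB : ∀ q, ‖q - p‖ ≤ ‖v‖ → ‖fderiv ℝ (fderiv ℝ f) q‖ ≤ B) :
    ‖f (p + v) + f (p - v) - (f p + f p)‖ ≤ 2 * B * ‖v‖ ^ 2 := by
  have hB0 : 0 ≤ B := le_trans (norm_nonneg (fderiv ℝ (fderiv ℝ f) p)) (hB p (by simp))
  have hd (w : E) : HasFDerivAt (fun w => f (p + w) + f (p - w))
      (fderiv ℝ f (p + w) - fderiv ℝ f (p - w)) w := by
    have h1 := (hf (p + w)).hasFDerivAt.comp w ((hasFDerivAt_id w).const_add p)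
    have h2 := (hf (p - w)).hasFDerivAt.comp w ((hasFDerivAt_id w).const_sub p)
    convert h1.add h2 using 1
    · rfl
    · rw [ContinuousLinearMap.comp_neg, ContinuousLinearMap.comp_id, ContinuousLinearMap.comp_id,
        sub_eq_add_neg]
  have hbd (w : E) (hw : w ∈ Metric.closedBall (0 : E) ‖v‖) :
      ‖fderiv ℝ f (p + w) - fderiv ℝ f (p - w)‖ ≤ 2 * B * ‖v‖ := by
    rw [mem_closedBall_zero_iff] at hw
    have := Convex.norm_image_sub_le_of_norm_fderiv_le (𝕜 := ℝ) (f := fderiv ℝ f) (C := B)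
      (s := Metric.closedBall p ‖v‖) (x := p - w) (y := p + w)
      (fun q _ => hf' q) (fun q hq => hB q (by simpa [dist_eq_norm] using hq))
      (convex_closedBall _ _) (by simpa [dist_eq_norm] using hw)
      (by simpa [dist_eq_norm] using hw)
    have h2 : p + w - (p - w) = (2 : ℝ) • w := by rw [two_smul]; abel
    rw [h2, norm_smul, Real.norm_two] at this
    nlinarith
  have := Convex.norm_image_sub_le_of_norm_hasFDerivWithin_le
    (fun w _ => (hd w).hasFDerivWithinAt) hbd (convex_closedBall _ _)
    (Metric.mem_closedBall_self (norm_nonneg v)) (y := v) (by simp)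
  simp only [add_zero, sub_zero] at this
  linarith [this, sq ‖v‖]

lemma norm_inv_sqrt_smul_sq {E : Type*} [NormedAddCommGroup E] [NormedSpace ℝ E] {τ : ℝ}
    (hτ : 0 ≤ τ) (y : E) : ‖(√τ)⁻¹ • y‖ ^ 2 = ‖y‖ ^ 2 / τ := by
  rw [norm_smul, mul_pow, norm_inv, inv_pow, Real.norm_eq_abs, sq_abs, Real.sq_sqrt hτ]
  ring

/-- For small times the increment is controlled by Taylor expansion. -/
lemma SchwartzMap.exists_norm_increment_le {n : ℕ}
    (φ : SchwartzMap (En n × ℝ) ℂ) {N : ℝ} (hN : 0 ≤ N) :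
    ∃ A > (0 : ℝ), ∀ (x y : En n) (t τ : ℝ), 0 < τ → τ ≤ 1 →
      ‖2 * φ (x, t) - φ (x + y, t + τ) - φ (x - y, t + τ)‖ ≤
        A * parabolicWeight (x, t) ^ (-N) * (τ * (1 + ‖y‖ ^ 2 / τ) ^ (N + 1)) := by
  set ψ := SchwartzMap.fderivCLM ℝ (En n × ℝ) ℂ φ with hψ
  set χ := SchwartzMap.fderivCLM ℝ (En n × ℝ) _ ψ with hχ
  have eψ : fderiv ℝ φ = ψ := by ext1 q; simp [hψ]
  have eχ : fderiv ℝ ψ = χ := by ext1 q; simp [hχ]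
  obtain ⟨C₁, hC₁, h₁⟩ := ψ.exists_norm_le_of_norm_sub_le hN
  obtain ⟨C₂, hC₂, h₂⟩ := χ.exists_norm_le_of_norm_sub_le hN
  refine ⟨2 * (C₁ + C₂) * 3 ^ N, by positivity, fun x y t τ hτ hτ1 => ?_⟩
  set R := parabolicWeight (x, t) ^ (-N)
  have hR : 0 < R := Real.rpow_pos_of_pos (parabolicWeight_pos _) _
  set u := ‖y‖ ^ 2 / τ with hu
  have hu0 : 0 ≤ u := by positivity
  have hyu : ‖y‖ ^ 2 = τ * u := by rw [hu]; field_simp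
  have hyu' : ‖y‖ ^ 2 ≤ u := by rw [hyu]; nlinarith
  have htime : ‖φ (x, t + τ) - φ (x, t)‖ ≤ C₁ * R * 3 ^ N * τ := by
    have hx : (x, t + τ) - (x, t) = ((0 : En n), τ) := by simp
    have hnx : ‖(x, t + τ) - (x, t)‖ = τ := by rw [hx]; simp [Prod.norm_def, abs_of_pos hτ, hτ.le]
    have := Convex.norm_image_sub_le_of_norm_fderiv_le (𝕜 := ℝ) (f := φ)
      (C := C₁ * R * 3 ^ N) (s := Metric.closedBall (x, t) τ) (x := (x, t)) (y := (x, t + τ))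
      (fun q _ => φ.differentiableAt) (fun q hq => by
        rw [eψ]
        refine (h₁ (x, t) q τ (by rwa [mem_closedBall_iff_norm] at hq)).trans ?_
        gcongr
        nlinarith)
      (convex_closedBall _ _) (Metric.mem_closedBall_self hτ.le)
      (by rw [mem_closedBall_iff_norm, hnx])
    rwa [hnx] at this
  have hspace : ‖φ (x + y, t + τ) + φ (x - y, t + τ) - (φ (x, t + τ) + φ (x, t + τ))‖ ≤
      2 * (C₂ * R * (3 * (1 + u)) ^ N) * ‖y‖ ^ 2 := by
    have hv : ‖(y, (0 : ℝ))‖ = ‖y‖ := by simp [Prod.norm_def]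
    have := norm_symmetric_difference_le (f := φ) (p := (x, t + τ)) (v := (y, 0))
      (B := C₂ * R * (3 * (1 + u)) ^ N)
      φ.differentiable (by rw [eψ]; exact ψ.differentiable) (fun q hq => by
        rw [eψ, eχ]
        have hd : ‖q - (x, t)‖ ≤ ‖y‖ + τ := by
          have hx : ‖(x, t + τ) - (x, t)‖ = τ := by
            simp [Prod.norm_def, abs_of_pos hτ, hτ.le]
          calc ‖q - (x, t)‖ ≤ ‖q - (x, t + τ)‖ + ‖(x, t + τ) - (x, t)‖ :=
                norm_sub_le_norm_sub_add_norm_sub _ _ _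
            _ ≤ _ := by rw [hx]; rw [hv] at hq; gcongr
        refine (h₂ (x, t) q _ hd).trans ?_
        gcongr
        nlinarith [sq_nonneg (‖y‖ - τ)])
    rw [hv] at this
    simpa using this
  have e : 2 * φ (x, t) - φ (x + y, t + τ) - φ (x - y, t + τ) =
      -(2 * (φ (x, t + τ) - φ (x, t))) -
      (φ (x + y, t + τ) + φ (x - y, t + τ) - (φ (x, t + τ) + φ (x, t + τ))) := by ring
  rw [e]
  refine (norm_sub_le _ _).trans ?_
  rw [norm_neg, norm_mul, Complex.norm_ofNat]
  rw [hyu, Real.mul_rpow (by norm_num) (by positivity)] at hspace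
  rw [Real.rpow_add (by positivity), Real.rpow_one]
  have h1 : 1 ≤ (1 + u) ^ N := Real.one_le_rpow (by linarith) hN
  have h2 : C₁ * R * 3 ^ N * τ * 1 ≤ C₁ * R * 3 ^ N * τ * ((1 + u) ^ N * (1 + u)) := by
    gcongr
    exact one_le_mul_of_one_le_of_one_le h1 (by linarith)
  have h3 : C₂ * R * 3 ^ N * τ * (1 + u) ^ N * u ≤
    C₂ * R * 3 ^ N * τ * (1 + u) ^ N * (1 + u) := by gcongr; linarith
  linear_combination 2 * htime + hspace + 2 * h2 + 2 * h3

lemma SchwartzMap.exists_increment_mul_kernel_le_of_le_one {n : ℕ}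
    (φ : SchwartzMap (En n × ℝ) ℂ) {N : ℝ} (hN : 0 ≤ N) :
    ∃ A > (0 : ℝ), ∀ (x y : En n) (t τ : ℝ), 0 < τ → τ ≤ 1 →
      ‖2 * φ (x, t) - φ (x + y, t + τ) - φ (x - y, t + τ)‖ *
          (τ ^ (-N) * Real.exp (-‖y‖ ^ 2 / (4 * τ))) ≤
        A * parabolicWeight (x, t) ^ (-N) *
          (τ ^ (1 - N) * radialDecay ((√τ)⁻¹ • y)) := by
  obtain ⟨A, hA, h⟩ := φ.exists_norm_increment_le hN
  obtain ⟨E, hE, hexp⟩ := exists_exp_neg_le_rpow (N + 1 + ((n : ℝ) + 1) / 2)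
  refine ⟨A * E, by positivity, fun x y t τ hτ hτ1 => ?_⟩
  have hD := h x y t τ hτ hτ1
  set R := parabolicWeight (x, t) ^ (-N)
  have hR : 0 < R := Real.rpow_pos_of_pos (parabolicWeight_pos _) _
  set u := ‖y‖ ^ 2 / τ with hu
  have hu0 : 0 ≤ u := by positivity
  have hexpu : Real.exp (-‖y‖ ^ 2 / (4 * τ)) ≤ E * (1 + u) ^ (-(N + 1 + ((n : ℝ) + 1) / 2)) := by
    convert hexp u hu0 using 2
    rw [hu]; field_simp
  calc _ ≤ (A * R * (τ * (1 + u) ^ (N + 1))) *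
        (τ ^ (-N) * (E * (1 + u) ^ (-(N + 1 + ((n : ℝ) + 1) / 2)))) := by gcongr
    _ = A * E * R * ((τ * τ ^ (-N)) *
        ((1 + u) ^ (N + 1) * (1 + u) ^ (-(N + 1 + ((n : ℝ) + 1) / 2)))) := by ring
    _ = _ := by
      have e₁ : τ * τ ^ (-N) = τ ^ (1 - N) := by
        rw [sub_eq_add_neg, Real.rpow_add hτ, Real.rpow_one]
      have e₂ : (1 + u) ^ (N + 1) * (1 + u) ^ (-(N + 1 + ((n : ℝ) + 1) / 2)) =
          radialDecay ((√τ)⁻¹ • y) := by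
        rw [← Real.rpow_add (by positivity), radialDecay, norm_inv_sqrt_smul_sq hτ.le]
        congr 1
        ring
      rw [e₁, e₂]

/-- For large times the three terms of the increment are estimated separately. -/
lemma SchwartzMap.exists_increment_mul_kernel_le_of_one_le {n : ℕ}
    (φ : SchwartzMap (En n × ℝ) ℂ) {N : ℝ} (hN : 0 ≤ N) :
    ∃ A > (0 : ℝ), ∀ (x y : En n) (t τ : ℝ), 1 ≤ τ →
      ‖2 * φ (x, t) - φ (x + y, t + τ) - φ (x - y, t + τ)‖ *
          (τ ^ (-N) * Real.exp (-‖y‖ ^ 2 / (4 * τ))) ≤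
        A * parabolicWeight (x, t) ^ (-N) *
          (τ ^ (-N) * radialDecay ((√τ)⁻¹ • y) +
            (1 + (t + τ) ^ 2)⁻¹ * (radialDecay (x + y) + radialDecay (x - y))) := by
  set a : ℝ := ((n : ℝ) + 1) / 2 with ha
  have ha0 : 0 ≤ a := by positivity
  obtain ⟨C, hC, h⟩ := φ.exists_norm_le_parabolicWeight_rpow hN
  obtain ⟨C', hC', h'⟩ := φ.exists_norm_le_parabolicWeight_rpow (M := N + a + 2) (by positivity)
  obtain ⟨E, hE, hexp⟩ := exists_exp_neg_le_rpow a
  obtain ⟨E', hE', hexp'⟩ := exists_exp_neg_le_rpow N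
  refine ⟨2 * C * E + C' * E' * 4 ^ N, by positivity, fun x y t τ hτ => ?_⟩
  have hτ0 : 0 < τ := one_pos.trans_le hτ
  set R := parabolicWeight (x, t) ^ (-N) with hRdef
  have hR : 0 < R := Real.rpow_pos_of_pos (parabolicWeight_pos _) _
  set K := τ ^ (-N) * Real.exp (-‖y‖ ^ 2 / (4 * τ)) with hK
  have hK0 : 0 ≤ K := by positivity
  set u := ‖y‖ ^ 2 / τ with hu
  have hu0 : 0 ≤ u := by positivity
  have hue : -‖y‖ ^ 2 / (4 * τ) = -u / 4 := by rw [hu]; field_simp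
  have hcenter : ‖φ (x, t)‖ * K ≤ C * E * R * (τ ^ (-N) * radialDecay ((√τ)⁻¹ • y)) := by
    calc ‖φ (x, t)‖ * K ≤ (C * R) * (τ ^ (-N) * (E * (1 + u) ^ (-a))) := by
          rw [hK, hue]
          gcongr
          · exact h _
          · exact hexp u hu0
      _ = _ := by
          rw [radialDecay, norm_inv_sqrt_smul_sq hτ0.le, ← hu, ha]
          ring_nf
  have hshift (z : En n) (hz : ‖z - x‖ = ‖y‖) : ‖φ (z, t + τ)‖ * K ≤
      C' * E' * 4 ^ N * R * ((1 + (t + τ) ^ 2)⁻¹ * radialDecay z) := by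
    set q : En n × ℝ := (z, t + τ) with hq
    have hq0 := parabolicWeight_pos q
    have hp0 := parabolicWeight_pos (x, t)
    have hKq : K ≤ E' * 4 ^ N * R * parabolicWeight q ^ N := by
      have h1 : parabolicWeight (x, t) ≤ 4 * parabolicWeight q * (τ * (1 + u)) := by
        refine (parabolicWeight_le_mul (x, t) q).trans ?_
        have h2 : 1 + ‖q.1 - x‖ ^ 2 + |q.2 - t| ≤ 2 * (τ * (1 + u)) := by
          have h3 : τ * u = ‖y‖ ^ 2 := by rw [hu]; field_simp
          have h4 : q.2 - t = τ := by simp [hq]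
          have h5 : ‖q.1 - x‖ = ‖y‖ := hz
          rw [h4, h5, abs_of_pos hτ0]
          nlinarith [sq_nonneg ‖y‖]
        calc _ ≤ 2 * parabolicWeight q * (2 * (τ * (1 + u))) := by gcongr
          _ = _ := by ring
      have h2 := Real.rpow_le_rpow hp0.le h1 hN
      rw [Real.mul_rpow (by positivity) (by positivity),
        Real.mul_rpow (by positivity) (by positivity)] at h2
      have h3 : K ≤ E' * (τ * (1 + u)) ^ (-N) := by
        rw [hK, hue, Real.mul_rpow (by positivity) (by positivity)]
        calc _ ≤ τ ^ (-N) * (E' * (1 + u) ^ (-N)) := by gcongr; exact hexp' u hu0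
          _ = _ := by ring
      refine h3.trans ?_
      rw [hRdef, Real.rpow_neg (by positivity), Real.rpow_neg hp0.le, mul_assoc E', mul_assoc E']
      gcongr
      rw [mul_right_comm, ← div_eq_mul_inv, inv_le_iff_one_le_mul₀ (by positivity),
        div_mul_eq_mul_div, le_div_iff₀ (by positivity), one_mul]
      exact h2
    have hdecay : parabolicWeight q ^ (-a - 2) ≤ (1 + (t + τ) ^ 2)⁻¹ * radialDecay z := by
      rw [sub_eq_add_neg, Real.rpow_add hq0, mul_comm]
      gcongr
      · rw [Real.rpow_neg hq0.le, Real.rpow_two]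
        gcongr
        have : 1 + |t + τ| ≤ parabolicWeight q := by
          simp only [parabolicWeight, hq]; nlinarith [sq_nonneg ‖z‖]
        nlinarith [abs_nonneg (t + τ), sq_abs (t + τ)]
      · rw [radialDecay, neg_div, ← ha]
        refine Real.rpow_le_rpow_of_nonpos (by positivity) ?_ (by linarith)
        simp only [parabolicWeight, hq]; linarith [abs_nonneg (t + τ)]
    calc ‖φ q‖ * K ≤ (C' * parabolicWeight q ^ (-(N + a + 2))) *
          (E' * 4 ^ N * R * parabolicWeight q ^ N) := by
          gcongr
          exact h' q
      _ = C' * E' * 4 ^ N * R * (parabolicWeight q ^ (-(N + a + 2)) * parabolicWeight q ^ N) := by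
          ring
      _ = C' * E' * 4 ^ N * R * parabolicWeight q ^ (-a - 2) := by
          rw [← Real.rpow_add hq0]; ring_nf
      _ ≤ _ := by gcongr
  have hplus := hshift (x + y) (by simp)
  have hminus := hshift (x - y) (by simp)
  have hD : ‖2 * φ (x, t) - φ (x + y, t + τ) - φ (x - y, t + τ)‖ ≤
      2 * ‖φ (x, t)‖ + ‖φ (x + y, t + τ)‖ + ‖φ (x - y, t + τ)‖ := by
    refine (norm_sub_le _ _).trans (add_le_add_left ((norm_sub_le _ _).trans ?_) _)
    rw [norm_mul, Complex.norm_ofNat]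
  have h1 := mul_le_mul_of_nonneg_right hD hK0
  have hA : 0 ≤ R * (τ ^ (-N) * radialDecay ((√τ)⁻¹ • y)) :=
    mul_nonneg hR.le (mul_nonneg (by positivity) (radialDecay_nonneg _))
  have hB : 0 ≤ R * ((1 + (t + τ) ^ 2)⁻¹ * (radialDecay (x + y) + radialDecay (x - y))) :=
    mul_nonneg hR.le (mul_nonneg (by positivity)
      (add_nonneg (radialDecay_nonneg _) (radialDecay_nonneg _)))
  have hA' := mul_nonneg (by positivity : 0 ≤ C' * E' * (4 : ℝ) ^ N) hA
  have hB' := mul_nonneg (by positivity : 0 ≤ 2 * C * E) hB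
  linarith

lemma integral_radialDecay_inv_sqrt_smul (n : ℕ) {τ : ℝ} (hτ : 0 ≤ τ) :
    ∫ y : En n, radialDecay ((√τ)⁻¹ • y) =
      τ ^ ((n : ℝ) / 2) * ∫ y : En n, radialDecay y := by
  rw [Measure.integral_comp_inv_smul_of_nonneg _ _ (Real.sqrt_nonneg τ), finrank_euclideanSpace_fin,
    smul_eq_mul, Real.sqrt_eq_rpow, ← Real.rpow_mul_natCast hτ, one_div_mul_eq_div]

lemma integrable_radialDecay_inv_sqrt_smul (n : ℕ) {τ : ℝ} (hτ : 0 < τ) :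
    Integrable (fun y : En n => radialDecay ((√τ)⁻¹ • y)) :=
  (integrable_radialDecay n).comp_smul (by positivity)

/-- The profile in `τ` of the spatial integrals. -/
noncomputable def timeProfile (s τ : ℝ) : ℝ :=
  (Set.Ioc 0 1).indicator (fun τ => τ ^ (-s)) τ +
    (Set.Ioi 1).indicator (fun τ => τ ^ (-1 - s)) τ

lemma integrable_timeProfile {s : ℝ} (hs0 : 0 < s) (hs1 : s < 1) :
    Integrable (timeProfile s) := by
  refine Integrable.add ?_ ?_
  · rw [integrable_indicator_iff measurableSet_Ioc]
    exact (intervalIntegral.intervalIntegrable_rpow' (by linarith)).1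
  · rw [integrable_indicator_iff measurableSet_Ioi]
    exact integrableOn_Ioi_rpow_of_lt (by linarith) one_pos

lemma timeProfile_of_le_one {s τ : ℝ} (hτ : 0 < τ) (hτ1 : τ ≤ 1) :
    timeProfile s τ = τ ^ (-s) := by
  simp [timeProfile, hτ, hτ1]

lemma timeProfile_of_one_lt {s τ : ℝ} (hτ : 1 < τ) : timeProfile s τ = τ ^ (-1 - s) := by
  simp [timeProfile, hτ]

lemma timeProfile_nonneg (s τ : ℝ) : 0 ≤ timeProfile s τ :=
  add_nonneg (Set.indicator_nonneg (fun _ h => Real.rpow_nonneg h.1.le _) _)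
    (Set.indicator_nonneg (fun _ h => Real.rpow_nonneg (one_pos.trans h).le _) _)

lemma SchwartzMap.exists_norm_spatial_integral_le {n : ℕ} (φ : SchwartzMap (En n × ℝ) ℂ)
    {s : ℝ} (hs0 : 0 < s) :
    ∃ A > (0 : ℝ), ∀ (x : En n) (t τ : ℝ), 0 < τ →
      ‖∫ y : En n, (2 * φ (x, t) - φ (x + y, t + τ) - φ (x - y, t + τ)) *
          (((τ ^ (-((n : ℝ) / 2 + 1 + s)) * Real.exp (-‖y‖ ^ 2 / (4 * τ)) : ℝ)) : ℂ)‖ ≤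
        A * parabolicWeight (x, t) ^ (-((n : ℝ) / 2 + 1 + s)) *
          (timeProfile s τ + (1 + (t + τ) ^ 2)⁻¹) := by
  set N := (n : ℝ) / 2 + 1 + s with hNdef
  have hN : 0 ≤ N := by positivity
  obtain ⟨A, hA, h⟩ := φ.exists_increment_mul_kernel_le_of_le_one hN
  obtain ⟨B, hB, h'⟩ := φ.exists_increment_mul_kernel_le_of_one_le hN
  set I := ∫ y : En n, radialDecay y with hI
  have hI0 : 0 ≤ I := integral_nonneg radialDecay_nonneg
  refine ⟨A * I + 2 * B * I + 1, by positivity, fun x t τ hτ => ?_⟩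
  set R := parabolicWeight (x, t) ^ (-N)
  have hR : 0 < R := Real.rpow_pos_of_pos (parabolicWeight_pos _) _
  have hnorm (y : En n) : ‖(2 * φ (x, t) - φ (x + y, t + τ) - φ (x - y, t + τ)) *
      (((τ ^ (-N) * Real.exp (-‖y‖ ^ 2 / (4 * τ)) : ℝ)) : ℂ)‖ =
      ‖2 * φ (x, t) - φ (x + y, t + τ) - φ (x - y, t + τ)‖ *
        (τ ^ (-N) * Real.exp (-‖y‖ ^ 2 / (4 * τ))) := by
    rw [norm_mul, Complex.norm_of_nonneg (by positivity)]
  have hint := integrable_radialDecay_inv_sqrt_smul n hτ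
  have hT := timeProfile_nonneg s τ
  have hQ : 0 ≤ (1 + (t + τ) ^ 2)⁻¹ := by positivity
  set Q := (1 + (t + τ) ^ 2)⁻¹
  rcases le_or_gt τ 1 with hτ1 | hτ1
  · have key := norm_integral_le_of_norm_le ((hint.const_mul (τ ^ (1 - N))).const_mul (A * R))
      (Filter.Eventually.of_forall fun y => (hnorm y).trans_le (h x y t τ hτ hτ1))
    rw [integral_const_mul, integral_const_mul, integral_radialDecay_inv_sqrt_smul n hτ.le,
      ← mul_assoc (τ ^ (1 - N)), ← Real.rpow_add hτ,
      show 1 - N + (n : ℝ) / 2 = -s by rw [hNdef]; ring,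
      ← timeProfile_of_le_one (s := s) hτ hτ1, ← hI] at key
    refine key.trans ?_
    calc A * R * (timeProfile s τ * I) = (A * I) * R * (timeProfile s τ) := by ring
      _ ≤ _ := by
        gcongr
        · have : 0 ≤ B * I := by positivity
          linarith
        · linarith
  · have hp : Integrable (fun y : En n => radialDecay (x + y)) :=
      (integrable_radialDecay n).comp_add_left x
    have hm : Integrable (fun y : En n => radialDecay (x - y)) :=
      (integrable_radialDecay n).comp_sub_left x
    have hpm : Integrable (fun y : En n => radialDecay (x + y) + radialDecay (x - y)) :=
      hp.add hm
    have key := norm_integral_le_of_norm_le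
      (((hint.const_mul (τ ^ (-N))).add (hpm.const_mul Q)).const_mul (B * R))
      (Filter.Eventually.of_forall fun y => (hnorm y).trans_le (h' x y t τ hτ1.le))
    simp only [Pi.add_apply] at key
    rw [integral_const_mul, integral_add (hint.const_mul _) (hpm.const_mul Q),
      integral_const_mul, integral_const_mul, integral_add hp hm,
      integral_radialDecay_inv_sqrt_smul n hτ.le, integral_add_left_eq_self,
      integral_sub_left_eq_self,
      ← mul_assoc (τ ^ (-N)), ← Real.rpow_add hτ,
      show -N + (n : ℝ) / 2 = -1 - s by rw [hNdef]; ring,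
      ← timeProfile_of_one_lt (s := s) hτ1, ← hI] at key
    refine key.trans ?_
    have h1 : B * R * (timeProfile s τ * I) ≤ B * R * (timeProfile s τ * (2 * I)) := by
      gcongr; linarith
    calc _ ≤ (2 * B * I) * R * (timeProfile s τ + Q) := by linarith
      _ ≤ _ := by
        gcongr
        have : 0 ≤ A * I := by positivity
        linarith

lemma parabolicWeight_rpow_neg_le {n : ℕ} {s : ℝ} (hs : 0 < s) (x : En n) (t : ℝ) :
    parabolicWeight (x, t) ^ (-((n : ℝ) / 2 + 1 + s)) ≤
      3 / (1 + ‖x‖ ^ ((n : ℝ) + 2 + 2 * s) + |t| ^ ((n : ℝ) / 2 + 1 + s)) := by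
  have hp := parabolicWeight_pos (x, t)
  have h1 := one_le_parabolicWeight (x, t)
  set N := (n : ℝ) / 2 + 1 + s with hN
  have hN0 : 0 ≤ N := by positivity
  have e : (n : ℝ) + 2 + 2 * s = 2 * N := by rw [hN]; ring
  have h2 : ‖x‖ ^ (2 * N) ≤ parabolicWeight (x, t) ^ N := by
    rw [Real.rpow_mul (norm_nonneg x), Real.rpow_two]
    gcongr
    simp only [parabolicWeight]; linarith [abs_nonneg t]
  have h3 : |t| ^ N ≤ parabolicWeight (x, t) ^ N := by
    gcongr
    simp only [parabolicWeight]; linarith [sq_nonneg ‖x‖]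
  have h4 : 1 ≤ parabolicWeight (x, t) ^ N := Real.one_le_rpow h1 hN0
  rw [e, Real.rpow_neg hp.le, le_div_iff₀ (by positivity), inv_mul_le_iff₀ (by positivity)]
  linarith

/-- Optimal decay estimate: for a Schwartz function `φ` on `ℝⁿ×ℝ`,
`|(∂_t−Δ)^s_{right} φ(x,t)| ≤ C / (1 + |x|^{n+2+2s} + |t|^{n/2+1+s})`. -/
theorem rightHeat_decay_estimate (n : ℕ) (hn : 1 ≤ n)
    (s : ℝ) (hs0 : 0 < s) (hs1 : s < 1)
    (φ : SchwartzMap (En n × ℝ) ℂ) :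
    ∃ C > (0 : ℝ), ∀ (x : En n) (t : ℝ),
      ‖rightHeat n s (fun q => φ q) x t‖ ≤
        C / (1 + ‖x‖ ^ ((n : ℝ) + 2 + 2 * s) + |t| ^ ((n : ℝ) / 2 + 1 + s)) := by
  obtain ⟨A, hA, h⟩ := φ.exists_norm_spatial_integral_le hs0
  set H := ∫ τ in Set.Ioi (0 : ℝ), timeProfile s τ with hH
  have hH0 : 0 ≤ H := integral_nonneg (timeProfile_nonneg s)
  have hT : IntegrableOn (timeProfile s) (Set.Ioi 0) :=
    (integrable_timeProfile hs0 hs1).integrableOn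
  refine ⟨(|Cns n s / 2| + 1) * (A * (H + Real.pi)) * 3, by positivity, fun x t => ?_⟩
  have hQ : Integrable (fun τ : ℝ => (1 + (t + τ) ^ 2)⁻¹) :=
    integrable_inv_one_add_sq.comp_add_left t
  have hQpi : ∫ τ in Set.Ioi (0 : ℝ), (1 + (t + τ) ^ 2)⁻¹ ≤ Real.pi := by
    refine (setIntegral_le_integral hQ
      (Filter.Eventually.of_forall fun τ => by positivity)).trans_eq ?_
    rw [integral_add_left_eq_self (fun τ : ℝ => (1 + τ ^ 2)⁻¹), integral_univ_inv_one_add_sq]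
  have hR : 0 ≤ parabolicWeight (x, t) ^ (-((n : ℝ) / 2 + 1 + s)) :=
    Real.rpow_nonneg (parabolicWeight_pos _).le _
  have key := norm_integral_le_of_norm_le ((hT.add hQ.integrableOn).const_mul
      (A * parabolicWeight (x, t) ^ (-((n : ℝ) / 2 + 1 + s))))
    ((ae_restrict_iff' measurableSet_Ioi).2
      (Filter.Eventually.of_forall fun τ hτ => h x t τ hτ))
  simp only [Pi.add_apply] at key
  rw [integral_const_mul, integral_add hT hQ.integrableOn, ← hH] at key
  rw [rightHeat, norm_mul, Complex.norm_real, Real.norm_eq_abs]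
  calc _ ≤ (|Cns n s / 2| + 1) *
        (A * parabolicWeight (x, t) ^ (-((n : ℝ) / 2 + 1 + s)) * (H + Real.pi)) := by
        refine mul_le_mul (by linarith) (key.trans ?_) (norm_nonneg _) (by positivity)
        gcongr
    _ = (|Cns n s / 2| + 1) * (A * (H + Real.pi)) *
        parabolicWeight (x, t) ^ (-((n : ℝ) / 2 + 1 + s)) := by ring
    _ ≤ (|Cns n s / 2| + 1) * (A * (H + Real.pi)) *
        (3 / (1 + ‖x‖ ^ ((n : ℝ) + 2 + 2 * s) + |t| ^ ((n : ℝ) / 2 + 1 + s))) := by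
        gcongr
        exact parabolicWeight_rpow_neg_le hs0 x t
    _ = _ := by rw [mul_div_assoc]
end

section
/- Let 0 < s < 1 and let z ∈ ℂ satisfy Re z ≥ 0 and z ≠ 0. Then the integral ∫_0^∞ (e^{-τz} − 1) τ^{-1-s} dτ converges absolutely and equals Γ(−s) · z^s, where Γ(−s) = Γ(1−s)/(−s) is the Gamma function evaluated at −s and z^s is the principal branch complex power. -/
open MeasureTheory

open Set Filter Topology

lemma Complex.norm_exp_sub_one_le_of_re_nonpos {w : ℂ} (hw : w.re ≤ 0) :
    ‖Complex.exp w - 1‖ ≤ min (2 * ‖w‖) 2 := by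
  have h2 : ‖Complex.exp w - 1‖ ≤ 2 := by
    calc ‖Complex.exp w - 1‖ ≤ ‖Complex.exp w‖ + ‖(1 : ℂ)‖ := norm_sub_le _ _
      _ ≤ 1 + 1 := by
        gcongr
        · rw [Complex.norm_exp]; exact Real.exp_le_one_iff.mpr hw
        · simp
      _ = 2 := by norm_num
  refine le_min ?_ h2
  rcases le_total ‖w‖ 1 with h | h
  · exact Complex.norm_exp_sub_one_le h
  · linarith

lemma rpow_neg_eq_mul_rpow_neg_one_sub {τ : ℝ} (hτ : 0 < τ) (s : ℝ) :
    τ ^ (-s) = τ * τ ^ (-1 - s) := by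
  nth_rewrite 2 [← Real.rpow_one τ]
  rw [← Real.rpow_add hτ]
  ring_nf

/-- The integrand of the regularised Gamma integral at the exponent `-s`. -/
noncomputable def regGammaIntegrand (s : ℝ) (z : ℂ) (τ : ℝ) : ℂ :=
  (Complex.exp (-(τ : ℂ) * z) - 1) * ((τ ^ (-1 - s) : ℝ) : ℂ)

/-- The regularised Gamma integral at the exponent `-s`. -/
noncomputable def regGammaIntegral (s : ℝ) (z : ℂ) : ℂ :=
  ∫ τ in Ioi (0 : ℝ), regGammaIntegrand s z τ

lemma measurable_regGammaIntegrand (s : ℝ) (z : ℂ) : Measurable (regGammaIntegrand s z) := by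
  unfold regGammaIntegrand
  fun_prop

lemma norm_regGammaIntegrand_le {s R τ : ℝ} {z : ℂ} (hz : 0 ≤ z.re) (hR : ‖z‖ ≤ R)
    (hτ : 0 < τ) :
    ‖regGammaIntegrand s z τ‖ ≤ min (2 * R * τ ^ (-s)) (2 * τ ^ (-1 - s)) := by
  have hre : (-(τ : ℂ) * z).re ≤ 0 := by
    simpa using mul_nonneg hτ.le hz
  have h := Complex.norm_exp_sub_one_le_of_re_nonpos hre
  have hn : ‖-(τ : ℂ) * z‖ = τ * ‖z‖ := by simp [abs_of_pos hτ]
  rw [hn] at h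
  have hp : 0 < τ ^ (-1 - s) := Real.rpow_pos_of_pos hτ _
  have hmul : τ ^ (-s) = τ * τ ^ (-1 - s) := rpow_neg_eq_mul_rpow_neg_one_sub hτ s
  rw [regGammaIntegrand, norm_mul, Complex.norm_real, Real.norm_of_nonneg hp.le]
  refine le_min ?_ ?_
  · calc _ ≤ 2 * (τ * R) * τ ^ (-1 - s) := by
          gcongr
          exact (h.trans (min_le_left _ _)).trans (by gcongr)
      _ = _ := by rw [hmul]; ring
  · gcongr
    exact h.trans (min_le_right _ _)

lemma integrableOn_min_rpow {s : ℝ} (hs0 : 0 < s) (hs1 : s < 1) {R : ℝ} (hR : 0 ≤ R) :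
    IntegrableOn (fun τ : ℝ => min (2 * R * τ ^ (-s)) (2 * τ ^ (-1 - s))) (Ioi 0) := by
  have hm : Measurable (fun τ : ℝ => min (2 * R * τ ^ (-s)) (2 * τ ^ (-1 - s))) := by fun_prop
  have hnn : ∀ τ : ℝ, 0 < τ → 0 ≤ min (2 * R * τ ^ (-s)) (2 * τ ^ (-1 - s)) := by
    intro τ hτ
    positivity
  rw [← Ioc_union_Ioi_eq_Ioi zero_le_one]
  refine IntegrableOn.union ?_ ?_
  · have hi : IntegrableOn (fun τ : ℝ => 2 * R * τ ^ (-s)) (Ioc 0 1) :=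
      ((intervalIntegrable_iff_integrableOn_Ioc_of_le zero_le_one).mp
        (intervalIntegral.intervalIntegrable_rpow' (by linarith))).const_mul _
    refine Integrable.mono' hi hm.aestronglyMeasurable ?_
    filter_upwards [ae_restrict_mem measurableSet_Ioc] with τ hτ
    rw [Real.norm_of_nonneg (hnn τ hτ.1)]
    exact min_le_left _ _
  · have hi : IntegrableOn (fun τ : ℝ => 2 * τ ^ (-1 - s)) (Ioi 1) :=
      (integrableOn_Ioi_rpow_of_lt (by linarith) one_pos).const_mul _
    refine Integrable.mono' hi hm.aestronglyMeasurable ?_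
    filter_upwards [ae_restrict_mem measurableSet_Ioi] with τ hτ
    rw [Real.norm_of_nonneg (hnn τ (zero_lt_one.trans hτ))]
    exact min_le_right _ _

lemma integrableOn_regGammaIntegrand {s : ℝ} (hs0 : 0 < s) (hs1 : s < 1) {z : ℂ}
    (hz : 0 ≤ z.re) : IntegrableOn (regGammaIntegrand s z) (Ioi 0) := by
  refine Integrable.mono' (integrableOn_min_rpow hs0 hs1 (norm_nonneg z))
    (measurable_regGammaIntegrand s z).aestronglyMeasurable ?_
  filter_upwards [ae_restrict_mem measurableSet_Ioi] with τ hτ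
  exact norm_regGammaIntegrand_le hz le_rfl hτ

lemma continuousOn_regGammaIntegral {s : ℝ} (hs0 : 0 < s) (hs1 : s < 1) :
    ContinuousOn (regGammaIntegral s) {z : ℂ | 0 ≤ z.re} := by
  intro z hz
  refine continuousWithinAt_of_dominated
    (bound := fun τ : ℝ => min (2 * (‖z‖ + 1) * τ ^ (-s)) (2 * τ ^ (-1 - s))) ?_ ?_
    (integrableOn_min_rpow hs0 hs1 (by positivity)) ?_
  · exact Eventually.of_forall fun w => (measurable_regGammaIntegrand s w).aestronglyMeasurable
  · have hlt : ∀ᶠ w : ℂ in 𝓝[{z : ℂ | 0 ≤ z.re}] z, ‖w‖ < ‖z‖ + 1 :=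
      nhdsWithin_le_nhds
        (continuous_norm.continuousAt.eventually_lt continuousAt_const (lt_add_one _))
    filter_upwards [hlt, self_mem_nhdsWithin] with w hw hw0
    filter_upwards [ae_restrict_mem measurableSet_Ioi] with τ hτ
    exact norm_regGammaIntegrand_le hw0 hw.le hτ
  · refine Eventually.of_forall fun τ => Continuous.continuousWithinAt ?_
    unfold regGammaIntegrand
    fun_prop

lemma hasDerivAt_regGammaIntegral {s : ℝ} (hs0 : 0 < s) (hs1 : s < 1) {z : ℂ}
    (hz : 0 < z.re) :
    HasDerivAt (regGammaIntegral s)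
      (∫ τ in Ioi (0 : ℝ), -(τ : ℂ) * Complex.exp (-(τ : ℂ) * z) * ((τ ^ (-1 - s) : ℝ) : ℂ)) z := by
  have hbi : IntegrableOn (fun τ : ℝ => τ ^ (-s) * Real.exp (-(z.re / 2) * τ)) (Ioi 0) :=
    integrableOn_rpow_mul_exp_neg_mul_rpow (s := -s) (p := 1) (by linarith) one_pos
      (half_pos hz) |>.congr_fun
      (fun τ _ => by simp) measurableSet_Ioi
  refine (hasDerivAt_integral_of_dominated_loc_of_deriv_le
    (F := regGammaIntegrand s)
    (F' := fun w τ => -(τ : ℂ) * Complex.exp (-(τ : ℂ) * w) * ((τ ^ (-1 - s) : ℝ) : ℂ))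
    (s := {w : ℂ | z.re / 2 < w.re})
    ((isOpen_lt continuous_const Complex.continuous_re).mem_nhds (half_lt_self hz))
    (Eventually.of_forall fun w => (measurable_regGammaIntegrand s w).aestronglyMeasurable)
    (integrableOn_regGammaIntegrand hs0 hs1 hz.le)
    (Measurable.aestronglyMeasurable (by fun_prop)) ?_ hbi ?_).2
  · filter_upwards [ae_restrict_mem measurableSet_Ioi] with τ hτ w hw
    have hτ' : 0 < τ := hτ
    have hw' : z.re / 2 < w.re := hw
    have hp : 0 < τ ^ (-1 - s) := Real.rpow_pos_of_pos hτ _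
    have hmul : τ ^ (-s) = τ * τ ^ (-1 - s) := rpow_neg_eq_mul_rpow_neg_one_sub hτ s
    rw [norm_mul, norm_mul, norm_neg, Complex.norm_real, Complex.norm_real, Complex.norm_exp,
      Real.norm_of_nonneg hp.le, Real.norm_of_nonneg hτ'.le, hmul]
    have he : Real.exp (-(τ : ℂ) * w).re ≤ Real.exp (-(z.re / 2) * τ) := by
      apply Real.exp_le_exp.mpr
      simp
      nlinarith
    calc _ = τ * τ ^ (-1 - s) * Real.exp (-(τ : ℂ) * w).re := by ring
      _ ≤ _ := by gcongr
  · refine Eventually.of_forall fun τ w _ => ?_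
    have h1 : HasDerivAt (fun w : ℂ => -(τ : ℂ) * w) (-(τ : ℂ)) w := by
      simpa using (hasDerivAt_id w).const_mul (-(τ : ℂ))
    convert! (h1.cexp.sub_const 1).mul_const ((τ ^ (-1 - s) : ℝ) : ℂ) using 1
    ring

lemma regGammaIntegral_ofReal {s r : ℝ} (hr : 0 < r) :
    regGammaIntegral s r = (r : ℂ) ^ (s : ℂ) * regGammaIntegral s 1 := by
  have h := integral_comp_mul_left_Ioi (regGammaIntegrand s 1) 0 hr
  rw [mul_zero] at h
  have h2 : ∫ τ in Ioi (0 : ℝ), regGammaIntegrand s 1 (r * τ) =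
      ((r ^ (-1 - s) : ℝ) : ℂ) * regGammaIntegral s r := by
    rw [regGammaIntegral, ← integral_const_mul]
    refine setIntegral_congr_fun measurableSet_Ioi fun τ hτ => ?_
    simp only [regGammaIntegrand]
    rw [Real.mul_rpow hr.le (le_of_lt hτ)]
    push_cast
    ring_nf
  rw [h2, Complex.real_smul] at h
  have hpow : (r : ℂ) ^ (s : ℂ) * ((r ^ (-1 - s) : ℝ) : ℂ) = ((r⁻¹ : ℝ) : ℂ) := by
    rw [← Complex.ofReal_cpow hr.le, ← Complex.ofReal_mul, ← Real.rpow_add hr,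
      ← Real.rpow_neg_one]
    ring_nf
  have hne : ((r⁻¹ : ℝ) : ℂ) ≠ 0 := by exact_mod_cast (inv_pos.mpr hr).ne'
  apply mul_left_cancel₀ hne
  rw [← regGammaIntegral] at h
  calc _ = (r : ℂ) ^ (s : ℂ) * (((r ^ (-1 - s) : ℝ) : ℂ) * regGammaIntegral s r) := by
        rw [← hpow]; ring
    _ = _ := by rw [h]; ring

lemma regGammaIntegral_eq_cpow_mul {s : ℝ} (hs0 : 0 < s) (hs1 : s < 1) :
    EqOn (regGammaIntegral s) (fun z => z ^ (s : ℂ) * regGammaIntegral s 1)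
      {z : ℂ | 0 < z.re} := by
  have hopen : IsOpen {z : ℂ | 0 < z.re} := isOpen_lt continuous_const Complex.continuous_re
  have hF : AnalyticOnNhd ℂ (regGammaIntegral s) {z : ℂ | 0 < z.re} :=
    DifferentiableOn.analyticOnNhd (fun z hz =>
      (hasDerivAt_regGammaIntegral hs0 hs1 hz).differentiableAt.differentiableWithinAt) hopen
  have hG : AnalyticOnNhd ℂ (fun z => z ^ (s : ℂ) * regGammaIntegral s 1)
      {z : ℂ | 0 < z.re} :=
    DifferentiableOn.analyticOnNhd (fun z hz =>
      (((Complex.hasStrictDerivAt_cpow_const (Or.inl hz)).hasDerivAt.differentiableAt).mul_const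
        _).differentiableWithinAt) hopen
  refine hF.eqOn_of_preconnected_of_frequently_eq hG
    (convex_halfSpace_re_gt 0).isPreconnected (z₀ := 1) (by simp) ?_
  have ht : Tendsto (fun r : ℝ => (r : ℂ)) (𝓝[>] 1) (𝓝[≠] 1) := by
    refine tendsto_nhdsWithin_iff.mpr ⟨?_, ?_⟩
    · exact (Complex.continuous_ofReal.tendsto' 1 1 (by simp)).mono_left nhdsWithin_le_nhds
    · filter_upwards [self_mem_nhdsWithin] with r hr
      simpa using (ne_of_gt hr : r ≠ 1)
  refine ht.frequently (Eventually.frequently ?_)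
  filter_upwards [self_mem_nhdsWithin] with r hr
  exact regGammaIntegral_ofReal (zero_lt_one.trans hr)

lemma regGammaIntegral_one {s : ℝ} (hs0 : 0 < s) (hs1 : s < 1) :
    regGammaIntegral s 1 = ((Real.Gamma (-s) : ℝ) : ℂ) := by
  have h1 := hasDerivAt_regGammaIntegral hs0 hs1 (z := 1) (by simp)
  have h2 : HasDerivAt (regGammaIntegral s) ((s : ℂ) * regGammaIntegral s 1) 1 := by
    have h := ((Complex.hasStrictDerivAt_cpow_const (x := 1) (c := (s : ℂ))
      (by simp)).hasDerivAt).mul_const (regGammaIntegral s 1)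
    simp only [Complex.one_cpow, mul_one] at h
    refine h.congr_of_eventuallyEq ?_
    filter_upwards [(isOpen_lt continuous_const Complex.continuous_re).mem_nhds
      (show (0 : ℝ) < (1 : ℂ).re by simp)] with z hz
    exact regGammaIntegral_eq_cpow_mul hs0 hs1 hz
  have h3 : (∫ τ in Ioi (0 : ℝ), -(τ : ℂ) * Complex.exp (-(τ : ℂ) * 1) *
      ((τ ^ (-1 - s) : ℝ) : ℂ)) = -((Real.Gamma (-s + 1) : ℝ) : ℂ) := by
    rw [Real.Gamma_eq_integral (by linarith), ← integral_complex_ofReal, ← integral_neg]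
    refine setIntegral_congr_fun measurableSet_Ioi fun τ hτ => ?_
    have hmul : τ ^ (-s) = τ * τ ^ (-1 - s) := rpow_neg_eq_mul_rpow_neg_one_sub hτ s
    simp only [mul_one, add_sub_cancel_right, hmul]
    push_cast
    ring
  have h4 := h2.unique h1
  rw [h3, Real.Gamma_add_one (by linarith)] at h4
  have hs : (s : ℂ) ≠ 0 := by exact_mod_cast hs0.ne'
  apply mul_left_cancel₀ hs
  rw [h4]
  push_cast
  ring

/-- For `0 < s < 1` and `z ∈ ℂ` with `Re z ≥ 0`, `z ≠ 0`, the integral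
`∫_0^∞ (e^{-τz} − 1) τ^{-1-s} dτ` converges absolutely and equals `Γ(−s) z^s`
(principal branch; here `Γ(−s) = Γ(1−s)/(−s)`). -/
theorem gamma_integral_formula (s : ℝ) (hs0 : 0 < s) (hs1 : s < 1)
    (z : ℂ) (hz_re : 0 ≤ z.re) (hz0 : z ≠ 0) :
    IntegrableOn
      (fun τ : ℝ => (Complex.exp (-(τ : ℂ) * z) - 1) * ((τ ^ (-1 - s) : ℝ) : ℂ))
      (Set.Ioi 0) ∧
    (∫ τ in Set.Ioi (0 : ℝ),
        (Complex.exp (-(τ : ℂ) * z) - 1) * ((τ ^ (-1 - s) : ℝ) : ℂ)) =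
      ((Real.Gamma (-s) : ℝ) : ℂ) * z ^ ((s : ℝ) : ℂ) := by

  refine ⟨integrableOn_regGammaIntegrand hs0 hs1 hz_re, ?_⟩
  change regGammaIntegral s z = _
  rw [mul_comm, ← regGammaIntegral_one hs0 hs1]
  have hpath : Tendsto (fun ε : ℝ => z + ε) (𝓝[>] 0) (𝓝 z) :=
    ((by fun_prop : Continuous fun ε : ℝ => z + ε).tendsto' 0 z (by simp)).mono_left
      nhdsWithin_le_nhds
  have hre : ∀ᶠ ε : ℝ in 𝓝[>] 0, 0 < (z + ε).re := by
    filter_upwards [self_mem_nhdsWithin] with ε hε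
    simpa using add_pos_of_nonneg_of_pos hz_re hε
  have hslit : z ∈ Complex.slitPlane := by
    rw [Complex.mem_slitPlane_iff]
    by_contra! h
    exact hz0 (Complex.ext (le_antisymm h.1 hz_re) h.2)
  have hF : Tendsto (fun ε : ℝ => regGammaIntegral s (z + ε)) (𝓝[>] 0)
      (𝓝 (regGammaIntegral s z)) :=
    (continuousOn_regGammaIntegral hs0 hs1 z hz_re).tendsto.comp
      (tendsto_nhdsWithin_iff.mpr ⟨hpath, hre.mono fun _ h => h.le⟩)
  have hG : Tendsto (fun ε : ℝ => (z + ε) ^ (s : ℂ) * regGammaIntegral s 1) (𝓝[>] 0)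
      (𝓝 (z ^ (s : ℂ) * regGammaIntegral s 1)) :=
    (((Complex.hasStrictDerivAt_cpow_const hslit).hasDerivAt.continuousAt.tendsto).comp hpath).mul_const _
  refine tendsto_nhds_unique hF (hG.congr' ?_)
  filter_upwards [hre] with ε hε
  exact (regGammaIntegral_eq_cpow_mul hs0 hs1 hε).symm
end

section
/- Let n ≥ 1 and 0 < s < 1, and let p : ℝⁿ×ℝ → ℝ be a polynomial function in the n+1 variables (x₁,...,xₙ,t) satisfying ∫_ℝ ∫_{ℝⁿ} |p(x,t)| / (1+|x|^{n+2+2s}+|t|^{n/2+1+s}) dx dt < ∞. Then there exist real constants c₀, c₁, ..., cₙ such that p(x,t) = c₀ + Σ_{i=1}^n cᵢ xᵢ for all (x,t); moreover, if s ≤ 1/2 then p is constant. -/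
open MeasureTheory

open Filter Topology Set

open scoped ENNReal

section Scaling

variable {σ R : Type*} [CommSemiring R]

/-- The polynomial `P (λ ^ w i * x i)`, viewed as a polynomial in `λ` with coefficients in
`R[x]`. -/
noncomputable def weightedScaling (w : σ → ℕ) (P : MvPolynomial σ R) :
    Polynomial (MvPolynomial σ R) :=
  MvPolynomial.aeval
    (fun i => Polynomial.C (MvPolynomial.X i : MvPolynomial σ R) * Polynomial.X ^ w i) P

lemma eval_map_weightedScaling (w : σ → ℕ) (P : MvPolynomial σ R) (z : σ → R) (r : R) :
    ((weightedScaling w P).map (MvPolynomial.eval z)).eval r =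
      MvPolynomial.eval (fun i => r ^ w i * z i) P := by
  unfold weightedScaling
  induction P using MvPolynomial.induction_on with
  | C a => simp [MvPolynomial.algebraMap_eq,
      IsScalarTower.algebraMap_apply R (MvPolynomial σ R) (Polynomial (MvPolynomial σ R))]
  | add p q hp hq => simp [hp, hq]
  | mul_X p i hp =>
    simp only [map_mul, Polynomial.map_mul, Polynomial.eval_mul, hp]
    simp [mul_comm (r ^ w i)]

lemma weightedScaling_monomial (w : σ → ℕ) (β : σ →₀ ℕ) (c : R) :
    weightedScaling w (MvPolynomial.monomial β c) =
      Polynomial.monomial (Finsupp.weight w β) (MvPolynomial.monomial β c) := by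
  rw [weightedScaling, MvPolynomial.aeval_monomial, ← Polynomial.C_mul_X_pow_eq_monomial,
    MvPolynomial.monomial_eq, Finsupp.weight_apply]
  simp only [mul_pow, Finsupp.prod, Finsupp.sum, map_mul, map_prod, map_pow, ← pow_mul,
    Finset.prod_mul_distrib, Finset.prod_pow_eq_pow_sum, smul_eq_mul, mul_comm (w _)]
  rw [mul_assoc]
  rfl

lemma coeff_coeff_weightedScaling (w : σ → ℕ) (P : MvPolynomial σ R) (β : σ →₀ ℕ) :
    ((weightedScaling w P).coeff (Finsupp.weight w β)).coeff β = P.coeff β := by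
  classical
  induction P using MvPolynomial.induction_on' with
  | add p q hp hq =>
    have : weightedScaling w (p + q) = weightedScaling w p + weightedScaling w q := by
      simp [weightedScaling]
    simp [this, hp, hq]
  | monomial γ c =>
    rw [weightedScaling_monomial, Polynomial.coeff_monomial]
    split_ifs with h
    · rfl
    · rw [MvPolynomial.coeff_monomial, if_neg (fun h' => h (by rw [h']))]
      simp

end Scaling

/-- A real polynomial with a nonzero coefficient of degree at least `a` grows at least like
`r ^ a`. -/
lemma Polynomial.exists_mul_rpow_le_abs_eval (q : Polynomial ℝ) {a : ℝ} {k : ℕ} (hk : a ≤ k)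
    (hq : q.coeff k ≠ 0) : ∃ c > 0, ∀ᶠ r : ℝ in atTop, c * r ^ a ≤ |q.eval r| := by
  have hq0 : q ≠ 0 := by rintro rfl; simp at hq
  have hlead : q.leadingCoeff ≠ 0 := Polynomial.leadingCoeff_ne_zero.mpr hq0
  have hdeg : k ≤ q.natDegree := Polynomial.le_natDegree_of_ne_zero hq
  refine ⟨|q.leadingCoeff| / 2, by positivity, ?_⟩
  filter_upwards [q.isEquivalent_atTop_lead.isLittleO.def (by norm_num : (0 : ℝ) < 1 / 2),
    eventually_ge_atTop 1] with r hr h1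
  have h2 : r ^ a ≤ r ^ q.natDegree := by
    rw [← Real.rpow_natCast]
    exact Real.rpow_le_rpow_of_exponent_le h1 (hk.trans (by exact_mod_cast hdeg))
  simp only [Pi.sub_apply, Real.norm_eq_abs] at hr
  have h3 := abs_sub_abs_le_abs_sub (q.leadingCoeff * r ^ q.natDegree) (q.eval r)
  rw [abs_sub_comm] at h3
  have h4 : |q.leadingCoeff * r ^ q.natDegree| = |q.leadingCoeff| * r ^ q.natDegree := by
    rw [abs_mul, abs_of_nonneg (by positivity : 0 ≤ r ^ q.natDegree)]
  rw [h4] at h3 hr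
  have := mul_le_mul_of_nonneg_left h2 (abs_nonneg q.leadingCoeff)
  linarith

lemma lintegral_comp_smul_addHaar {E : Type*} [NormedAddCommGroup E] [NormedSpace ℝ E]
    [FiniteDimensional ℝ E] [MeasurableSpace E] [BorelSpace E] (μ : Measure E)
    [μ.IsAddHaarMeasure] {f : E → ℝ≥0∞} (hf : Measurable f) {r : ℝ} (hr : 0 < r) :
    ENNReal.ofReal (r ^ Module.finrank ℝ E) * ∫⁻ x, f (r • x) ∂μ = ∫⁻ x, f x ∂μ := by
  rw [← lintegral_map hf (measurable_const_smul r), Measure.map_addHaar_smul μ hr.ne',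
    lintegral_smul_measure, smul_eq_mul, ← mul_assoc, ← ENNReal.ofReal_mul (by positivity),
    abs_of_pos (by positivity), mul_inv_cancel₀ (by positivity)]
  simp

lemma tendsto_setLIntegral_Ioi_zero {ι : Type*} {l : Filter ι} [l.IsCountablyGenerated]
    {h : ℝ → ℝ≥0∞} (hm : Measurable h) (hfin : ∫⁻ t, h t ≠ ∞) {u : ι → ℝ}
    (hu : Tendsto u l atTop) : Tendsto (fun i => ∫⁻ t in Ioi (u i), h t) l (𝓝 0) := by
  simp_rw [← lintegral_indicator measurableSet_Ioi]
  rw [← lintegral_zero (μ := (volume : Measure ℝ))]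
  refine tendsto_lintegral_filter_of_dominated_convergence h
    (.of_forall fun i => hm.indicator measurableSet_Ioi)
    (.of_forall fun i => .of_forall fun t => indicator_le_self _ _ _) hfin
    (.of_forall fun t => ?_)
  refine tendsto_const_nhds.congr' ?_
  filter_upwards [hu.eventually_ge_atTop t] with i hi
  simp [hi]

lemma snoc_smul_eq_weighted {n : ℕ} (r t : ℝ) (x : En n) :
    (Fin.snoc (fun i => (r • x) i) (r ^ 2 * t) : Fin (n + 1) → ℝ) =
      fun i => r ^ (Fin.snoc (fun _ => 1) 2 : Fin (n + 1) → ℕ) i *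
        (Fin.snoc (fun i => x i) t : Fin (n + 1) → ℝ) i := by
  funext i
  refine Fin.lastCases ?_ (fun i => ?_) i <;> simp

lemma continuous_snoc_euclidean (n : ℕ) :
    Continuous fun z : ℝ × En n => (Fin.snoc (fun i => z.2 i) z.1 : Fin (n + 1) → ℝ) := by
  refine continuous_pi fun i => ?_
  refine Fin.lastCases ?_ (fun i => ?_) i
  · simpa using continuous_fst
  · simp only [Fin.snoc_castSucc]
    fun_prop

lemma continuous_eval_snoc {n : ℕ} (P : MvPolynomial (Fin (n + 1)) ℝ) :
    Continuous fun z : ℝ × En n =>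
      MvPolynomial.eval (Fin.snoc (fun i => z.2 i) z.1 : Fin (n + 1) → ℝ) P :=
  (MvPolynomial.continuous_eval P).comp (continuous_snoc_euclidean n)

lemma lintegral_parabolic_scaling_eq {n : ℕ} {g : ℝ × En n → ℝ≥0∞} (hg : Measurable g) {r : ℝ}
    (hr : 0 < r) :
    ∫⁻ t in Ioi (1 : ℝ), ∫⁻ x : En n, ENNReal.ofReal (r ^ (n + 2)) * g (r ^ 2 * t, r • x) =
      ∫⁻ t in Ioi (r ^ 2), ∫⁻ x : En n, g (t, x) := by
  have hm : Measurable fun t => ∫⁻ x : En n, g (t, x) := hg.lintegral_prod_right'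
  have hx (t : ℝ) : ∫⁻ x : En n, ENNReal.ofReal (r ^ (n + 2)) * g (r ^ 2 * t, r • x) =
      ENNReal.ofReal (r ^ 2) * ∫⁻ x : En n, g (r ^ 2 * t, x) := by
    rw [← lintegral_comp_smul_addHaar volume (f := fun x => g (r ^ 2 * t, x)) (by fun_prop) hr,
      lintegral_const_mul _ (by fun_prop), finrank_euclideanSpace_fin, ← mul_assoc,
      ← ENNReal.ofReal_mul (by positivity), ← pow_add, add_comm 2 n]
  simp_rw [hx]
  rw [← lintegral_indicator measurableSet_Ioi, ← lintegral_indicator measurableSet_Ioi,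
    ← lintegral_comp_smul_addHaar volume (hm.indicator measurableSet_Ioi)
      (by positivity : 0 < r ^ 2), Module.finrank_self, pow_one,
    ← lintegral_const_mul _ (by
      exact (hm.indicator measurableSet_Ioi).comp (measurable_const_smul (r ^ 2)))]
  refine lintegral_congr fun t => ?_
  have : r ^ 2 * t ∈ Ioi (r ^ 2) ↔ t ∈ Ioi (1 : ℝ) := by
    simp only [mem_Ioi]
    exact lt_mul_iff_one_lt_right (by positivity)
  by_cases ht : t ∈ Ioi (1 : ℝ)
  · rw [smul_eq_mul, indicator_of_mem ht, indicator_of_mem (this.mpr ht)]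
  · rw [smul_eq_mul, indicator_of_notMem ht, indicator_of_notMem (mt this.mp ht), mul_zero]

/-- The parabolic weight scales at most like `r ^ (n + 2 + 2 * s)`. -/
lemma parabolic_weight_scaling_le {n : ℕ} {s r : ℝ} (hs : 0 < s) (hr : 1 ≤ r) (t : ℝ) (x : En n) :
    1 + ‖r • x‖ ^ ((n : ℝ) + 2 + 2 * s) + |r ^ 2 * t| ^ ((n : ℝ) / 2 + 1 + s) ≤
      r ^ (n + 2) * (r ^ (2 * s) *
        (1 + ‖x‖ ^ ((n : ℝ) + 2 + 2 * s) + |t| ^ ((n : ℝ) / 2 + 1 + s))) := by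
  have hr0 : 0 < r := by linarith
  have e1 : ‖r • x‖ ^ ((n : ℝ) + 2 + 2 * s) =
      r ^ ((n : ℝ) + 2 + 2 * s) * ‖x‖ ^ ((n : ℝ) + 2 + 2 * s) := by
    rw [norm_smul, Real.norm_of_nonneg hr0.le, Real.mul_rpow hr0.le (norm_nonneg x)]
  have e2 : |r ^ 2 * t| ^ ((n : ℝ) / 2 + 1 + s) =
      r ^ ((n : ℝ) + 2 + 2 * s) * |t| ^ ((n : ℝ) / 2 + 1 + s) := by
    rw [abs_mul, abs_of_pos (by positivity), Real.mul_rpow (by positivity) (abs_nonneg t),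
      ← Real.rpow_natCast, ← Real.rpow_mul hr0.le]
    congr 2
    push_cast
    ring
  have e3 : r ^ ((n : ℝ) + 2 + 2 * s) = r ^ (n + 2) * r ^ (2 * s) := by
    rw [Real.rpow_add hr0, ← Real.rpow_natCast]
    push_cast
    rfl
  have h1 : 1 ≤ r ^ ((n : ℝ) + 2 + 2 * s) := Real.one_le_rpow hr (by positivity)
  rw [e1, e2, ← mul_assoc, ← e3]
  linarith

/-- The high parabolic-degree part of a polynomial that is integrable against the parabolic weight
vanishes. -/
lemma coeff_weightedScaling_eq_zero {n : ℕ} {s : ℝ} (hs : 0 < s)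
    (P : MvPolynomial (Fin (n + 1)) ℝ)
    (hP : (∫⁻ t : ℝ, ∫⁻ x : En n,
        ENNReal.ofReal
          (|MvPolynomial.eval (Fin.snoc (fun i => x i) t) P| /
            (1 + ‖x‖ ^ ((n : ℝ) + 2 + 2 * s) + |t| ^ ((n : ℝ) / 2 + 1 + s)))) < ⊤)
    {k : ℕ} (hk : 2 * s ≤ k) :
    (weightedScaling (Fin.snoc (fun _ => 1) 2 : Fin (n + 1) → ℕ) P).coeff k = 0 := by
  set Q := weightedScaling (Fin.snoc (fun _ => 1) 2 : Fin (n + 1) → ℕ) P with hQ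
  let D : ℝ × En n → ℝ := fun z =>
    1 + ‖z.2‖ ^ ((n : ℝ) + 2 + 2 * s) + |z.1| ^ ((n : ℝ) / 2 + 1 + s)
  have hD : ∀ z, 0 < D z := fun z => by positivity
  let p : ℝ × En n → ℝ := fun z =>
    MvPolynomial.eval (Fin.snoc (fun i => z.2 i) z.1 : Fin (n + 1) → ℝ) P
  have hp : Continuous p := continuous_eval_snoc P
  have hDm : Measurable D := by fun_prop
  let g : ℝ × En n → ℝ≥0∞ := fun z => ENNReal.ofReal (|p z| / D z)
  have hg : Measurable g := by fun_prop
  let F : ℕ → ℝ × En n → ℝ≥0∞ := fun j z => ENNReal.ofReal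
    (|p (((j : ℝ) + 1) ^ 2 * z.1, ((j : ℝ) + 1) • z.2)| / (((j : ℝ) + 1) ^ (2 * s) * D z))
  have hF : ∀ j, Measurable (F j) := fun j => by fun_prop
  have hFg (j : ℕ) (z : ℝ × En n) : F j z ≤
      ENNReal.ofReal (((j : ℝ) + 1) ^ (n + 2)) *
        g (((j : ℝ) + 1) ^ 2 * z.1, ((j : ℝ) + 1) • z.2) := by
    simp only [F, g]
    have hj : (1 : ℝ) ≤ (j : ℝ) + 1 := by simp
    have hj0 : (0 : ℝ) < (j : ℝ) + 1 := by positivity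
    rw [← ENNReal.ofReal_mul (by positivity)]
    refine ENNReal.ofReal_le_ofReal ?_
    rw [mul_div_assoc', div_le_div_iff₀ (mul_pos (by positivity) (hD _)) (hD _)]
    have := mul_le_mul_of_nonneg_left (parabolic_weight_scaling_le hs hj z.1 z.2)
      (abs_nonneg (p (((j : ℝ) + 1) ^ 2 * z.1, ((j : ℝ) + 1) • z.2)))
    simp only [D]
    linarith
  have hFint : Tendsto (fun j => ∫⁻ z in Ioi (1 : ℝ) ×ˢ (univ : Set (En n)), F j z) atTop
      (𝓝 0) := by
    have hu : Tendsto (fun j : ℕ => ((j : ℝ) + 1) ^ 2) atTop atTop :=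
      (tendsto_pow_atTop two_ne_zero).comp
        (tendsto_atTop_add_const_right _ _ tendsto_natCast_atTop_atTop)
    refine tendsto_of_tendsto_of_tendsto_of_le_of_le tendsto_const_nhds
      (tendsto_setLIntegral_Ioi_zero hg.lintegral_prod_right' hP.ne hu) (fun j => zero_le)
      fun j => ?_
    dsimp only
    rw [← lintegral_parabolic_scaling_eq hg (by positivity), Measure.volume_eq_prod,
      ← Measure.prod_restrict, Measure.restrict_univ, lintegral_prod _ (hF j).aemeasurable]
    exact lintegral_mono fun t => lintegral_mono fun x => hFg j (t, x)
  have hae : ∀ᵐ z ∂(volume : Measure (ℝ × En n)).restrict (Ioi (1 : ℝ) ×ˢ univ),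
      liminf (fun j => F j z) atTop = 0 := by
    refine (lintegral_eq_zero_iff (.liminf hF)).mp (le_antisymm ?_ zero_le)
    exact (lintegral_liminf_le hF).trans hFint.liminf_eq.le
  have hcoeff : (fun z : ℝ × En n => MvPolynomial.eval
      (Fin.snoc (fun i => z.2 i) z.1 : Fin (n + 1) → ℝ) (Q.coeff k)) =ᵐ[
        volume.restrict (Ioi (1 : ℝ) ×ˢ univ)] 0 := by
    filter_upwards [hae] with z hz
    by_contra hne
    obtain ⟨c, hc, hev⟩ := Polynomial.exists_mul_rpow_le_abs_eval
      (Q.map (MvPolynomial.eval (Fin.snoc (fun i => z.2 i) z.1 : Fin (n + 1) → ℝ))) hk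
      (by rwa [Polynomial.coeff_map])
    have hev' := (tendsto_atTop_add_const_right atTop (1 : ℝ)
      tendsto_natCast_atTop_atTop).eventually hev
    have hle : ENNReal.ofReal (c / D z) ≤ liminf (fun j => F j z) atTop := by
      refine le_liminf_of_le (by isBoundedDefault) ?_
      filter_upwards [hev'] with j hj
      rw [hQ, eval_map_weightedScaling, ← snoc_smul_eq_weighted] at hj
      refine ENNReal.ofReal_le_ofReal ?_
      have hj0 : (0 : ℝ) < ((j : ℝ) + 1) ^ (2 * s) := by positivity
      rw [div_le_div_iff₀ (hD z) (mul_pos hj0 (hD z)), ← mul_assoc]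
      exact mul_le_mul_of_nonneg_right hj (hD z).le
    rw [hz] at hle
    exact (ENNReal.ofReal_pos.mpr (div_pos hc (hD z))).not_ge hle
  have heq := Measure.eqOn_open_of_ae_eq hcoeff (isOpen_Ioi.prod isOpen_univ)
    (continuous_eval_snoc _).continuousOn continuousOn_const
  refine MvPolynomial.funext_set (fun _ => Ioi (1 : ℝ)) (fun _ => Ioi_infinite 1) fun y hy => ?_
  have := heq (x := (y (Fin.last n), WithLp.toLp 2 fun i => y i.castSucc))
    ⟨hy _ (mem_univ _), mem_univ _⟩
  have hy' : (Fin.snoc (fun i => y i.castSucc) (y (Fin.last n)) : Fin (n + 1) → ℝ) = y :=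
    Fin.snoc_init_self y
  simpa [hy'] using this

/-- A polynomial function on `ℝⁿ×ℝ` whose weighted integral
`∫∫ |p(x,t)|/(1+|x|^{n+2+2s}+|t|^{n/2+1+s})` is finite must have the form
`c₀ + Σ cᵢ xᵢ`; it is constant when `s ≤ 1/2`. -/
theorem polynomial_in_L2ss_is_affine (n : ℕ) (hn : 1 ≤ n)
    (s : ℝ) (hs0 : 0 < s) (hs1 : s < 1)
    (P : MvPolynomial (Fin (n + 1)) ℝ)
    (hP : (∫⁻ t : ℝ, ∫⁻ x : En n,
        ENNReal.ofReal
          (|MvPolynomial.eval (Fin.snoc (fun i => x i) t) P| /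
            (1 + ‖x‖ ^ ((n : ℝ) + 2 + 2 * s) + |t| ^ ((n : ℝ) / 2 + 1 + s)))) < ⊤) :
    ∃ (c₀ : ℝ) (c : Fin n → ℝ),
      (∀ (x : En n) (t : ℝ),
        MvPolynomial.eval (Fin.snoc (fun i => x i) t) P = c₀ + ∑ i, c i * x i) ∧
      (s ≤ 1 / 2 → ∀ i, c i = 0) := by
  
  have hzero (β : Fin (n + 1) →₀ ℕ)
      (hβ : 2 * s ≤ (Finsupp.weight (Fin.snoc (fun _ => 1) 2 : Fin (n + 1) → ℕ) β : ℕ)) :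
      P.coeff β = 0 := by
    rw [← coeff_coeff_weightedScaling (Fin.snoc (fun _ => 1) 2 : Fin (n + 1) → ℕ),
      coeff_weightedScaling_eq_zero hs0 P hP hβ, MvPolynomial.coeff_zero]
  have hweight (β : Fin (n + 1) →₀ ℕ) :
      Finsupp.weight (Fin.snoc (fun _ => 1) 2 : Fin (n + 1) → ℕ) β =
        ∑ i : Fin n, β i.castSucc + 2 * β (Fin.last n) := by
    rw [Finsupp.weight_apply, Finsupp.sum_fintype _ _ (by simp), Fin.sum_univ_castSucc]
    simp [mul_comm]
  refine ⟨P.coeff 0, fun i => P.coeff (Finsupp.single i.castSucc 1), ?_, fun hs i => ?_⟩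
  · have hPeq : P = MvPolynomial.C (P.coeff 0) + ∑ i : Fin n,
        MvPolynomial.C (P.coeff (Finsupp.single i.castSucc 1)) * MvPolynomial.X i.castSucc := by
      ext β
      simp only [MvPolynomial.coeff_add, MvPolynomial.coeff_sum, MvPolynomial.coeff_C_mul,
        MvPolynomial.coeff_C, MvPolynomial.coeff_X]
      by_cases h0 : β = 0
      · simp [h0]
      by_cases h1 : ∃ i : Fin n, Finsupp.single i.castSucc 1 = β
      · obtain ⟨i, rfl⟩ := h1
        rw [if_neg (Ne.symm h0)]
        simp [Finsupp.single_left_inj]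
      · push Not at h1
        rw [hzero]
        · simp [Ne.symm h0, h1]
        · suffices 2 ≤ Finsupp.weight (Fin.snoc (fun _ => 1) 2 : Fin (n + 1) → ℕ) β by
            have : (2 : ℝ) ≤
              (Finsupp.weight (Fin.snoc (fun _ => 1) 2 : Fin (n + 1) → ℕ) β : ℕ) := by
              exact_mod_cast this
            linarith
          rw [hweight]
          by_contra! hlt
          have hlast : β (Fin.last n) = 0 := by omega
          have hsum : ∑ i : Fin n, β i.castSucc = β.degree := by
            rw [Finsupp.degree_eq_sum, Fin.sum_univ_castSucc, hlast, add_zero]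
          have hd : β.degree = 0 ∨ β.degree = 1 := by omega
          rcases hd with hd | hd
          · exact h0 ((Finsupp.degree_eq_zero_iff β).mp hd)
          · obtain ⟨i, rfl⟩ := (Finsupp.sum_eq_one_iff β).mp hd
            induction i using Fin.lastCases with
            | last => simp at hlast
            | cast i => exact h1 i rfl
    intro x t
    conv_lhs => rw [hPeq]
    simp
  · refine hzero _ ?_
    rw [hweight]
    simp [Finsupp.single_apply]
    linarith
end

section
/- Let n ≥ 1 and 0 < s < 1, and let η : ℝⁿ×ℝ → ℝ be a smooth compactly supported function with −1 ≤ η ≤ 0, η ≡ −1 on {|x| ≤ 1} × [−1,1], and η ≡ 0 outside {|x| < 2} × (−4,4). Then the decay exponents in the estimate |(∂_t−Δ)^s_{right} η(x,t)| ≤ C/(1+|x|^{n+2+2s}+|t|^{n/2+1+s}) are optimal: there do NOT exist constants C₁, δ₁ > 0 such that |(∂_t−Δ)^s_{right} η(x,t)| ≤ C₁/(1+|x|^{n+2+2s}+|t|^{n/2+1+s+δ₁}) for all (x,t) with |t|/2 ≤ |x|² ≤ 2|t|, and there do NOT exist constants C₂, δ₂ > 0 such that |(∂_t−Δ)^s_{right}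 η(x,t)| ≤ C₂/(1+|x|^{n+2+2s+δ₂}+|t|^{n/2+1+s}) for all (x,t) with |t|/2 ≤ |x|² ≤ 2|t|. -/
open MeasureTheory

/-- The right fractional heat operator `(∂_t - Δ)^s_{right}` (real-valued version). -/
noncomputable def rightHeatR (n : ℕ) (s : ℝ) (φ : En n × ℝ → ℝ)
    (x : En n) (t : ℝ) : ℝ :=
  (Cns n s / 2) *
    ∫ τ in Set.Ioi (0 : ℝ), ∫ y : En n,
      (2 * φ (x, t) - φ (x + y, t + τ) - φ (x - y, t + τ)) *
        (τ ^ (-((n : ℝ) / 2 + 1 + s)) * Real.exp (-‖y‖ ^ 2 / (4 * τ)))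

/-- The normalization constant is positive for `0 < s < 1`. -/
theorem Cns_pos (n : ℕ) {s : ℝ} (hs0 : 0 < s) (hs1 : s < 1) : 0 < Cns n s := by
  have hΓ : Real.Gamma (-s) ≠ 0 := by
    refine Real.Gamma_ne_zero fun m hm => ?_
    have hsm : s = m := by linarith
    rw [hsm] at hs0 hs1
    norm_cast at hs0 hs1
    omega
  exact div_pos (by positivity) (abs_pos.mpr hΓ)

/-- On the parabola `t = -‖x‖²` a nonpositive bump that equals `-1` on the unit cylinder has
`|(∂_t - Δ)^s_{right} η|` at least of order `(‖x‖²) ^ (-(n/2 + 1 + s))`. -/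
theorem rightHeatR_lower_bound (n : ℕ) {s : ℝ} (hs0 : 0 < s) (hs1 : s < 1)
    {η : En n × ℝ → ℝ} (hη_cont : Continuous η)
    (hη_range : ∀ p, -1 ≤ η p ∧ η p ≤ 0)
    (hη_inner : ∀ (x : En n) (t : ℝ), ‖x‖ ≤ 1 → |t| ≤ 1 → η (x, t) = -1)
    (hη_outer : ∀ (x : En n) (t : ℝ), 2 ≤ ‖x‖ ∨ 4 ≤ |t| → η (x, t) = 0) :
    ∃ c > (0 : ℝ), ∀ x : En n, 3 ≤ ‖x‖ →
      c * (‖x‖ ^ 2) ^ (-((n : ℝ) / 2 + 1 + s)) ≤ |rightHeatR n s η x (-‖x‖ ^ 2)| := by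
  set a : ℝ := (n : ℝ) / 2 + 1 + s with ha
  have ha0 : 0 < a := by positivity
  have hC := Cns_pos n hs0 hs1
  set V : ℝ := volume.real (Metric.closedBall (0 : En n) 1) with hV
  have hVpos : 0 < V := ENNReal.toReal_pos
    (Metric.measure_closedBall_pos volume _ one_pos).ne' measure_closedBall_lt_top.ne
  refine ⟨Cns n s / 2 * (2 * V * (2 ^ (-a) * Real.exp (-2))), by positivity, fun x hx => ?_⟩
  set R : ℝ := ‖x‖ with hR
  have hR0 : 0 < R := by linarith
  have hR9 : 9 ≤ R ^ 2 := by nlinarith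
  have hzero : η (x, -R ^ 2) = 0 := by
    refine hη_outer _ _ (Or.inr ?_)
    rw [abs_of_nonpos (by linarith)]
    linarith
  let G : ℝ × En n → ℝ := fun p =>
    (2 * η (x, -R ^ 2) - η (x + p.2, -R ^ 2 + p.1) - η (x - p.2, -R ^ 2 + p.1)) *
      (p.1 ^ (-a) * Real.exp (-‖p.2‖ ^ 2 / (4 * p.1)))
  let μ : Measure (ℝ × En n) := (volume.restrict (Set.Ioi (0 : ℝ))).prod volume
  have hGmeas : Measurable G := by
    have h1 : Measurable fun p : ℝ × En n => η (x + p.2, -R ^ 2 + p.1) :=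
      (hη_cont.comp (by fun_prop)).measurable
    have h2 : Measurable fun p : ℝ × En n => η (x - p.2, -R ^ 2 + p.1) :=
      (hη_cont.comp (by fun_prop)).measurable
    have h3 : Measurable fun p : ℝ × En n => p.1 ^ (-a) * Real.exp (-‖p.2‖ ^ 2 / (4 * p.1)) := by
      fun_prop
    exact ((measurable_const.sub h1).sub h2).mul h3
  have hG0 : ∀ p : ℝ × En n, 0 < p.1 → 0 ≤ G p := fun p hp => by
    have h1 := (hη_range (x + p.2, -R ^ 2 + p.1)).2
    have h2 := (hη_range (x - p.2, -R ^ 2 + p.1)).2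
    refine mul_nonneg (by rw [hzero]; linarith) (by positivity)
  let K : Set (ℝ × En n) := Set.Icc (R ^ 2 - 4) (R ^ 2 + 4) ×ˢ Metric.closedBall 0 (R + 2)
  have hKmeas : MeasurableSet K := measurableSet_Icc.prod measurableSet_closedBall
  have hKfin : μ K ≠ ⊤ := by
    rw [Measure.prod_prod]
    exact ENNReal.mul_ne_top
      ((Measure.restrict_apply_le _ _).trans_lt measure_Icc_lt_top).ne measure_closedBall_lt_top.ne
  have hGK : ∀ p, p ∉ K → G p = 0 := by
    rintro ⟨τ, y⟩ hp
    have h : (4 ≤ |-R ^ 2 + τ|) ∨ (R + 2 < ‖y‖) := by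
      by_contra! h
      have := abs_lt.mp h.1
      exact hp ⟨⟨by simp only; linarith, by simp only; linarith⟩, by simpa using h.2⟩
    have h1 : η (x + y, -R ^ 2 + τ) = 0 := by
      refine hη_outer _ _ (h.symm.imp_left fun h => ?_)
      have := norm_sub_le (x + y) x
      rw [add_sub_cancel_left] at this
      linarith
    have h2 : η (x - y, -R ^ 2 + τ) = 0 := by
      refine hη_outer _ _ (h.symm.imp_left fun h => ?_)
      have := norm_sub_le x (x - y)
      rw [sub_sub_cancel] at this
      linarith
    simp [G, hzero, h1, h2]
  have hGle : ∀ p ∈ K, ‖G p‖ ≤ 2 := by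
    rintro ⟨τ, y⟩ ⟨⟨hτ, -⟩, -⟩
    simp only at hτ
    have hτ1 : 1 ≤ τ := by linarith
    have h1 := hη_range (x + y, -R ^ 2 + τ)
    have h2 := hη_range (x - y, -R ^ 2 + τ)
    have h3 : τ ^ (-a) ≤ 1 := Real.rpow_le_one_of_one_le_of_nonpos hτ1 (by linarith)
    have h4 : Real.exp (-‖y‖ ^ 2 / (4 * τ)) ≤ 1 :=
      Real.exp_le_one_iff.mpr (div_nonpos_of_nonpos_of_nonneg (by simp) (by linarith))
    have h5 : τ ^ (-a) * Real.exp (-‖y‖ ^ 2 / (4 * τ)) ≤ 1 :=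
      mul_le_one₀ h3 (Real.exp_pos _).le h4
    rw [Real.norm_of_nonneg (hG0 _ (by simp only; linarith))]
    calc G (τ, y) ≤ 2 * 1 := by
          refine mul_le_mul ?_ h5 (by positivity) (by norm_num)
          simp only [hzero]
          linarith
      _ = 2 := by norm_num
  have hGint : Integrable G μ :=
    (integrableOn_iff_integrable_of_support_subset fun p hp => by
      by_contra h
      exact hp (hGK p h)).mp
      (Measure.integrableOn_of_bounded hKfin hGmeas.aestronglyMeasurable
        (ae_restrict_of_forall_mem hKmeas hGle))
  let S : Set (ℝ × En n) := Set.Icc (R ^ 2 - 1) (R ^ 2 + 1) ×ˢ Metric.closedBall (-x) 1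
  have hSmeas : MeasurableSet S := measurableSet_Icc.prod measurableSet_closedBall
  have hμS : μ.real S = 2 * V := by
    have h1 : (volume.restrict (Set.Ioi (0 : ℝ))).real (Set.Icc (R ^ 2 - 1) (R ^ 2 + 1)) = 2 := by
      rw [measureReal_restrict_apply measurableSet_Icc, Set.inter_eq_left.mpr
        (Set.Icc_subset_Ioi_iff (by linarith) |>.mpr (by linarith)), Real.volume_real_Icc_of_le (by linarith)]
      ring
    rw [measureReal_prod_prod, h1, hV, measureReal_def, measureReal_def,
      Measure.addHaar_closedBall_center]
  have hGS : ∀ p ∈ S, (2 * R ^ 2) ^ (-a) * Real.exp (-2) ≤ G p := by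
    rintro ⟨τ, y⟩ ⟨⟨hτ1, hτ2⟩, hy⟩
    simp only at hτ1 hτ2 hy
    have hxy : ‖x + y‖ ≤ 1 := by
      rw [mem_closedBall_iff_norm, sub_neg_eq_add, add_comm] at hy
      exact hy
    have hη1 : η (x + y, -R ^ 2 + τ) = -1 :=
      hη_inner _ _ hxy (abs_le.mpr ⟨by linarith, by linarith⟩)
    have h2 := (hη_range (x - y, -R ^ 2 + τ)).2
    have hyR : ‖y‖ ≤ R + 1 := by
      have := norm_sub_le (x + y) x
      rw [add_sub_cancel_left] at this
      linarith
    have hτ0 : 0 < τ := by linarith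
    have h3 : (2 * R ^ 2) ^ (-a) ≤ τ ^ (-a) :=
      Real.rpow_le_rpow_of_nonpos hτ0 (by linarith) (by linarith)
    have h4 : Real.exp (-2) ≤ Real.exp (-‖y‖ ^ 2 / (4 * τ)) := by
      rw [Real.exp_le_exp, le_div_iff₀ (by linarith)]
      nlinarith [norm_nonneg y]
    calc _ ≤ 1 * (τ ^ (-a) * Real.exp (-‖y‖ ^ 2 / (4 * τ))) := by
          rw [one_mul]
          gcongr
      _ ≤ G (τ, y) := by
          refine mul_le_mul_of_nonneg_right ?_ (by positivity)
          simp only [hzero, hη1]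
          linarith
  have hpos : ∀ᵐ p ∂μ, 0 ≤ G p := by
    have h : μ = (volume : Measure (ℝ × En n)).restrict (Set.Ioi 0 ×ˢ Set.univ) := by
      rw [Measure.volume_eq_prod, ← Measure.prod_restrict, Measure.restrict_univ]
    rw [h]
    exact ae_restrict_of_forall_mem (measurableSet_Ioi.prod MeasurableSet.univ)
      fun p hp => hG0 p hp.1
  have hmain : 2 * V * ((2 * R ^ 2) ^ (-a) * Real.exp (-2)) ≤ ∫ p, G p ∂μ := by
    have hSfin : μ S ≠ ⊤ := by
      intro h
      rw [measureReal_def, h] at hμS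
      simp at hμS
      linarith
    calc _ = μ.real S * ((2 * R ^ 2) ^ (-a) * Real.exp (-2)) := by rw [hμS]
      _ = ∫ _ in S, (2 * R ^ 2) ^ (-a) * Real.exp (-2) ∂μ := by rw [setIntegral_const, smul_eq_mul]
      _ ≤ ∫ p in S, G p ∂μ :=
          setIntegral_mono_on (integrableOn_const hSfin) hGint.integrableOn hSmeas hGS
      _ ≤ ∫ p, G p ∂μ := setIntegral_le_integral hGint hpos
  have hval : rightHeatR n s η x (-R ^ 2) = Cns n s / 2 * ∫ p, G p ∂μ := by
    rw [integral_prod G hGint]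
    rfl
  rw [hval]
  refine le_trans ?_ (le_abs_self _)
  rw [Real.mul_rpow (by norm_num) (by positivity)] at hmain
  calc _ = Cns n s / 2 * (2 * V * (2 ^ (-a) * (R ^ 2) ^ (-a) * Real.exp (-2))) := by ring
    _ ≤ _ := by gcongr

/-- A bound `c * r ^ (-a) ≤ C / r ^ (a + δ)` with `c, δ > 0` cannot hold for all large `r`. -/
theorem not_forall_mul_rpow_neg_le_div {a c C δ : ℝ} (hc : 0 < c) (hδ : 0 < δ) (r₀ : ℝ) :
    ¬ ∀ r ≥ r₀, c * r ^ (-a) ≤ C / r ^ (a + δ) := by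
  intro h
  obtain ⟨r, hr₀, hr, hr1⟩ := ((Filter.eventually_ge_atTop r₀).and
    (((tendsto_rpow_atTop hδ).eventually_gt_atTop (C / c)).and
      (Filter.eventually_gt_atTop 0))).exists
  have h1 := h r hr₀
  rw [le_div_iff₀ (by positivity), mul_assoc, ← Real.rpow_add hr1, neg_add_cancel_left] at h1
  rw [div_lt_iff₀ hc] at hr
  linarith

/-- Optimality of the decay exponents in the estimate for `(∂_t−Δ)^s_{right} η`:
neither exponent (in `|t|` nor in `|x|`) can be improved on the region `|x|² ∼ |t|`. -/
theorem rightHeat_decay_exponents_optimal (n : ℕ) (hn : 1 ≤ n)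
    (s : ℝ) (hs0 : 0 < s) (hs1 : s < 1)
    (η : En n × ℝ → ℝ) (hη_smooth : ContDiff ℝ (⊤ : ℕ∞) η) (hη_supp : HasCompactSupport η)
    (hη_range : ∀ p, -1 ≤ η p ∧ η p ≤ 0)
    (hη_inner : ∀ (x : En n) (t : ℝ), ‖x‖ ≤ 1 → |t| ≤ 1 → η (x, t) = -1)
    (hη_outer : ∀ (x : En n) (t : ℝ), 2 ≤ ‖x‖ ∨ 4 ≤ |t| → η (x, t) = 0) :
    (¬ ∃ C₁ > (0 : ℝ), ∃ δ₁ > (0 : ℝ), ∀ (x : En n) (t : ℝ),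
        |t| / 2 ≤ ‖x‖ ^ 2 → ‖x‖ ^ 2 ≤ 2 * |t| →
        |rightHeatR n s η x t| ≤
          C₁ / (1 + ‖x‖ ^ ((n : ℝ) + 2 + 2 * s) + |t| ^ ((n : ℝ) / 2 + 1 + s + δ₁))) ∧
    (¬ ∃ C₂ > (0 : ℝ), ∃ δ₂ > (0 : ℝ), ∀ (x : En n) (t : ℝ),
        |t| / 2 ≤ ‖x‖ ^ 2 → ‖x‖ ^ 2 ≤ 2 * |t| →
        |rightHeatR n s η x t| ≤
          C₂ / (1 + ‖x‖ ^ ((n : ℝ) + 2 + 2 * s + δ₂) + |t| ^ ((n : ℝ) / 2 + 1 + s))) := by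
  obtain ⟨c, hc, hlow⟩ := rightHeatR_lower_bound n hs0 hs1 hη_smooth.continuous
    hη_range hη_inner hη_outer
  have hpoint : ∀ r ≥ (9 : ℝ), ∃ x : En n, ‖x‖ ^ 2 = r ∧ 3 ≤ ‖x‖ := fun r hr => by
    refine ⟨EuclideanSpace.single ⟨0, hn⟩ (√r), ?_, ?_⟩
    · simp [abs_of_nonneg, Real.sq_sqrt (show 0 ≤ r by linarith)]
    · simpa [abs_of_nonneg] using Real.le_sqrt_of_sq_le (by linarith)
  have hpow : ∀ (x : En n) (b : ℝ), (‖x‖ ^ 2) ^ b = ‖x‖ ^ (2 * b) := fun x b => by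
    rw [Real.rpow_mul (norm_nonneg x), Real.rpow_two]
  refine ⟨?_, ?_⟩
  · rintro ⟨C, hC, δ, hδ, h⟩
    refine not_forall_mul_rpow_neg_le_div (a := (n : ℝ) / 2 + 1 + s) (C := C) hc hδ 9 fun r hr => ?_
    obtain ⟨x, rfl, hx⟩ := hpoint r hr
    have habs : |-‖x‖ ^ 2| = ‖x‖ ^ 2 := by rw [abs_neg, abs_of_nonneg (sq_nonneg _)]
    refine (hlow x hx).trans ((h x (-‖x‖ ^ 2) (by rw [habs]; linarith)
      (by rw [habs]; linarith)).trans ?_)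
    rw [habs]
    refine div_le_div_of_nonneg_left hC.le (Real.rpow_pos_of_pos (by linarith) _) ?_
    have := Real.rpow_nonneg (norm_nonneg x) ((n : ℝ) + 2 + 2 * s)
    linarith
  · rintro ⟨C, hC, δ, hδ, h⟩
    refine not_forall_mul_rpow_neg_le_div (a := (n : ℝ) / 2 + 1 + s) (C := C) hc
      (half_pos hδ) 9 fun r hr => ?_
    obtain ⟨x, rfl, hx⟩ := hpoint r hr
    have habs : |-‖x‖ ^ 2| = ‖x‖ ^ 2 := by rw [abs_neg, abs_of_nonneg (sq_nonneg _)]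
    refine (hlow x hx).trans ((h x (-‖x‖ ^ 2) (by rw [habs]; linarith)
      (by rw [habs]; linarith)).trans ?_)
    rw [habs]
    refine div_le_div_of_nonneg_left hC.le (Real.rpow_pos_of_pos (by linarith) _) ?_
    rw [hpow x ((n : ℝ) / 2 + 1 + s + δ / 2),
      show 2 * ((n : ℝ) / 2 + 1 + s + δ / 2) = (n : ℝ) + 2 + 2 * s + δ by ring]
    have := Real.rpow_nonneg (sq_nonneg ‖x‖) ((n : ℝ) / 2 + 1 + s)
    linarith
end
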